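/- arXiv:0711.4880 — 5 statements merged into one kernel-verified Lean document; each statement's English description precedes it below -/
import Mathlib

section
/- Let (A, 𝔪) be a two-dimensional analytically unramified Cohen–Macaulay Noetherian local ring with infinite residue field, and let I be an 𝔪-primary ideal of A with a minimal reduction Q. Then r_Q(I) ≤ ē_1(I) − ē_0(I) + ℓ_A(A/I) + 1, where ē_0(I) and ē_1(I) are the first two normal Hilbert coefficients of I, defined via the integral closure filtration { (I^n)‾ }_{n≥0}. -/
open IsLocalRing

/-- The reduction number `r_Q(I) = inf { n ≥ 0 | I^(n+1) = Q·I^n }`. -/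
noncomputable def redNum {A : Type*} [CommRing A] (Q I : Ideal A) : ℕ∞ :=
  sInf {n : ℕ∞ | ∃ m : ℕ, n = (m : ℕ∞) ∧ I ^ (m + 1) = Q * I ^ m}

/-- `Q` is a reduction of `I`. -/
def IsReduction {A : Type*} [CommRing A] (Q I : Ideal A) : Prop :=
  Q ≤ I ∧ ∃ n : ℕ, I ^ (n + 1) = Q * I ^ n

/-- `Q` is a minimal reduction of `I`. -/
def IsMinimalReduction {A : Type*} [CommRing A] (Q I : Ideal A) : Prop :=
  IsReduction Q I ∧ ∀ Q' : Ideal A, Q' ≤ Q → IsReduction Q' I → Q' = Q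

/-- A regular sequence on `A`. -/
def IsRegularSeq {A : Type*} [CommRing A] {m : ℕ} (a : Fin m → A) : Prop :=
  (∀ i : Fin m, ∀ x : A,
      a i * x ∈ Ideal.span (a '' {j | j < i}) → x ∈ Ideal.span (a '' {j | j < i})) ∧
    Ideal.span (Set.range a) ≠ ⊤

/-- The integral closure of an ideal `I`, as a set. -/
def idealIC {A : Type*} [CommRing A] (I : Ideal A) : Set A :=
  {x | ∃ m : ℕ, 0 < m ∧ ∃ c : ℕ → A, (∀ i ∈ Finset.Icc 1 m, c i ∈ I ^ i) ∧
    x ^ m + ∑ i ∈ Finset.Icc 1 m, c i * x ^ (m - i) = 0}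

/-- The integral closure of an ideal `I`, as an ideal (the ideal generated by the
set `idealIC I`, which coincides with it). -/
def idealICIdeal {A : Type*} [CommRing A] (I : Ideal A) : Ideal A :=
  Ideal.span (idealIC I)

/-- The length of an `A`-module `M`: the Krull dimension of its lattice of
submodules. -/
noncomputable def modLength (A : Type*) [CommRing A] (M : Type*) [AddCommGroup M]
    [Module A M] : WithBot ℕ∞ :=
  Order.krullDim (Submodule A M)

theorem AdicCompletion.exists_evalₐ_of_cauchy {R : Type*} [CommRing R] (I : Ideal R) (f : ℕ → R)
    (hf : ∀ n, f (n + 1) - f n ∈ I ^ n) :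
    ∃ z : AdicCompletion I R, ∀ n, evalₐ I n z = Ideal.Quotient.mk _ (f n) := by
  refine ⟨AdicCompletion.mk I R (AdicCauchySequence.mk I R f fun n => ?_), fun n => ?_⟩
  · rw [SModEq.comm, SModEq.sub_mem]
    simpa using hf n
  · simp

theorem Ideal.exists_pow_preimage_of_surjective {P R : Type*} [CommRing P] [CommRing R]
    (φ : P →+* R) (hφ : Function.Surjective φ) (J : Ideal P) (n : ℕ) {r : R}
    (hr : r ∈ (J.map φ) ^ n) : ∃ p ∈ J ^ n, φ p = r := by
  rw [← Ideal.map_pow] at hr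
  exact (Ideal.mem_map_iff_of_surjective φ hφ).1 hr

theorem AdicCompletion.isNoetherianRing_of_isNoetherianRing {R : Type*} [CommRing R]
    [IsNoetherianRing R] (I : Ideal R) : IsNoetherianRing (AdicCompletion I R) := by
  obtain ⟨s, hs⟩ := IsNoetherian.noetherian I
  let φ : MvPolynomial s R →+* R := MvPolynomial.eval (fun i => (i : R))
  have hφ : Function.Surjective φ := fun r => ⟨MvPolynomial.C r, by simp [φ]⟩
  let J := MvPolynomial.idealOfVars s R
  have hJ : J.map φ = I := by
    rw [← hs]
    simp only [J, MvPolynomial.idealOfVars, Ideal.map_span]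
    congr 1
    ext x
    simp [φ]
  have hle : ∀ n, J ^ n ≤ (I ^ n).comap φ := fun n => by
    rw [← hJ, ← Ideal.map_pow]; exact Ideal.le_comap_map
  let F : (n : ℕ) → MvPowerSeries s R →+* R ⧸ I ^ n := fun n =>
    (Ideal.quotientMap (I ^ n) φ (hle n)).comp
      (MvPowerSeries.truncTotalAlgHom s R n : MvPowerSeries s R →+* _)
  have hF : ∀ n p, F n p = Ideal.Quotient.mk _ (φ (MvPowerSeries.truncTotal n p)) := by
    intro n p
    simp only [F, RingHom.comp_apply, RingHom.coe_coe, MvPowerSeries.truncTotalAlgHom_apply]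
    exact Ideal.quotientMap_mk
  let G : MvPowerSeries s R →+* AdicCompletion I R := liftRingHom I F (by
    intro m n hmn
    ext p
    · simp only [RingHom.comp_apply, hF]
      simp only [Ideal.Quotient.factorPow, Ideal.Quotient.factor_mk]
      rw [Ideal.Quotient.eq, ← map_sub]
      exact hle m (MvPowerSeries.truncTotal_sub_truncTotal_mem_pow_idealOfVars hmn le_rfl _))
  refine isNoetherianRing_of_surjective _ _ G fun z => ?_
  have h1 : ∀ n, ∃ a : R, Ideal.Quotient.mk (I ^ n) a = evalₐ I n z := fun n =>
    Ideal.Quotient.mk_surjective _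
  choose a ha using h1
  have h2 : ∀ n, ∃ p ∈ J ^ n, φ p = a (n + 1) - a n := by
    intro n
    refine Ideal.exists_pow_preimage_of_surjective φ hφ J n ?_
    rw [hJ, ← Ideal.Quotient.eq, ha]
    obtain ⟨w, rfl⟩ := AdicCompletion.mk_surjective I R z
    have := ha (n + 1)
    rw [evalₐ_mk, Ideal.Quotient.eq] at this
    rw [evalₐ_mk, Ideal.Quotient.eq]
    have h3 := AdicCauchySequence.mk_eq_mk (Nat.le_succ n) w
    have h4 := (Submodule.Quotient.eq _).1 h3
    simp only [smul_eq_mul, Ideal.mul_top] at h4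
    have := add_mem (Ideal.pow_le_pow_right (Nat.le_succ n) this) h4
    simpa using this
  choose p hp hpa using h2
  obtain ⟨w, hw⟩ := exists_evalₐ_of_cauchy J
    (fun n => MvPolynomial.C (a 0) + ∑ i ∈ Finset.range n, p i) (fun n => by
      simpa [Finset.sum_range_succ] using hp n)
  have hsum : ∀ n, φ (MvPolynomial.C (a 0) + ∑ i ∈ Finset.range n, p i) = a n := by
    intro n
    simp only [map_add, map_sum, hpa, Finset.sum_range_sub]
    simp [φ]
  obtain ⟨q, rfl⟩ := (MvPowerSeries.toAdicCompletionAlgEquiv s R).surjective w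
  refine ⟨q, AdicCompletion.ext_evalₐ fun n => ?_⟩
  rw [evalₐ_liftRingHom, hF, ← ha, ← hsum, Ideal.Quotient.eq, ← map_sub]
  refine hle n ?_
  rw [← Ideal.Quotient.eq, ← hw n]
  change _ = evalₐ J n (MvPowerSeries.toAdicCompletion s R q)
  unfold MvPowerSeries.toAdicCompletion
  symm
  apply evalₐ_liftAlgHom
  exact fun {m n} h => AlgHom.ext fun p => by
    exact Ideal.Quotient.eq.2
      (MvPowerSeries.truncTotal_sub_truncTotal_mem_pow_idealOfVars h (le_refl m) p)

theorem Ideal.span_pair_pow_succ {A : Type*} [CommRing A] (x y : A) (n : ℕ) :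
    Ideal.span {x, y} ^ (n + 1) = Ideal.span {x} * Ideal.span {x, y} ^ n ⊔ Ideal.span {y ^ (n + 1)} := by
  have hQ : Ideal.span {x, y} = Ideal.span {x} ⊔ Ideal.span {y} := Ideal.span_insert x {y}
  induction n with
  | zero => simp [hQ]
  | succ n ih =>
    have hy : Ideal.span {y ^ (n + 1)} ≤ Ideal.span {x, y} ^ (n + 1) := by
      rw [← Ideal.span_singleton_pow]
      exact Ideal.pow_right_mono (by rw [hQ]; exact le_sup_right) _
    calc Ideal.span {x, y} ^ (n + 1 + 1)
        = Ideal.span {x, y} ^ (n + 1) * (Ideal.span {x} ⊔ Ideal.span {y}) := by rw [pow_succ, ← hQ]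
      _ = Ideal.span {x} * Ideal.span {x, y} ^ (n + 1) ⊔
          Ideal.span {y} * Ideal.span {x, y} ^ (n + 1) := by
        rw [Ideal.mul_sup, mul_comm, mul_comm _ (Ideal.span {y})]
      _ = _ := by
        refine le_antisymm (sup_le le_sup_left ?_) (sup_le le_sup_left ?_)
        · conv_lhs => rw [ih]
          rw [Ideal.mul_sup]
          refine sup_le (le_sup_of_le_left ?_) (le_sup_of_le_right ?_)
          · rw [mul_left_comm]
            refine Ideal.mul_mono_right ?_
            rw [pow_succ']
            exact Ideal.mul_mono_left (by rw [hQ]; exact le_sup_right)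
          · rw [Ideal.span_singleton_mul_span_singleton, ← pow_succ']
        · refine le_sup_of_le_right ?_
          rw [pow_succ' y, ← Ideal.span_singleton_mul_span_singleton]
          exact Ideal.mul_mono_right hy

theorem Ideal.mem_span_pair_pow_succ {A : Type*} [CommRing A] {x y : A} {n : ℕ} {z : A} :
    z ∈ Ideal.span {x, y} ^ (n + 1) ↔
      ∃ u ∈ Ideal.span {x, y} ^ n, ∃ c, z = x * u + c * y ^ (n + 1) := by
  rw [Ideal.span_pair_pow_succ, Submodule.mem_sup]
  constructor
  · rintro ⟨a, ha, b, hb, rfl⟩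
    obtain ⟨u, hu, rfl⟩ := Ideal.mem_span_singleton_mul.1 ha
    obtain ⟨c, rfl⟩ := Ideal.mem_span_singleton'.1 hb
    exact ⟨u, hu, c, rfl⟩
  · rintro ⟨u, hu, c, rfl⟩
    exact ⟨_, Ideal.mem_span_singleton_mul.2 ⟨u, hu, rfl⟩, _,
      Ideal.mem_span_singleton'.2 ⟨c, rfl⟩, rfl⟩

theorem Ideal.span_pair_pow_le_of_forall {A : Type*} [CommRing A] {x y : A} (n : ℕ) (K : Ideal A)
    (h : ∀ i j, i + j = n → x ^ i * y ^ j ∈ K) : Ideal.span {x, y} ^ n ≤ K := by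
  suffices H : ∀ m k, k + m = n → ∀ z ∈ Ideal.span {x, y} ^ m, x ^ k * z ∈ K by
    intro z hz
    simpa using H n 0 (by simp) z hz
  intro m
  induction m with
  | zero =>
    intro k hk z _
    exact K.mul_mem_right _ (by simpa using h k 0 (by simpa using hk))
  | succ m ih =>
    intro k hk z hz
    obtain ⟨u, hu, c, rfl⟩ := Ideal.mem_span_pair_pow_succ.1 hz
    rw [mul_add]
    refine add_mem ?_ ?_
    · have := ih (k + 1) (by omega) u hu
      rwa [pow_succ, mul_assoc] at this
    · rw [mul_left_comm]
      exact K.mul_mem_left _ (h k (m + 1) hk)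

/-- Every element of the affine chart `D[y/x]` has the form `d / x ^ r` with `d ∈ (x, y) ^ r`. -/
theorem exists_mul_pow_eq_of_mem_adjoin_div {D K : Type*} [CommRing D] [IsDomain D] [Field K]
    [Algebra D K] [IsFractionRing D K] {x y : D} (hx : x ≠ 0) {e : K}
    (he : e ∈ Algebra.adjoin D {algebraMap D K y / algebraMap D K x}) :
    ∃ r : ℕ, ∃ d ∈ Ideal.span {x, y} ^ r, e * algebraMap D K x ^ r = algebraMap D K d := by
  have hxK : algebraMap D K x ≠ 0 := by simpa using hx
  have hxm : ∀ n, x ^ n ∈ Ideal.span {x, y} ^ n := fun n =>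
    Ideal.pow_mem_pow (Ideal.subset_span (by simp)) n
  induction he using Algebra.adjoin_induction with
  | mem e he =>
    rw [Set.mem_singleton_iff] at he
    subst he
    exact ⟨1, y, by rw [pow_one]; exact Ideal.subset_span (by simp), by field_simp⟩
  | algebraMap a => exact ⟨0, a, by simp, by simp⟩
  | add a b _ _ iha ihb =>
    obtain ⟨r, c, hc, hac⟩ := iha
    obtain ⟨s, d, hd, hbd⟩ := ihb
    refine ⟨r + s, c * x ^ s + x ^ r * d, ?_, ?_⟩
    · rw [pow_add]
      exact add_mem (Ideal.mul_mem_mul hc (hxm s)) (Ideal.mul_mem_mul (hxm r) hd)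
    · simp only [map_add, map_mul, map_pow, ← hac, ← hbd]
      ring
  | mul a b _ _ iha ihb =>
    obtain ⟨r, c, hc, hac⟩ := iha
    obtain ⟨s, d, hd, hbd⟩ := ihb
    refine ⟨r + s, c * d, ?_, ?_⟩
    · rw [pow_add]
      exact Ideal.mul_mem_mul hc hd
    · simp only [map_mul, ← hac, ← hbd]
      ring

/-- If `a ≠ 0` has infinite asymptotic order along `x`, in a Noetherian domain, then `x` is a
unit. -/
theorem isUnit_of_forall_pow_dvd {E : Type*} [CommRing E] [IsDomain E] [IsNoetherianRing E]
    {x a : E} (hx : x ≠ 0) (ha : a ≠ 0) (h : ∀ n : ℕ, ∃ c : ℕ, ∀ k : ℕ, x ^ (n * k - c) ∣ a ^ k) :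
    IsUnit x := by
  by_contra hu
  obtain ⟨M, hM, hxM⟩ := exists_max_ideal_of_mem_nonunits hu
  have hle : Ideal.span {x} ≤ M := by rwa [Ideal.span_singleton_le_iff_mem]
  obtain ⟨P, hP, -⟩ := Ideal.exists_minimalPrimes_le (J := M) hle
  have hPp : P.IsPrime := hP.1.1
  have hxP : x ∈ P := hP.1.2 (Ideal.mem_span_singleton_self x)
  have hht : P.height ≤ 1 :=
    Ideal.height_le_one_of_isPrincipal_of_mem_minimalPrimes _ P hP
  obtain ⟨u, huP, s, hus⟩ : ∃ u, u ∉ P ∧ ∃ s, a ∣ u * x ^ s := by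
    by_contra! hcon
    have hdis : Disjoint (Ideal.span {a} : Set E) ((P.primeCompl ⊔ Submonoid.powers x : Submonoid E) : Set E) := by
      rw [Set.disjoint_left]
      intro z hz hz'
      obtain ⟨u, hu', w, ⟨s, rfl⟩, rfl⟩ := Submonoid.mem_sup.1 hz'
      exact hcon u hu' s (Ideal.mem_span_singleton.1 hz)
    obtain ⟨q, hq, haq, hdq⟩ := Ideal.exists_le_prime_disjoint _ _ hdis
    have hqP : q ≤ P := by
      intro z hz
      by_contra hzP
      exact Set.disjoint_left.1 hdq hz (SetLike.le_def.1 le_sup_left hzP)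
    have hxq : x ∉ q := fun hz =>
      Set.disjoint_left.1 hdq hz (SetLike.le_def.1 le_sup_right (Submonoid.mem_powers x))
    have hlt : q < P := lt_of_le_of_ne hqP (by rintro rfl; exact hxq hxP)
    have h1 := Ideal.height_add_one_le_of_lt_of_isPrime hlt
    have h2 : q.height ≠ 0 := by
      rw [Ne, Ideal.height_eq_zero_iff_eq_bot]
      rintro rfl
      exact ha (by simpa using haq (Ideal.mem_span_singleton_self a))
    have h3 : (1 : ℕ∞) ≤ q.height := by rwa [Order.one_le_iff_ne_zero]
    have h4 : (1 : ℕ∞) + 1 ≤ 1 := (add_le_add h3 le_rfl).trans (h1.trans hht)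
    exact absurd h4 (by decide)
  obtain ⟨c, hc⟩ := h (s + 1)
  obtain ⟨e, he⟩ := hus
  obtain ⟨f, hf⟩ := hc (c + 1)
  have hexp : (s + 1) * (c + 1) - c = s * (c + 1) + 1 := by
    rw [Nat.sub_eq_iff_eq_add (by nlinarith)]; ring
  have h5 : u ^ (c + 1) * x ^ (s * (c + 1)) = (x * (f * e ^ (c + 1))) * x ^ (s * (c + 1)) := by
    calc u ^ (c + 1) * x ^ (s * (c + 1)) = (u * x ^ s) ^ (c + 1) := by rw [mul_pow, ← pow_mul]
      _ = a ^ (c + 1) * e ^ (c + 1) := by rw [he, mul_pow]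
      _ = _ := by rw [hf, hexp]; ring
  have h6 := mul_right_cancel₀ (pow_ne_zero _ hx) h5
  exact huP (hPp.mem_of_pow_mem _ (h6 ▸ P.mul_mem_right _ hxP))

theorem exists_pow_mem_pow_succ_of_infinite_order {D : Type*} [CommRing D] [IsDomain D]
    [IsNoetherianRing D] {x y a : D} (ha : a ≠ 0)
    (h : ∀ n : ℕ, ∃ c : ℕ, ∀ k : ℕ, a ^ k ∈ Ideal.span {x, y} ^ (n * k - c)) :
    ∃ r, x ^ r ∈ Ideal.span {x, y} ^ (r + 1) := by
  by_cases hx : x = 0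
  · exact ⟨1, by simp [hx]⟩
  let K := FractionRing D
  have hxK : algebraMap D K x ≠ 0 := by simpa using hx
  let E := Algebra.adjoin D ({algebraMap D K y / algebraMap D K x} : Set K)
  have hE : IsNoetherianRing E := by
    refine isNoetherianRing_of_fg (R := D) ?_
    exact ⟨{algebraMap D K y / algebraMap D K x}, by simp [E]⟩
  have hinj : Function.Injective (algebraMap D E) := by
    intro a b hab
    exact IsFractionRing.injective D K (congrArg (algebraMap E K) hab)
  let t : E := ⟨algebraMap D K y / algebraMap D K x, Algebra.subset_adjoin rfl⟩
  have hyt : algebraMap D E y = algebraMap D E x * t := by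
    apply Subtype.ext
    change algebraMap D K y = algebraMap D K x * (algebraMap D K y / algebraMap D K x)
    rw [mul_div_assoc', mul_div_cancel_left₀ _ hxK]
  have hJ : (Ideal.span {x, y}).map (algebraMap D E) ≤ Ideal.span {algebraMap D E x} := by
    rw [Ideal.map_le_iff_le_comap, Ideal.span_le]
    rintro z (rfl | rfl)
    · exact Ideal.mem_span_singleton_self _
    · exact Ideal.mem_span_singleton.2 ⟨t, hyt⟩
  have hunit : IsUnit (algebraMap D E x) := by
    refine isUnit_of_forall_pow_dvd (a := algebraMap D E a) ?_ ?_ fun n => ?_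
    · rwa [Ne, map_eq_zero_iff _ hinj]
    · rwa [Ne, map_eq_zero_iff _ hinj]
    · obtain ⟨c, hc⟩ := h n
      refine ⟨c, fun k => ?_⟩
      have h1 := Ideal.mem_map_of_mem (algebraMap D E) (hc k)
      rw [Ideal.map_pow] at h1
      have h2 := Ideal.pow_right_mono hJ _ h1
      rwa [Ideal.span_singleton_pow, Ideal.mem_span_singleton, map_pow] at h2
  obtain ⟨v, hv⟩ := hunit.exists_right_inv
  obtain ⟨r, d, hd, hr⟩ := exists_mul_pow_eq_of_mem_adjoin_div (K := K) hx v.2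
  refine ⟨r, ?_⟩
  have hv' : algebraMap D K x * (v : K) = 1 := congrArg (algebraMap E K) hv
  have : x ^ r = x * d := by
    apply IsFractionRing.injective D K
    rw [map_pow, map_mul, ← hr, ← mul_assoc, hv', one_mul]
  rw [this, pow_succ']
  exact Ideal.mul_mem_mul (Ideal.subset_span (by simp)) hd

theorem false_of_infinite_order {D : Type*} [CommRing D] [IsDomain D]
    [IsNoetherianRing D] [IsLocalRing D] {x y a : D} (ha : a ≠ 0)
    (hx : x ∈ IsLocalRing.maximalIdeal D) (hy : y ∈ IsLocalRing.maximalIdeal D)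
    (h : ∀ n : ℕ, ∃ c : ℕ, ∀ k : ℕ, a ^ k ∈ Ideal.span {x, y} ^ (n * k - c)) : False := by
  set J := Ideal.span {x, y} with hJ
  obtain ⟨r, hr⟩ := exists_pow_mem_pow_succ_of_infinite_order ha h
  obtain ⟨s, hs⟩ := exists_pow_mem_pow_succ_of_infinite_order (x := y) (y := x) ha
    (by rwa [Set.pair_comm])
  rw [Set.pair_comm, ← hJ] at hs
  rw [← hJ] at hr
  have hle : J ^ (r + s) ≤ J ^ (r + s + 1) := by
    refine Ideal.span_pair_pow_le_of_forall _ _ fun i j hij => ?_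
    have hxm : ∀ n, x ^ n ∈ J ^ n := fun n => Ideal.pow_mem_pow (Ideal.subset_span (by simp)) n
    have hym : ∀ n, y ^ n ∈ J ^ n := fun n => Ideal.pow_mem_pow (Ideal.subset_span (by simp)) n
    by_cases hi : r ≤ i
    · obtain ⟨k, rfl⟩ := Nat.exists_eq_add_of_le hi
      rw [show r + s + 1 = (r + 1) + k + j by omega, pow_add, pow_add, pow_add x]
      exact Ideal.mul_mem_mul (Ideal.mul_mem_mul hr (hxm k)) (hym j)
    · obtain ⟨k, rfl⟩ := Nat.exists_eq_add_of_le (show s ≤ j by omega)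
      rw [show r + s + 1 = i + ((s + 1) + k) by omega, pow_add, pow_add _ (s + 1) k, pow_add y]
      exact Ideal.mul_mem_mul (hxm i) (Ideal.mul_mem_mul hs (hym k))
  have hJm : J ≤ IsLocalRing.maximalIdeal D := by
    rw [hJ, Ideal.span_le]
    rintro z (rfl | rfl) <;> assumption
  have hbot : J ^ (r + s) = ⊥ := by
    refine Submodule.eq_bot_of_le_smul_of_le_jacobson_bot J _ (IsNoetherian.noetherian _) ?_
      (hJm.trans (IsLocalRing.maximalIdeal_le_jacobson _))
    rwa [smul_eq_mul, ← pow_succ']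
  obtain ⟨c, hc⟩ := h 1
  have h1 := hc (r + s + c)
  rw [one_mul, Nat.add_sub_cancel, hbot, Ideal.mem_bot] at h1
  exact pow_ne_zero _ ha h1

theorem isArtinianRing_quotient_of_pow_le {A : Type*} [CommRing A] [IsNoetherianRing A]
    [IsLocalRing A] {J : Ideal A} {n : ℕ} (h : IsLocalRing.maximalIdeal A ^ n ≤ J) :
    IsArtinianRing (A ⧸ J) := by
  by_cases hJ : J = ⊤
  · subst hJ
    have := Ideal.Quotient.subsingleton_iff.2 (rfl : (⊤ : Ideal A) = ⊤)
    infer_instance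
  have := Ideal.Quotient.nontrivial_iff.2 hJ
  have : IsLocalRing (A ⧸ J) :=
    IsLocalRing.of_surjective' (Ideal.Quotient.mk J) Ideal.Quotient.mk_surjective
  rw [isArtinianRing_iff_isNilpotent_maximalIdeal]
  refine ⟨n, ?_⟩
  rw [← IsLocalRing.map_maximalIdeal_of_surjective _ Ideal.Quotient.mk_surjective, ← Ideal.map_pow,
    Ideal.zero_eq_bot, Ideal.map_eq_bot_iff_le_ker, Ideal.mk_ker]
  exact h

theorem AdicCompletion.mem_map_pow_of_evalₐ_eq_zero {A : Type*} [CommRing A] [IsNoetherianRing A]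
    (I : Ideal A) (n : ℕ) (z : AdicCompletion I A) (hz : evalₐ I n z = 0) :
    z ∈ (I ^ n).map (algebraMap A (AdicCompletion I A)) := by
  have h := AdicCompletion.pow_smul_top_eq_ker_eval (M := A) (n := n)
    (IsNoetherian.noetherian I : I.FG)
  rw [← Submodule.restrictScalars_mem A, ← Ideal.smul_top_eq_map, h, LinearMap.mem_ker]
  obtain ⟨w, rfl⟩ := AdicCompletion.mk_surjective I A z
  rw [evalₐ_mk, Ideal.Quotient.eq_zero_iff_mem] at hz
  rw [eval_apply, mk_apply_coe, Submodule.mkQ_apply, Submodule.Quotient.mk_eq_zero]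
  simpa using hz

/-- In a reduced completion, an element of infinite asymptotic `(x, y)`-adic order vanishes. -/
theorem eq_zero_of_infinite_order {B : Type*} [CommRing B] [IsNoetherianRing B] [IsLocalRing B]
    [IsReduced B] {x y a : B} (hx : x ∈ IsLocalRing.maximalIdeal B)
    (hy : y ∈ IsLocalRing.maximalIdeal B)
    (h : ∀ n : ℕ, ∃ c : ℕ, ∀ k : ℕ, a ^ k ∈ Ideal.span {x, y} ^ (n * k - c)) : a = 0 := by
  have hnil : a ∈ nilradical B := by
    rw [nilradical_eq_sInf, Submodule.mem_sInf]
    intro p hp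
    have hp' : Ideal.IsPrime p := hp
    by_contra hap
    have : IsLocalRing (B ⧸ p) :=
      IsLocalRing.of_surjective' (Ideal.Quotient.mk p) Ideal.Quotient.mk_surjective
    have hloc : IsLocalHom (Ideal.Quotient.mk p) :=
      Function.Surjective.isLocalHom _ Ideal.Quotient.mk_surjective
    refine false_of_infinite_order (D := B ⧸ p) (x := Ideal.Quotient.mk p x)
      (y := Ideal.Quotient.mk p y) (a := Ideal.Quotient.mk p a) ?_ ?_ ?_ fun n => ?_
    · rwa [Ne, Ideal.Quotient.eq_zero_iff_mem]
    · rw [IsLocalRing.mem_maximalIdeal]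
      exact (map_mem_nonunits_iff _ _).2 hx
    · exact (map_mem_nonunits_iff _ _).2 hy
    · obtain ⟨c, hc⟩ := h n
      refine ⟨c, fun k => ?_⟩
      have := Ideal.mem_map_of_mem (Ideal.Quotient.mk p) (hc k)
      rwa [Ideal.map_pow, Ideal.map_span, Set.image_pair, map_pow] at this
  exact (mem_nilradical.1 hnil).eq_zero

/-- A descending chain of ideals that is not contained in `𝔪 ^ c` produces a coherent sequence
modulo the powers of `𝔪`. -/
theorem exists_cauchy_of_not_le {A : Type*} [CommRing A] [IsNoetherianRing A] [IsLocalRing A]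
    (F : ℕ → Ideal A) (hF : Antitone F) (c : ℕ)
    (hc : ∀ N, ¬ F N ≤ IsLocalRing.maximalIdeal A ^ c) :
    ∃ f : ℕ → A, (∀ n, f n ∈ F n ⊔ IsLocalRing.maximalIdeal A ^ n) ∧
      (∀ n, f (n + 1) - f n ∈ IsLocalRing.maximalIdeal A ^ n) ∧
      f c ∉ IsLocalRing.maximalIdeal A ^ c := by
  set m := IsLocalRing.maximalIdeal A with hm
  have hstab : ∀ n, ∃ N, n ≤ N ∧ ∀ M, F N ⊔ m ^ n ≤ F M ⊔ m ^ n := by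
    intro n
    have hart : IsArtinianRing (A ⧸ m ^ n) := isArtinianRing_quotient_of_pow_le le_rfl
    obtain ⟨N, hN⟩ := IsArtinian.monotone_stabilizes (R := A ⧸ m ^ n) (M := A ⧸ m ^ n)
      ⟨fun N => OrderDual.toDual ((F N).map (Ideal.Quotient.mk (m ^ n))),
        fun a b hab => Ideal.map_mono (hF hab)⟩
    refine ⟨max N n, le_max_right _ _, fun M => sup_le ?_ le_sup_right⟩
    have h1 : (F (max N n)).map (Ideal.Quotient.mk (m ^ n)) ≤
        (F M).map (Ideal.Quotient.mk (m ^ n)) := by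
      have h2 := hN (max N M) (le_max_left _ _)
      have h3 : (F N).map (Ideal.Quotient.mk (m ^ n)) =
        (F (max N M)).map (Ideal.Quotient.mk (m ^ n)) := h2
      exact (Ideal.map_mono (hF (le_max_left _ _))).trans
        (h3.le.trans (Ideal.map_mono (hF (le_max_right _ _))))
    have h4 := Ideal.map_le_iff_le_comap.1 h1
    rwa [Ideal.comap_map_of_surjective _ Ideal.Quotient.mk_surjective,
      ← RingHom.ker_eq_comap_bot, Ideal.mk_ker] at h4
  choose N hnN hN using hstab
  have hstep : ∀ n, ∀ z : A, (∀ M, z ∈ F M ⊔ m ^ n) →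
      ∃ z', (∀ M, z' ∈ F M ⊔ m ^ (n + 1)) ∧ z' - z ∈ m ^ n := by
    intro n z hz
    obtain ⟨f, hf, g, hg, rfl⟩ := Submodule.mem_sup.1 (hz (N (n + 1)))
    exact ⟨f, fun M => hN (n + 1) M (Ideal.mem_sup_left hf), by simpa using hg⟩
  choose! S hS hS' using hstep
  obtain ⟨z, hz, hzc⟩ := SetLike.not_le_iff_exists.1 (hc (N c))
  have hzE : ∀ M, z ∈ F M ⊔ m ^ c := fun M => hN c M (Ideal.mem_sup_left hz)
  let g : ℕ → A := fun i => Nat.rec z (fun i w => S (c + i) w) i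
  have hg : ∀ i, ∀ M, g i ∈ F M ⊔ m ^ (c + i) := by
    intro i
    induction i with
    | zero => exact hzE
    | succ i ih => exact hS (c + i) (g i) ih
  have hg' : ∀ i, g (i + 1) - g i ∈ m ^ (c + i) := fun i => hS' (c + i) (g i) (hg i)
  have hgz : ∀ i, g i - z ∈ m ^ c := by
    intro i
    induction i with
    | zero => simp [g]
    | succ i ih =>
      have := add_mem (Ideal.pow_le_pow_right (Nat.le_add_right c i) (hg' i)) ih
      simpa using this
  refine ⟨g, fun n => (sup_le_sup le_rfl (Ideal.pow_le_pow_right (Nat.le_add_left n c)) : F n ⊔ m ^ (c + n) ≤ _) (hg n n),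
    fun n => Ideal.pow_le_pow_right (Nat.le_add_left n c) (hg' n), fun h => hzc ?_⟩
  simpa using sub_mem h (hgz c)

theorem exists_le_pow_of_infinite_order {A : Type*} [CommRing A] [IsNoetherianRing A]
    [IsLocalRing A] (hred : IsReduced (AdicCompletion (IsLocalRing.maximalIdeal A) A))
    {x y : A} (hx : x ∈ IsLocalRing.maximalIdeal A) (hy : y ∈ IsLocalRing.maximalIdeal A)
    {h : ℕ} (hQ : IsLocalRing.maximalIdeal A ^ h ≤ Ideal.span {x, y})
    (F : ℕ → Ideal A) (hF : Antitone F)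
    (hFQ : ∀ n, ∀ z ∈ F n, ∃ c : ℕ, ∀ k : ℕ, z ^ k ∈ Ideal.span {x, y} ^ (n * k - c)) (c : ℕ) :
    ∃ N, F N ≤ IsLocalRing.maximalIdeal A ^ c := by
  by_contra! hcon
  set m := IsLocalRing.maximalIdeal A with hm
  obtain ⟨f, hf, hf', hfc⟩ := exists_cauchy_of_not_le F hF c hcon
  obtain ⟨a, ha⟩ := AdicCompletion.exists_evalₐ_of_cauchy m f hf'
  have hnoeth := AdicCompletion.isNoetherianRing_of_isNoetherianRing m
  let φ := algebraMap A (AdicCompletion m A)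
  have hφm : ∀ z ∈ m, φ z ∈ IsLocalRing.maximalIdeal (AdicCompletion m A) := by
    intro z hz
    rw [AdicCompletion.maximalIdeal_eq_map]
    exact Ideal.mem_map_of_mem _ hz
  have ha0 : a = 0 := by
    refine eq_zero_of_infinite_order (hφm x hx) (hφm y hy) fun n => ?_
    set J := Ideal.span {φ x, φ y} with hJ
    have hJ' : J = (Ideal.span {x, y}).map φ := by rw [Ideal.map_span, Set.image_pair]
    let M := (h + 1) * n
    have hnM : n ≤ M := Nat.le_mul_of_pos_left n (Nat.succ_pos h)
    have hmM : m ^ M ≤ Ideal.span {x, y} ^ n := by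
      rw [pow_mul]
      exact Ideal.pow_right_mono ((Ideal.pow_le_pow_right (Nat.le_succ h)).trans hQ) _
    obtain ⟨z, hz, w, hw, hzw⟩ := Submodule.mem_sup.1 (hf M)
    obtain ⟨e, he⟩ := hFQ n z (hF hnM hz)
    have hg : a - φ z ∈ J ^ n := by
      have h1 : a - φ (f M) ∈ (m ^ M).map φ := by
        apply AdicCompletion.mem_map_pow_of_evalₐ_eq_zero
        rw [map_sub, ha, sub_eq_zero]
        exact ((AdicCompletion.evalₐ m M).commutes (f M)).symm
      have h2 : φ w ∈ (m ^ M).map φ := Ideal.mem_map_of_mem _ hw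
      have h3 : a - φ z ∈ (m ^ M).map φ := by
        have := add_mem h1 h2
        rwa [← hzw, map_add, sub_add_eq_sub_sub, sub_add_cancel] at this
      rw [hJ', ← Ideal.map_pow]
      exact Ideal.map_mono hmM h3
    refine ⟨e, fun k => ?_⟩
    rw [← sub_add_cancel a (φ z), add_pow]
    refine Ideal.sum_mem _ fun i hi => Ideal.mul_mem_right _ _ ?_
    have hik : i ≤ k := by simpa [Nat.lt_succ_iff] using hi
    have h1 : (a - φ z) ^ i ∈ J ^ (n * i) := by rw [pow_mul]; exact Ideal.pow_mem_pow hg i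
    have h2 : φ z ^ (k - i) ∈ J ^ (n * (k - i) - e) := by
      rw [hJ', ← Ideal.map_pow, ← map_pow]
      exact Ideal.mem_map_of_mem _ (he _)
    have h3 := Ideal.mul_mem_mul h1 h2
    rw [← pow_add] at h3
    refine Ideal.pow_le_pow_right ?_ h3
    have : n * k = n * i + n * (k - i) := by rw [← mul_add, Nat.add_sub_cancel' hik]
    omega
  apply hfc
  rw [← Ideal.Quotient.eq_zero_iff_mem, ← ha, ha0, map_zero]

/-- A pair `x, y` of nonzerodivisors with only the trivial syzygy. -/
structure IsRegPair {A : Type*} [CommRing A] (x y : A) : Prop where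
  left : ∀ u, x * u = 0 → u = 0
  right : ∀ u, y * u = 0 → u = 0
  syz : ∀ u v, x * u = y * v → ∃ w, u = y * w ∧ v = x * w

namespace IsRegPair

variable {A : Type*} [CommRing A] {x y : A}

theorem symm (h : IsRegPair x y) : IsRegPair y x where
  left := h.right
  right := h.left
  syz u v huv := by
    obtain ⟨w, hw, hw'⟩ := h.syz v u huv.symm
    exact ⟨w, hw', hw⟩

theorem syz_pow (h : IsRegPair x y) (n : ℕ) : ∀ u v, x * u = y ^ n * v →
    ∃ w, u = y ^ n * w ∧ v = x * w := by
  induction n with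
  | zero =>
    intro u v huv
    exact ⟨u, by simp, by simpa using huv.symm⟩
  | succ n ih =>
    intro u v huv
    obtain ⟨w, hw, hw'⟩ := ih u (y * v) (by rw [huv]; ring)
    obtain ⟨w', h1, h2⟩ := h.syz w v hw'.symm
    exact ⟨w', by rw [hw, h1]; ring, h2⟩

theorem left_pow (h : IsRegPair x y) (n : ℕ) (u : A) (hu : x ^ n * u = 0) : u = 0 := by
  induction n with
  | zero => simpa using hu
  | succ n ih => exact ih (h.left _ (by rw [← mul_assoc, ← pow_succ', hu]))

theorem mem_pow_of_mul_left_mem (h : IsRegPair x y) {n : ℕ} {z : A}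
    (hz : x * z ∈ Ideal.span {x, y} ^ (n + 1)) : z ∈ Ideal.span {x, y} ^ n := by
  obtain ⟨u, hu, c, hc⟩ := Ideal.mem_span_pair_pow_succ.1 hz
  obtain ⟨w, hw, -⟩ := h.syz_pow (n + 1) (z - u) c (by rw [mul_sub, hc]; ring)
  rw [← sub_add_cancel z u, hw]
  refine add_mem (Ideal.mul_mem_right _ _ ?_) hu
  exact Ideal.pow_le_pow_right (Nat.le_succ n)
    (Ideal.pow_mem_pow (Ideal.subset_span (by simp)) (n + 1))

theorem mem_pow_of_pow_mul_left_mem (h : IsRegPair x y) {n : ℕ} (i : ℕ) {z : A}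
    (hz : x ^ i * z ∈ Ideal.span {x, y} ^ n) : z ∈ Ideal.span {x, y} ^ (n - i) := by
  induction i generalizing n with
  | zero => simpa using hz
  | succ i ih =>
    rcases n with _ | n
    · simp
    · rw [Nat.add_sub_add_right]
      refine ih (h.mem_pow_of_mul_left_mem ?_)
      rwa [← mul_assoc, ← pow_succ']

theorem mem_pow_succ_of_pow_mul_mem (h : IsRegPair x y) (p a : ℕ) : ∀ {z w : A},
    z ∈ Ideal.span {x, y} ^ a →
    y ^ p * z - x ^ (a + 1) * w ∈ Ideal.span {x, y} ^ (a + p + 1) →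
    z ∈ Ideal.span {x, y} ^ (a + 1) := by
  induction a with
  | zero =>
    intro z w _ hz
    rw [zero_add] at hz
    obtain ⟨u, _, c, hc⟩ := Ideal.mem_span_pair_pow_succ.1 hz
    obtain ⟨v, -, hv⟩ := h.syz_pow p (w + u) (z - c * y) (by linear_combination -hc)
    rw [zero_add, pow_one, Ideal.mem_span_pair]
    exact ⟨v, c, by linear_combination -hv⟩
  | succ a ih =>
    intro z w hz hzw
    obtain ⟨u, hu, c, rfl⟩ := Ideal.mem_span_pair_pow_succ.1 hz
    obtain ⟨u', hu', c', hc'⟩ := Ideal.mem_span_pair_pow_succ.1 hzw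
    obtain ⟨v, hv, hv'⟩ := h.syz_pow (a + 1 + p) (y ^ p * u - x ^ (a + 1) * w - u')
      (c' * y - c) (by linear_combination hc')
    have hy : ∀ n, y ^ n ∈ Ideal.span {x, y} ^ n := fun n =>
      Ideal.pow_mem_pow (Ideal.subset_span (by simp)) n
    have hu2 : u ∈ Ideal.span {x, y} ^ (a + 1) := by
      refine ih (w := w) hu ?_
      rw [sub_eq_iff_eq_add.1 hv, show a + p + 1 = a + 1 + p by ring]
      exact add_mem (Ideal.mul_mem_right _ _ (hy _)) hu'
    have hc : c ∈ Ideal.span {x, y} :=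
      Ideal.mem_span_pair.2 ⟨-v, c', by linear_combination hv'⟩
    refine add_mem ?_ ?_
    · rw [pow_succ']
      exact Ideal.mul_mem_mul (Ideal.subset_span (by simp)) hu2
    · rw [pow_succ']
      exact Ideal.mul_mem_mul hc (hy _)

end IsRegPair

theorem length_quotient_eq_add {A : Type*} [CommRing A] {J K : Ideal A} {x : A}
    (h : ∀ z, x * z ∈ J ↔ z ∈ K) :
    Module.length A (A ⧸ J) = Module.length A (A ⧸ K) +
      Module.length A (A ⧸ (J ⊔ Ideal.span {x})) := by
  have hK : K ≤ Submodule.comap (LinearMap.mulLeft A x) J := fun z hz => (h z).2 hz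
  have hJ : J ≤ Submodule.comap LinearMap.id (J ⊔ Ideal.span {x}) := le_sup_left
  refine Module.length_eq_add_of_exact (Submodule.mapQ K J (LinearMap.mulLeft A x) hK)
    (Submodule.mapQ J (J ⊔ Ideal.span {x}) LinearMap.id hJ) ?_ ?_ ?_
  · rw [← LinearMap.ker_eq_bot, Submodule.eq_bot_iff]
    intro z hz
    obtain ⟨z, rfl⟩ := Submodule.Quotient.mk_surjective _ z
    rw [LinearMap.mem_ker, Submodule.mapQ_apply, Submodule.Quotient.mk_eq_zero] at hz
    rw [Submodule.Quotient.mk_eq_zero]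
    exact (h z).1 hz
  · intro z
    obtain ⟨z, rfl⟩ := Submodule.Quotient.mk_surjective _ z
    exact ⟨Submodule.Quotient.mk z, by simp⟩
  · intro z
    obtain ⟨z, rfl⟩ := Submodule.Quotient.mk_surjective _ z
    rw [Submodule.mapQ_apply, LinearMap.id_apply, Submodule.Quotient.mk_eq_zero, Set.mem_range]
    constructor
    · intro hz
      obtain ⟨a, ha, b, hb, hab⟩ := Submodule.mem_sup.1 hz
      obtain ⟨c, rfl⟩ := Ideal.mem_span_singleton.1 hb
      refine ⟨Submodule.Quotient.mk c, ?_⟩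
      rw [Submodule.mapQ_apply, Submodule.Quotient.eq, LinearMap.mulLeft_apply, ← hab]
      simpa using ha
    · rintro ⟨c, hc⟩
      obtain ⟨c, rfl⟩ := Submodule.Quotient.mk_surjective _ c
      rw [Submodule.mapQ_apply, Submodule.Quotient.eq, LinearMap.mulLeft_apply] at hc
      have := sub_mem (Ideal.mem_sup_right (Ideal.mem_span_singleton.2 ⟨c, rfl⟩) :
          x * c ∈ J ⊔ Ideal.span {x})
        (Ideal.mem_sup_left hc : x * c - z ∈ J ⊔ Ideal.span {x})
      simpa using this

namespace IsRegPair

variable {A : Type*} [CommRing A] {x y : A}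

theorem length_quotient_left_pow (h : IsRegPair x y) (n : ℕ) :
    Module.length A (A ⧸ Ideal.span {x, y ^ n}) = n * Module.length A (A ⧸ Ideal.span {x, y}) := by
  induction n with
  | zero =>
    have : Ideal.span {x, y ^ 0} = ⊤ := by
      rw [Ideal.eq_top_iff_one]
      exact Ideal.subset_span (by simp)
    have := Ideal.Quotient.subsingleton_iff.2 this
    simp [Module.length_eq_zero]
  | succ n ih =>
    rw [length_quotient_eq_add (x := y) (K := Ideal.span {x, y ^ n}), ih]
    · have : Ideal.span {x, y ^ (n + 1)} ⊔ Ideal.span {y} = Ideal.span {x, y} := by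
        rw [Ideal.span_insert, Ideal.span_insert, sup_assoc]
        congr 1
        rw [sup_eq_right, Ideal.span_singleton_le_span_singleton]
        exact dvd_pow_self y n.succ_ne_zero
      rw [this]
      push_cast
      ring
    · intro z
      simp only [Ideal.mem_span_pair]
      constructor
      · rintro ⟨a, b, hab⟩
        obtain ⟨w, hw, hw'⟩ := h.syz a (z - b * y ^ n) (by linear_combination hab)
        exact ⟨w, b, by linear_combination -hw'⟩
      · rintro ⟨a, b, hab⟩
        exact ⟨y * a, b, by linear_combination y * hab⟩

theorem length_quotient_pow_succ (h : IsRegPair x y) (n : ℕ) :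
    Module.length A (A ⧸ Ideal.span {x, y} ^ (n + 1)) =
      Module.length A (A ⧸ Ideal.span {x, y} ^ n) +
        ((n + 1 : ℕ) : ℕ∞) * Module.length A (A ⧸ Ideal.span {x, y}) := by
  rw [length_quotient_eq_add (x := x) (K := Ideal.span {x, y} ^ n),
    ← h.length_quotient_left_pow (n + 1)]
  · have : Ideal.span {x, y} ^ (n + 1) ⊔ Ideal.span {x} = Ideal.span {x, y ^ (n + 1)} := by
      have hle : Ideal.span {x} * Ideal.span {x, y} ^ n ≤ Ideal.span {x} := Ideal.mul_le_left
      rw [Ideal.span_pair_pow_succ, Ideal.span_insert x {y ^ (n + 1)}, sup_comm, ← sup_assoc,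
        sup_eq_left.2 hle]
    rw [this]
  · intro z
    refine ⟨h.mem_pow_of_mul_left_mem, fun hz => ?_⟩
    rw [pow_succ']
    exact Ideal.mul_mem_mul (Ideal.subset_span (by simp)) hz

theorem length_quotient_pow (h : IsRegPair x y) (n : ℕ) :
    Module.length A (A ⧸ Ideal.span {x, y} ^ n) =
      (((n + 1).choose 2 : ℕ) : ℕ∞) * Module.length A (A ⧸ Ideal.span {x, y}) := by
  induction n with
  | zero =>
    have := Ideal.Quotient.subsingleton_iff.2
      ((pow_zero (Ideal.span {x, y})).trans Ideal.one_eq_top)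
    simp [Module.length_eq_zero]
  | succ n ih =>
    rw [h.length_quotient_pow_succ, ih, Nat.choose_succ_succ' (n + 1) 1, Nat.choose_one_right]
    push_cast
    ring

end IsRegPair

/-- The asymptotic `Q`-adic order of `z` is at least `β`. -/
def AsympOrderGE {A : Type*} [CommRing A] (Q : Ideal A) (z : A) (β : ℝ) : Prop :=
  ∀ β' < β, ∃ c : ℝ, ∀ k : ℕ, ∃ b : ℕ, β' * k - c ≤ b ∧ z ^ k ∈ Q ^ b

namespace AsympOrderGE

variable {A : Type*} [CommRing A] {Q : Ideal A} {z w : A} {β γ : ℝ}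

theorem mono (hz : AsympOrderGE Q z β) (h : γ ≤ β) : AsympOrderGE Q z γ :=
  fun β' hβ' => hz β' (hβ'.trans_le h)

theorem of_forall_lt (hz : ∀ γ < β, AsympOrderGE Q z γ) : AsympOrderGE Q z β := by
  intro β' hβ'
  obtain ⟨γ, h1, h2⟩ := exists_between hβ'
  exact hz γ h2 β' h1

theorem of_nonpos (h : β ≤ 0) : AsympOrderGE Q z β := by
  intro β' hβ'
  refine ⟨0, fun k => ⟨0, ?_, by simp⟩⟩
  have : β' * k ≤ 0 := mul_nonpos_of_nonpos_of_nonneg (hβ'.le.trans h) k.cast_nonneg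
  simpa using this

theorem zero : AsympOrderGE Q (0 : A) β := by
  intro β' hβ'
  refine ⟨0, fun k => ⟨⌈β' * k⌉₊, by simpa using Nat.le_ceil _, ?_⟩⟩
  rcases k with _ | k
  · simp
  · simp

theorem of_mem_pow {n : ℕ} (hz : z ∈ Q ^ n) : AsympOrderGE Q z n := by
  intro β' hβ'
  refine ⟨0, fun k => ⟨n * k, ?_, ?_⟩⟩
  · push_cast
    nlinarith [mul_le_mul_of_nonneg_right hβ'.le (k.cast_nonneg : (0 : ℝ) ≤ k)]
  · rw [pow_mul]
    exact Ideal.pow_mem_pow hz k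

theorem mul (hz : AsympOrderGE Q z β) (hw : AsympOrderGE Q w γ) :
    AsympOrderGE Q (z * w) (β + γ) := by
  intro δ hδ
  obtain ⟨c, hc⟩ := hz (β - (β + γ - δ) / 2) (by linarith)
  obtain ⟨c', hc'⟩ := hw (γ - (β + γ - δ) / 2) (by linarith)
  refine ⟨c + c', fun k => ?_⟩
  obtain ⟨b, hb, hzb⟩ := hc k
  obtain ⟨b', hb', hzb'⟩ := hc' k
  refine ⟨b + b', ?_, ?_⟩
  · push_cast
    nlinarith
  · rw [mul_pow, pow_add]
    exact Ideal.mul_mem_mul hzb hzb'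

theorem mul_left (a : A) (hz : AsympOrderGE Q z β) : AsympOrderGE Q (a * z) β := by
  simpa using (of_nonpos le_rfl : AsympOrderGE Q a 0).mul hz

theorem add (hz : AsympOrderGE Q z β) (hw : AsympOrderGE Q w β) :
    AsympOrderGE Q (z + w) β := by
  intro δ hδ
  obtain ⟨c, hc⟩ := hz δ hδ
  obtain ⟨c', hc'⟩ := hw δ hδ
  refine ⟨c + c', fun k => ⟨⌈δ * k - (c + c')⌉₊, Nat.le_ceil _, ?_⟩⟩
  rw [add_pow]
  refine Ideal.sum_mem _ fun i hi => ?_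
  have hik : i ≤ k := Nat.lt_succ_iff.1 (Finset.mem_range.1 hi)
  obtain ⟨b, hb, hzb⟩ := hc i
  obtain ⟨b', hb', hzb'⟩ := hc' (k - i)
  refine Ideal.mul_mem_right _ _ (Ideal.pow_le_pow_right ?_ (?_ : _ ∈ Q ^ (b + b')))
  · rw [Nat.ceil_le]
    push_cast [Nat.cast_sub hik] at hb' ⊢
    nlinarith
  · rw [pow_add]
    exact Ideal.mul_mem_mul hzb hzb'

theorem neg (hz : AsympOrderGE Q z β) : AsympOrderGE Q (-z) β := by
  simpa using hz.mul_left (-1)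

theorem sub (hz : AsympOrderGE Q z β) (hw : AsympOrderGE Q w β) :
    AsympOrderGE Q (z - w) β := by
  simpa [sub_eq_add_neg] using hz.add hw.neg

theorem pow {n : ℕ} (hz : AsympOrderGE Q z n) (k : ℕ) : AsympOrderGE Q (z ^ k) (n * k : ℕ) := by
  induction k with
  | zero => exact of_nonpos (by simp)
  | succ k ih => simpa [pow_succ, mul_add] using ih.mul hz

theorem of_mul_left {x y : A} (h : IsRegPair x y)
    (hz : AsympOrderGE (Ideal.span {x, y}) (x * z) (β + 1)) :
    AsympOrderGE (Ideal.span {x, y}) z β := by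
  intro β' hβ'
  obtain ⟨c, hc⟩ := hz (β' + 1) (by linarith)
  refine ⟨c, fun k => ?_⟩
  obtain ⟨b, hb, hzb⟩ := hc k
  rw [mul_pow] at hzb
  refine ⟨b - k, ?_, h.mem_pow_of_pow_mul_left_mem k hzb⟩
  have : (b : ℝ) ≤ ((b - k : ℕ) : ℝ) + k := by
    exact_mod_cast (le_tsub_add : b ≤ b - k + k)
  linarith

/-- The largest exponent with `z` in `Q ^ a`. -/
theorem exists_maximal_pow {b : ℕ} (hb : z ∉ Q ^ b) : ∃ a, z ∈ Q ^ a ∧ z ∉ Q ^ (a + 1) := by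
  classical
  have hex : ∃ b, z ∉ Q ^ b := ⟨b, hb⟩
  rcases hn : Nat.find hex with _ | n
  · exact absurd (Nat.find_spec hex) (by simp [hn])
  · refine ⟨n, not_not.1 (Nat.find_min hex (by omega)), ?_⟩
    rw [← hn]
    exact Nat.find_spec hex

theorem exists_sharp {m : ℕ} (hz : AsympOrderGE Q z m) (hz' : ¬ AsympOrderGE Q z (m + 1)) :
    ∃ α : ℝ, m ≤ α ∧ α < m + 1 ∧ AsympOrderGE Q z α ∧
      ∀ ε > 0, ∀ K : ℝ, ∃ k a : ℕ, K ≤ k ∧ (a : ℝ) ≤ (α + ε) * k ∧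
        z ^ k ∈ Q ^ a ∧ z ^ k ∉ Q ^ (a + 1) := by
  set S : Set ℝ := {β | AsympOrderGE Q z β} with hS
  have hub : ∀ β ∈ S, β ≤ m + 1 := fun β hβ => by
    by_contra! hlt
    exact hz' (AsympOrderGE.mono hβ hlt.le)
  have hbdd : BddAbove S := ⟨_, hub⟩
  have hα : AsympOrderGE Q z (sSup S) := by
    refine of_forall_lt fun γ hγ => ?_
    obtain ⟨β, hβ, hγβ⟩ := exists_lt_of_lt_csSup ⟨_, hz⟩ hγ
    exact AsympOrderGE.mono hβ hγβ.le
  have hle : sSup S ≤ m + 1 := csSup_le ⟨_, hz⟩ hub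
  refine ⟨sSup S, le_csSup hbdd hz, lt_of_le_of_ne hle fun h => hz' (h ▸ hα), hα, ?_⟩
  intro ε hε K
  have hn : ¬ AsympOrderGE Q z (sSup S + ε) := fun h => by
    have := le_csSup hbdd h
    linarith
  simp only [AsympOrderGE, not_forall, not_exists, not_and] at hn
  obtain ⟨β', hβ', hk⟩ := hn
  obtain ⟨k, hk⟩ := hk ((m + 1 + ε) * max K 0)
  have h0 : (0 : ℝ) ≤ max K 0 := le_max_right _ _
  have hm : (0 : ℝ) ≤ m := m.cast_nonneg
  have hk0 : (0 : ℝ) ≤ k := k.cast_nonneg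
  obtain ⟨a, ha, ha'⟩ := exists_maximal_pow (hk ⌈β' * k - (m + 1 + ε) * max K 0⌉₊ (Nat.le_ceil _))
  have hlt : (a : ℝ) < β' * k - (m + 1 + ε) * max K 0 := by
    by_contra! hlt
    exact hk a hlt ha
  have h1 : β' * k ≤ (sSup S + ε) * k := mul_le_mul_of_nonneg_right hβ'.le hk0
  have h2 : (0 : ℝ) ≤ (m + 1 + ε) * max K 0 := by positivity
  refine ⟨k, a, ?_, by linarith, ha, ha'⟩
  have h3 : (sSup S + ε) * k ≤ (m + 1 + ε) * k := by gcongr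
  have h4 : (m + 1 + ε) * max K 0 < (m + 1 + ε) * k := by
    have : (0 : ℝ) ≤ a := a.cast_nonneg
    linarith
  exact (le_max_left _ _).trans (lt_of_mul_lt_mul_left h4 (by positivity)).le

theorem of_pow_mul_sub {x y : A} (h : IsRegPair x y) {m j : ℕ} {s : A}
    (hz : AsympOrderGE (Ideal.span {x, y}) z m)
    (hs : AsympOrderGE (Ideal.span {x, y}) s (m + j + 1))
    (hzs : y ^ j * z = s + x ^ (m + 1) * w) :
    AsympOrderGE (Ideal.span {x, y}) z (m + 1) := by
  by_contra hcon
  obtain ⟨α, hmα, hαm, hα, hsharp⟩ := exists_sharp hz hcon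
  set g : A := x ^ (m + 1) * w with hg
  have hgord : AsympOrderGE (Ideal.span {x, y}) g (j + α) := by
    have h1 : AsympOrderGE (Ideal.span {x, y}) (y ^ j) j :=
      of_mem_pow (Ideal.pow_mem_pow (Ideal.subset_span (by simp)) j)
    have h2 : g = y ^ j * z - s := by rw [hzs]; ring
    rw [h2]
    exact (h1.mul hα).sub (hs.mono (by linarith))
  set γ : ℝ := m + 1 - α with hγ
  have hγ0 : 0 < γ := by linarith
  have hγ1 : γ ≤ 1 := by linarith
  set M : ℝ := m + 1 with hM
  have hM1 : 1 ≤ M := by simp [hM]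
  set ε : ℝ := γ ^ 2 / (8 * M) with hε
  have hεM : ε * M = γ ^ 2 / 8 := by
    rw [hε]; field_simp
  have hε0 : 0 < ε := by positivity
  have hεγ : ε ≤ γ / 2 := by nlinarith
  obtain ⟨c₁, hc₁⟩ := hgord (j + α - ε) (by linarith)
  obtain ⟨c₂, hc₂⟩ := hs (m + j + 1 - ε) (by linarith)
  obtain ⟨k, a, hK, hak, hza, hza'⟩ := hsharp ε hε0 (4 * M * (c₁ + c₂ + 1) / γ ^ 2)
  rw [div_le_iff₀ (by positivity)] at hK
  apply hza'
  set i₀ := a / (m + 1) + 1 with hi₀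
  have hai₀ : a + 1 ≤ (m + 1) * i₀ := by
    rw [hi₀]
    have := Nat.lt_mul_div_succ a (Nat.succ_pos m)
    exact this
  obtain ⟨W, hW⟩ : ∃ W, y ^ (j * k) * z ^ k - x ^ (a + 1) * W ∈
      Ideal.span {x, y} ^ (a + j * k + 1) := by
    have hex : y ^ (j * k) * z ^ k = ∑ i ∈ Finset.range (k + 1),
        g ^ i * s ^ (k - i) * (k.choose i : A) := by
      rw [pow_mul, ← mul_pow, hzs, add_comm, add_pow]
    have : ∀ i ∈ Finset.range (k + 1), ∃ W,
        g ^ i * s ^ (k - i) * (k.choose i : A) - x ^ (a + 1) * W ∈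
          Ideal.span {x, y} ^ (a + j * k + 1) := by
      intro i hi
      have hik : i ≤ k := Nat.lt_succ_iff.1 (Finset.mem_range.1 hi)
      rcases lt_or_ge i i₀ with hlt | hge
      · refine ⟨0, ?_⟩
        rw [mul_zero, sub_zero]
        obtain ⟨b, hb, hgb⟩ := hc₁ i
        obtain ⟨b', hb', hsb⟩ := hc₂ (k - i)
        refine Ideal.mul_mem_right _ _ (Ideal.pow_le_pow_right (n := b + b') ?_ ?_)
        · have h1 : (m + 1) * i ≤ a := by
            have : i ≤ a / (m + 1) := by omega
            calc (m + 1) * i ≤ (m + 1) * (a / (m + 1)) := Nat.mul_le_mul_left _ this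
              _ ≤ a := Nat.mul_div_le _ _
          have h2 : M * i ≤ a := by rw [hM]; exact_mod_cast h1
          have h3 : γ * (M * k - M * i) ≥ γ * ((γ - ε) * k) := by
            refine mul_le_mul_of_nonneg_left ?_ hγ0.le
            have : γ = M - α := hγ
            nlinarith
          have hk0 : (0 : ℝ) ≤ k := k.cast_nonneg
          have h4 : γ * ((γ - ε) * k) ≥ γ ^ 2 / 2 * k := by
            have : γ * (γ - ε) ≥ γ ^ 2 / 2 := by nlinarith
            nlinarith
          have h5 : M * (γ * (k - i)) ≥ M * (2 * ε * k + (c₁ + c₂ + 1)) := by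
            have : M * (2 * ε * k) = γ ^ 2 / 4 * k := by linear_combination 2 * k * hεM
            nlinarith
          have h6 := le_of_mul_le_mul_left h5 (by linarith)
          have : ((a + j * k + 1 : ℕ) : ℝ) ≤ ((b + b' : ℕ) : ℝ) := by
            push_cast [Nat.cast_sub hik] at hb' ⊢
            have : γ * (k - i) = (m + 1 - α) * (k - i) := by rw [hγ]
            nlinarith
          exact_mod_cast this
        · rw [pow_add]
          exact Ideal.mul_mem_mul hgb hsb
      · obtain ⟨W, hW⟩ : x ^ (a + 1) ∣ g ^ i * s ^ (k - i) * (k.choose i : A) := by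
          refine Dvd.dvd.mul_right (Dvd.dvd.mul_right ?_ _) _
          rw [hg, mul_pow, ← pow_mul]
          refine Dvd.dvd.mul_right (pow_dvd_pow x (hai₀.trans ?_)) _
          exact Nat.mul_le_mul_left _ hge
        exact ⟨W, by rw [hW, sub_self]; exact zero_mem _⟩
    choose! W hW using this
    refine ⟨∑ i ∈ Finset.range (k + 1), W i, ?_⟩
    rw [hex, Finset.mul_sum, ← Finset.sum_sub_distrib]
    exact Ideal.sum_mem _ hW
  exact h.mem_pow_succ_of_pow_mul_mem (j * k) a hza hW

end AsympOrderGE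

/-- The ideal of elements of asymptotic `Q`-adic order at least `n`. -/
def asympIdeal {A : Type*} [CommRing A] (Q : Ideal A) (n : ℕ) : Ideal A where
  carrier := {z | AsympOrderGE Q z n}
  add_mem' := AsympOrderGE.add
  zero_mem' := AsympOrderGE.zero
  smul_mem' a _ hz := hz.mul_left a

section AsympIdeal

variable {A : Type*} [CommRing A] {Q : Ideal A}

theorem asympIdeal_antitone : Antitone (asympIdeal Q) := fun _ _ h _ hz =>
  AsympOrderGE.mono hz (by exact_mod_cast h)

theorem asympIdeal_zero : asympIdeal Q 0 = ⊤ :=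
  eq_top_iff.2 fun _ _ => AsympOrderGE.of_nonpos (by simp)

theorem pow_le_asympIdeal (n : ℕ) : Q ^ n ≤ asympIdeal Q n := fun _ => AsympOrderGE.of_mem_pow

theorem mul_mem_asympIdeal {m n : ℕ} {z w : A} (hz : z ∈ asympIdeal Q m)
    (hw : w ∈ asympIdeal Q n) : z * w ∈ asympIdeal Q (m + n) := by
  have := AsympOrderGE.mul hz hw
  rwa [← Nat.cast_add] at this

theorem exists_pow_mem_of_mem_asympIdeal_succ {n : ℕ} {z : A} (hz : z ∈ asympIdeal Q (n + 1)) :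
    ∃ c : ℕ, ∀ k, z ^ k ∈ Q ^ (n * k - c) := by
  obtain ⟨c, hc⟩ := hz n (by push_cast; linarith)
  refine ⟨⌈c⌉₊, fun k => ?_⟩
  obtain ⟨b, hb, hzb⟩ := hc k
  refine Ideal.pow_le_pow_right ?_ hzb
  have h1 := Nat.le_ceil c
  have : ((n * k : ℕ) : ℝ) ≤ ((b + ⌈c⌉₊ : ℕ) : ℝ) := by
    push_cast
    linarith
  have := (Nat.cast_le (α := ℝ)).1 this
  omega

variable {x y : A}

theorem IsRegPair.mem_asympIdeal_of_mul_left (h : IsRegPair x y) {n : ℕ} {z : A}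
    (hz : x * z ∈ asympIdeal (Ideal.span {x, y}) (n + 1)) :
    z ∈ asympIdeal (Ideal.span {x, y}) n :=
  AsympOrderGE.of_mul_left h (by exact_mod_cast hz)

theorem IsRegPair.mem_asympIdeal_of_mul_right (h : IsRegPair x y) {n : ℕ} {z : A}
    (hz : y * z ∈ asympIdeal (Ideal.span {x, y}) (n + 1)) :
    z ∈ asympIdeal (Ideal.span {x, y}) n := by
  rw [Set.pair_comm] at hz ⊢
  exact h.symm.mem_asympIdeal_of_mul_left hz

theorem IsRegPair.mem_asympIdeal_succ (h : IsRegPair x y) {m j : ℕ} {z w : A}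
    (hz : z ∈ asympIdeal (Ideal.span {x, y}) m)
    (hs : y ^ j * z - x ^ (m + 1) * w ∈ asympIdeal (Ideal.span {x, y}) (m + j + 1)) :
    z ∈ asympIdeal (Ideal.span {x, y}) (m + 1) := by
  have := AsympOrderGE.of_pow_mul_sub h hz (by exact_mod_cast hs) (sub_add_cancel _ _).symm
  exact_mod_cast this

end AsympIdeal

section Length

variable {A M P : Type*} [CommRing A] [AddCommGroup M] [Module A M] [AddCommGroup P] [Module A P]

theorem Submodule.length_mono {N N' : Submodule A M} (h : N ≤ N') :
    Module.length A N ≤ Module.length A N' := by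
  rw [Module.length_submodule, Module.length_submodule]
  exact Order.height_mono h

theorem Submodule.eq_of_le_of_length_le {N N' : Submodule A M} (h : N ≤ N')
    (hlen : Module.length A N' ≤ Module.length A N) (htop : Module.length A N ≠ ⊤) : N = N' := by
  rw [Module.length_submodule, Module.length_submodule] at *
  by_contra hne
  exact (Order.height_strictMono (h.lt_of_ne hne) htop.lt_top).not_ge hlen

theorem Submodule.length_eq_map_add_inf_ker (f : M →ₗ[A] P) (N : Submodule A M) :
    Module.length A N = Module.length A (N ⊓ LinearMap.ker f : Submodule A M) +
      Module.length A (N.map f) := by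
  refine Module.length_eq_add_of_exact (Submodule.inclusion inf_le_left) (f.submoduleMap N)
    (Submodule.inclusion_injective _) (f.submoduleMap_surjective N) ?_
  rintro ⟨z, hz⟩
  simp only [Set.mem_range, Subtype.ext_iff, LinearMap.submoduleMap_coe_apply]
  constructor
  · intro h
    exact ⟨⟨z, hz, h⟩, rfl⟩
  · rintro ⟨⟨w, hw, hw'⟩, rfl⟩
    exact hw'

theorem Submodule.fg_of_length_ne_top {N : Submodule A M} (h : Module.length A N ≠ ⊤) : N.FG := by
  have := (isFiniteLength_iff_isNoetherian_isArtinian.1 (Module.length_ne_top_iff.1 h)).1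
  exact (Submodule.fg_top N).1 (IsNoetherian.noetherian _)

theorem Submodule.fg_of_le_of_length_ne_top {N N' : Submodule A M} (hle : N ≤ N')
    (h : Module.length A N' ≠ ⊤) : N.FG :=
  Submodule.fg_of_length_ne_top (ne_top_of_le_ne_top h (Submodule.length_mono hle))

theorem Submodule.FG.exists_le_of_le_iUnion {N : Submodule A M} (hN : N.FG)
    {V : ℕ → Submodule A M} (hV : Monotone V) (h : ∀ z ∈ N, ∃ n, z ∈ V n) : ∃ n, N ≤ V n := by
  obtain ⟨s, rfl⟩ := hN
  choose! n hn using h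
  refine ⟨s.sup n, Submodule.span_le.2 fun z hz => ?_⟩
  exact hV (Finset.le_sup hz) (hn z (Submodule.subset_span hz))

end Length

section Horner

variable {A M : Type*} [CommRing A] [AddCommGroup M] [Module A M]

/-- The sum of the submodules `t ^ i W` for `i ≤ k`. -/
def hornerSum (t : M →ₗ[A] M) (W : Submodule A M) : ℕ → Submodule A M
  | 0 => W
  | k + 1 => W ⊔ (hornerSum t W k).map t

variable {t : M →ₗ[A] M} {W : Submodule A M}

theorem hornerSum_le {V : ℕ → Submodule A M} (hV : Monotone V) (htV : ∀ n, (V n).map t ≤ V (n + 1))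
    {m : ℕ} (hW : W ≤ V m) (k : ℕ) : hornerSum t W k ≤ V (m + k) := by
  induction k with
  | zero => exact hW
  | succ k ih =>
    exact sup_le (hW.trans (hV (by omega))) ((Submodule.map_mono ih).trans (htV _))

theorem hornerSum_add_le (i j : ℕ) : hornerSum t W (j + 1 + i) ≤
    hornerSum t W j ⊔ hornerSum t (W.map (t ^ (j + 1))) i := by
  have hmap : ∀ (j : ℕ) (W : Submodule A M), (W.map (t ^ j)).map t = W.map (t ^ (j + 1)) := by
    intro j W
    rw [← Submodule.map_comp, pow_succ', Module.End.mul_eq_comp]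
  have hcomm : ∀ (j : ℕ) (W : Submodule A M), (W.map t).map (t ^ j) = W.map (t ^ (j + 1)) := by
    intro j W
    rw [← Submodule.map_comp, pow_succ, Module.End.mul_eq_comp]
  have key : ∀ j, hornerSum t W (j + 1 + i) ≤
      hornerSum t W j ⊔ (hornerSum t W i).map (t ^ (j + 1)) := by
    intro j
    induction j with
    | zero =>
      rw [zero_add, Nat.add_comm, pow_one]
      exact le_rfl
    | succ j ih =>
      rw [Nat.add_right_comm]
      refine sup_le (le_sup_of_le_left le_sup_left) ((Submodule.map_mono ih).trans ?_)
      rw [Submodule.map_sup, hmap]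
      exact sup_le_sup le_sup_right le_rfl
  refine (key j).trans (sup_le_sup le_rfl ?_)
  clear key
  induction i with
  | zero => exact le_rfl
  | succ i ih =>
    simp only [hornerSum]
    rw [Submodule.map_sup, hcomm, ← hmap (j + 1)]
    exact sup_le_sup le_rfl (Submodule.map_mono ih)

variable {U : ℕ → Submodule A M}

theorem mul_length_map_mkQ_le (ht : Function.Injective t) (hU : Monotone U)
    (htU : ∀ n, (U n).map t ≤ U (n + 1)) (m k : ℕ) :
    ((k + 1 : ℕ) : ℕ∞) * Module.length A ((U m).map ((⨆ n, U n).map t).mkQ) ≤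
      Module.length A (U (m + k)) := by
  set f := ((⨆ n, U n).map t).mkQ
  refine le_trans ?_ (Submodule.length_mono (hornerSum_le hU htU le_rfl k))
  induction k with
  | zero =>
    simp only [hornerSum, zero_add, Nat.cast_one, one_mul]
    change _ ≤ Module.length A (U m)
    rw [Submodule.length_eq_map_add_inf_ker f (U m)]
    exact le_add_self
  | succ k ih =>
    rw [Submodule.length_eq_map_add_inf_ker f]
    push_cast at ih ⊢
    rw [add_mul, one_mul]
    refine add_le_add (ih.trans ?_) (Submodule.length_mono (Submodule.map_mono le_sup_left))
    rw [(Submodule.equivMapOfInjective t ht _).length_eq]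
    refine Submodule.length_mono (le_inf le_sup_right ?_)
    rw [Submodule.ker_mkQ]
    exact Submodule.map_mono ((hornerSum_le hU htU le_rfl k).trans (le_iSup U _))

/-- The elements `u` with `t ^ (j + 1) u ∈ U (n + j)` for some `j`. -/
def saturatedLevel (t : M →ₗ[A] M) (U : ℕ → Submodule A M) (hU : Monotone U)
    (htU : ∀ n, (U n).map t ≤ U (n + 1)) (n : ℕ) : Submodule A M where
  carrier := {u | (∃ m, u ∈ U m) ∧ ∃ j, (t ^ (j + 1)) u ∈ U (n + j)}
  zero_mem' := ⟨⟨0, zero_mem _⟩, 0, by simp⟩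
  add_mem' := by
    have step : ∀ {u : M} {j : ℕ} (i : ℕ), (t ^ (j + 1)) u ∈ U (n + j) →
        (t ^ (j + i + 1)) u ∈ U (n + (j + i)) := by
      intro u j i hu
      induction i with
      | zero => exact hu
      | succ i ih =>
        have := htU _ (Submodule.mem_map_of_mem ih)
        rwa [← Module.End.mul_apply, ← pow_succ'] at this
    rintro u v ⟨⟨m, hm⟩, j, hj⟩ ⟨⟨m', hm'⟩, j', hj'⟩
    refine ⟨⟨m + m', add_mem (hU (by omega) hm) (hU (by omega) hm')⟩, j + j', ?_⟩
    rw [map_add]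
    refine add_mem (step j' hj) ?_
    rw [Nat.add_comm j j']
    exact step j hj'
  smul_mem' := by
    rintro a u ⟨⟨m, hm⟩, j, hj⟩
    exact ⟨⟨m, Submodule.smul_mem _ _ hm⟩, j, by
      rw [map_smul]
      exact Submodule.smul_mem _ _ hj⟩

theorem exists_le_hornerSum (ht : Function.Injective t) (hU : Monotone U)
    (htU : ∀ n, (U n).map t ≤ U (n + 1)) (hfin : ∀ n, Module.length A (U n) ≠ ⊤)
    (C : ℕ) (hC : ∀ n, Module.length A (U n) ≤ (C * (n + 1) : ℕ))
    (hsat : ∀ m j u, u ∈ U m → (t ^ (j + 1)) u ∈ U j → u = 0) :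
    ∃ a c, ∀ i, U (a + i) ≤ U c ⊔ hornerSum t (U a) i := by
  set T := ⨆ n, U n with hT
  have hTmem : ∀ u, u ∈ T ↔ ∃ n, u ∈ U n := fun u =>
    Submodule.mem_iSup_of_directed U hU.directed_le
  set f := (T.map t).mkQ with hf
  have hbound : ∀ m, Module.length A ((U m).map f) ≤ (2 * C : ℕ) := by
    intro m
    have h1 := (mul_length_map_mkQ_le ht hU htU m m).trans (hC (m + m))
    have h2 : Module.length A ((U m).map f) ≠ ⊤ := by
      refine ne_top_of_le_ne_top (hfin m) ?_
      rw [Submodule.length_eq_map_add_inf_ker f (U m)]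
      exact le_add_self
    change ((m + 1 : ℕ) : ℕ∞) * Module.length A ((U m).map f) ≤ _ at h1
    lift Module.length A ((U m).map f) to ℕ using h2 with v
    norm_cast at h1 ⊢
    have : (m + 1) * v ≤ (m + 1) * (2 * C) := h1.trans (by nlinarith)
    exact Nat.le_of_mul_le_mul_left this (Nat.succ_pos m)
  obtain ⟨m₁, hm₁⟩ : ∃ m₁, ∀ m, (U m).map f ≤ (U m₁).map f := by
    have hne : ∀ m, Module.length A ((U m).map f) ≠ ⊤ := fun m =>
      ne_top_of_le_ne_top (ENat.natCast_ne_top _) (hbound m)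
    obtain ⟨v, ⟨m₁, hm₁⟩, hv⟩ : ∃ v ∈ Set.range fun m => Module.length A ((U m).map f),
        ∀ w ∈ Set.range fun m => Module.length A ((U m).map f), w ≤ v := by
      have hfinite : (Set.range fun m => Module.length A ((U m).map f)).Finite := by
        refine Set.Finite.subset ((Set.finite_Iic (2 * C)).image (Nat.cast : ℕ → ℕ∞)) ?_
        rintro _ ⟨m, rfl⟩
        have h1 := hbound m
        have h2 := hne m
        simp only
        lift Module.length A ((U m).map f) to ℕ using h2 with v
        exact ⟨v, by exact_mod_cast h1, rfl⟩
      obtain ⟨v, hv⟩ := hfinite.exists_maximal ⟨_, ⟨0, rfl⟩⟩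
      refine ⟨v, hv.1, fun w hw => ?_⟩
      rcases le_total w v with h | h
      · exact h
      · exact hv.2 hw h
    refine ⟨m₁, fun m => ?_⟩
    have h1 : (U m₁).map f ≤ (U (m₁ + m)).map f := Submodule.map_mono (hU (by omega))
    rw [Submodule.eq_of_le_of_length_le h1 ((hv _ ⟨_, rfl⟩).trans hm₁.ge) (hne _)]
    exact Submodule.map_mono (hU (by omega))
  have hTf : T.map f ≤ (U m₁).map f := by
    exact (Submodule.map_iSup _ _).le.trans (iSup_le hm₁)
  have hTdec : ∀ u ∈ T, ∃ u' ∈ U m₁, ∃ v ∈ T, u = u' + t v := by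
    intro u hu
    obtain ⟨u', hu', h⟩ := hTf (Submodule.mem_map_of_mem hu)
    rw [hf, Submodule.mkQ_apply, Submodule.mkQ_apply, eq_comm, Submodule.Quotient.eq] at h
    obtain ⟨v, hv, hv'⟩ := h
    exact ⟨u', hu', v, hv, by rw [hv']; abel⟩
  set S := saturatedLevel t U hU htU with hS
  have hST : ∀ n, S n ≤ T := fun n u hu => (hTmem u).2 hu.1
  have hS0 : S 0 = ⊥ := by
    rw [Submodule.eq_bot_iff]
    rintro u ⟨⟨m, hm⟩, j, hj⟩
    exact hsat m j u hm (by simpa using hj)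
  have hUS : ∀ n, U n ≤ S (n + 1) := fun n u hu =>
    ⟨⟨n, hu⟩, 0, by simpa using htU n (Submodule.mem_map_of_mem hu)⟩
  have hSmono : Monotone S := by
    rintro n n' hnn u ⟨hu, j, hj⟩
    exact ⟨hu, j, hU (by omega) hj⟩
  have hSt : ∀ n, ∀ v ∈ T, t v ∈ S (n + 1) → v ∈ S n := by
    rintro n v hv ⟨-, j, hj⟩
    refine ⟨(hTmem v).1 hv, j + 1, ?_⟩
    rw [pow_succ, Module.End.mul_apply]
    rwa [Nat.add_assoc, Nat.add_comm 1 j] at hj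
  have hSfg : ∀ n, (S n).FG := by
    intro n
    induction n with
    | zero =>
      rw [hS0]
      exact Submodule.fg_bot
    | succ n ih =>
      refine Submodule.fg_of_fg_map_of_fg_inf_ker f ?_ ?_
      · exact Submodule.fg_of_le_of_length_ne_top ((Submodule.map_mono (hST _)).trans hTf)
          (ne_top_of_le_ne_top (ENat.natCast_ne_top _) (hbound m₁))
      · suffices h : S (n + 1) ⊓ LinearMap.ker f = (S n).map t from h ▸ ih.map t
        rw [hf, Submodule.ker_mkQ]
        apply le_antisymm
        · rintro _ ⟨hu, v, hv, rfl⟩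
          exact Submodule.mem_map_of_mem (hSt n v hv hu)
        · rintro _ ⟨v, ⟨hv, j, hj⟩, rfl⟩
          refine ⟨⟨?_, j, ?_⟩, v, hST n ⟨hv, j, hj⟩, rfl⟩
          · obtain ⟨m, hm⟩ := hv
            exact ⟨m + 1, htU m (Submodule.mem_map_of_mem hm)⟩
          · have := htU _ (Submodule.mem_map_of_mem hj)
            rwa [← Module.End.mul_apply, ← pow_succ', pow_succ, Module.End.mul_apply,
              Nat.add_right_comm] at this
  set n₀ := m₁ + 1
  set W := S n₀ with hW
  have hSW : ∀ i, S (n₀ + i) ≤ hornerSum t W i := by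
    intro i
    induction i with
    | zero => exact le_rfl
    | succ i ih =>
      intro u hu
      obtain ⟨u', hu', v, hv, rfl⟩ := hTdec u (hST _ hu)
      have hu'W : u' ∈ W := hUS m₁ hu'
      have htv : t v ∈ S (n₀ + i + 1) := by
        have := sub_mem hu (hSmono (Nat.le_add_right n₀ (i + 1)) hu'W)
        rwa [add_sub_cancel_left] at this
      exact add_mem (Submodule.mem_sup_left hu'W)
        (Submodule.mem_sup_right (Submodule.mem_map_of_mem (ih (hSt _ v hv htv))))
  obtain ⟨J, hJ⟩ := (hSfg n₀).exists_le_of_le_iUnion hU fun z hz => hz.1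
  obtain ⟨j, hj⟩ := (hSfg n₀).exists_le_of_le_iUnion
    (V := fun j => (U (n₀ + j)).comap (t ^ (j + 1)))
    (monotone_nat_of_le_succ fun j u hu => by
      have := htU _ (Submodule.mem_map_of_mem hu)
      rwa [← Module.End.mul_apply, ← pow_succ'] at this) fun z hz => hz.2
  refine ⟨n₀ + j, J + j, fun i => ?_⟩
  calc U (n₀ + j + i) ≤ S (n₀ + j + i + 1) := hUS _
    _ = S (n₀ + (j + 1 + i)) := by congr 1; omega
    _ ≤ hornerSum t W (j + 1 + i) := hSW _
    _ ≤ hornerSum t W j ⊔ hornerSum t (W.map (t ^ (j + 1))) i := hornerSum_add_le i j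
    _ ≤ _ := by
      refine sup_le_sup (hornerSum_le hU htU hJ j) ?_
      have hWj : W.map (t ^ (j + 1)) ≤ U (n₀ + j) := Submodule.map_le_iff_le_comap.2 hj
      clear_value W
      induction i with
      | zero => exact hWj
      | succ i ih => exact sup_le_sup hWj (Submodule.map_mono ih)

end Horner

section AsympGraded

variable {A : Type*} [CommRing A] {x y : A}

theorem Submodule.length_quotient_eq_add_of_le {M : Type*} [AddCommGroup M] [Module A M]
    {J K : Submodule A M} (h : J ≤ K) :
    Module.length A (M ⧸ J) = Module.length A (K.map J.mkQ) + Module.length A (M ⧸ K) := by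
  rw [← (Submodule.quotientQuotientEquivQuotient J K h).length_eq]
  refine Module.length_eq_add_of_exact (K.map J.mkQ).subtype (K.map J.mkQ).mkQ
    (Submodule.injective_subtype _) (Submodule.mkQ_surjective _) ?_
  exact LinearMap.exact_subtype_mkQ _

theorem Submodule.length_quotient_le_of_le {M : Type*} [AddCommGroup M] [Module A M]
    {J K : Submodule A M} (h : J ≤ K) :
    Module.length A (M ⧸ K) ≤ Module.length A (M ⧸ J) := by
  rw [length_quotient_eq_add_of_le h]
  exact le_add_self

theorem IsRegPair.mem_asympIdeal_of_pow_mul_left (h : IsRegPair x y) {n : ℕ} {z : A} (p : ℕ)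
    (hz : x ^ p * z ∈ asympIdeal (Ideal.span {x, y}) (n + p)) :
    z ∈ asympIdeal (Ideal.span {x, y}) n := by
  induction p with
  | zero => simpa using hz
  | succ p ih =>
    refine ih (h.mem_asympIdeal_of_mul_left ?_)
    rwa [← mul_assoc, ← pow_succ']

/-- The direct limit along multiplication by `x` of the graded pieces of the asymptotic
filtration, with multiplication by `y / x`. -/
theorem IsRegPair.exists_limit_module.{u} {A : Type u} [CommRing A] {x y : A}
    (h : IsRegPair x y) :
    ∃ (M : Type u) (_ : AddCommGroup M) (_ : Module A M) (t : M →ₗ[A] M) (g : ℕ → A →ₗ[A] M),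
      (∀ n z, g n z = 0 ↔ z ∈ asympIdeal (Ideal.span {x, y}) (n + 1)) ∧
      (∀ n z, g (n + 1) (x * z) = g n z) ∧ (∀ n z, t (g n z) = g (n + 1) (y * z)) ∧
      ∀ u, ∃ n z, u = g n z := by
  set F := asympIdeal (Ideal.span {x, y}) with hF
  let K := Localization.Away x
  let φ := algebraMap A K
  let ι : K := IsLocalization.Away.invSelf x
  have hι : φ x * ι = 1 := IsLocalization.Away.mul_invSelf x
  have hιp : ∀ n, φ x ^ n * ι ^ n = 1 := fun n => by rw [← mul_pow, hι, one_pow]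
  have hφ : Function.Injective φ := by
    refine IsLocalization.injective (M := Submonoid.powers x) K ?_
    rintro _ ⟨n, rfl⟩
    exact mem_nonZeroDivisors_iff.2 ⟨fun z hz => h.left_pow n z hz,
      fun z hz => h.left_pow n z (by rwa [mul_comm])⟩
  have hxF : ∀ n, x ^ n ∈ F n := fun n =>
    pow_le_asympIdeal n (Ideal.pow_mem_pow (Ideal.subset_span (by simp)) n)
  have hyF : y ∈ F 1 := pow_le_asympIdeal 1 (by
    rw [pow_one]
    exact Ideal.subset_span (by simp))
  have hshift : ∀ p n z, φ (x ^ p * z) * ι ^ (n + p) = φ z * ι ^ n := by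
    intro p n z
    rw [map_mul, map_pow, pow_add]
    linear_combination φ z * ι ^ n * hιp p
  let Z : Submodule A K :=
    { carrier := {k | ∃ n, ∃ z ∈ F (n + 1), φ z * ι ^ n = k}
      zero_mem' := ⟨0, 0, zero_mem _, by simp⟩
      add_mem' := by
        rintro _ _ ⟨n, z, hz, rfl⟩ ⟨m, w, hw, rfl⟩
        refine ⟨n + m, x ^ m * z + x ^ n * w, add_mem ?_ ?_, ?_⟩
        · have := mul_mem_asympIdeal (hxF m) hz
          rwa [show m + (n + 1) = n + m + 1 by ring] at this
        · have := mul_mem_asympIdeal (hxF n) hw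
          rwa [← add_assoc] at this
        · rw [map_add, add_mul, hshift, Nat.add_comm n m, hshift]
      smul_mem' := by
        rintro a _ ⟨n, z, hz, rfl⟩
        refine ⟨n, a * z, Ideal.mul_mem_left _ _ hz, ?_⟩
        rw [map_mul, mul_assoc, Algebra.smul_def] }
  have hZ : ∀ n z, φ z * ι ^ n ∈ Z ↔ z ∈ F (n + 1) := by
    intro n z
    refine ⟨?_, fun hz => ⟨n, z, hz, rfl⟩⟩
    rintro ⟨p, s, hs, hps⟩
    have h1 : x ^ p * z = x ^ n * s := by
      apply hφ
      rw [map_mul, map_mul, map_pow, map_pow]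
      linear_combination φ x ^ p * φ x ^ n * -hps + φ x ^ n * φ s * hιp p -
        φ x ^ p * φ z * hιp n
    refine h.mem_asympIdeal_of_pow_mul_left p ?_
    rw [h1, show n + 1 + p = n + (p + 1) by ring]
    exact mul_mem_asympIdeal (hxF n) hs
  let T : K →ₗ[A] K := LinearMap.mulLeft A (φ y * ι)
  have hT : Z ≤ Z.comap T := by
    rintro _ ⟨n, z, hz, rfl⟩
    refine ⟨n + 1, y * z, ?_, ?_⟩
    · rw [add_comm (n + 1)]
      exact mul_mem_asympIdeal hyF hz
    · rw [LinearMap.mulLeft_apply, map_mul]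
      ring
  let g : ℕ → A →ₗ[A] K ⧸ Z := fun n =>
    Z.mkQ ∘ₗ LinearMap.mulRight A (ι ^ n) ∘ₗ Algebra.linearMap A K
  have hg : ∀ n z, g n z = Z.mkQ (φ z * ι ^ n) := fun n z => rfl
  refine ⟨K ⧸ Z, inferInstance, inferInstance, Z.mapQ Z T hT, g, ?_, ?_, ?_, ?_⟩
  · intro n z
    rw [hg, Submodule.mkQ_apply, Submodule.Quotient.mk_eq_zero, hZ]
  · intro n z
    have := hshift 1 n z
    rw [pow_one] at this
    rw [hg, hg, this]
  · intro n z
    rw [hg, hg, Submodule.mkQ_apply, Submodule.mapQ_apply, LinearMap.mulLeft_apply,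
      Submodule.mkQ_apply, map_mul]
    congr 1
    ring
  · intro u
    obtain ⟨k, rfl⟩ := Z.mkQ_surjective u
    obtain ⟨n, z, hz⟩ := IsLocalization.Away.surj x k
    refine ⟨n, z, ?_⟩
    rw [hg, ← show algebraMap A K z = φ z from rfl, ← hz, mul_assoc]
    congr 1
    change k = k * (φ x ^ n * ι ^ n)
    rw [hιp, mul_one]

theorem IsRegPair.asympIdeal_le_sup (h : IsRegPair x y)
    (hfin : Module.length A (A ⧸ Ideal.span {x, y}) ≠ ⊤) :
    ∃ c, ∀ n, asympIdeal (Ideal.span {x, y}) n ≤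
      Ideal.span {x, y} ^ (n - c) ⊔ asympIdeal (Ideal.span {x, y}) (n + 1) := by
  obtain ⟨M, _, _, t, g, hg0, hgx, hgt, hgs⟩ := h.exists_limit_module
  set F := asympIdeal (Ideal.span {x, y}) with hF
  have hQn := h.length_quotient_pow
  lift Module.length A (A ⧸ Ideal.span {x, y}) to ℕ using hfin with ℓ
  have hgxp : ∀ p n z, g (n + p) (x ^ p * z) = g n z := by
    intro p n z
    induction p with
    | zero => simp
    | succ p ih =>
      rw [← add_assoc, pow_succ', mul_assoc, hgx, ih]
  have hgtp : ∀ p n z, (t ^ p) (g n z) = g (n + p) (y ^ p * z) := by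
    intro p n z
    induction p with
    | zero => simp
    | succ p ih =>
      rw [pow_succ', Module.End.mul_apply, ih, hgt, ← mul_assoc, ← pow_succ', add_assoc]
  have hxF : ∀ n, x ^ n ∈ F n := fun n =>
    pow_le_asympIdeal n (Ideal.pow_mem_pow (Ideal.subset_span (by simp)) n)
  have hxF1 : x ∈ F 1 := by simpa using hxF 1
  have hyF1 : y ∈ F 1 := pow_le_asympIdeal 1 (by
    rw [pow_one]
    exact Ideal.subset_span (by simp))
  set U : ℕ → Submodule A M := fun n => Submodule.map (g n) (F n) with hUdef
  have hU : Monotone U := by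
    refine monotone_nat_of_le_succ fun n => ?_
    rintro _ ⟨z, hz, rfl⟩
    refine ⟨x * z, ?_, hgx n z⟩
    rw [add_comm]
    exact mul_mem_asympIdeal hxF1 hz
  have htU : ∀ n, (U n).map t ≤ U (n + 1) := by
    rintro n _ ⟨_, ⟨z, hz, rfl⟩, rfl⟩
    refine ⟨y * z, ?_, (hgt n z).symm⟩
    rw [add_comm]
    exact mul_mem_asympIdeal hyF1 hz
  have ht : Function.Injective t := by
    rw [← LinearMap.ker_eq_bot, Submodule.eq_bot_iff]
    intro u hu
    obtain ⟨n, z, rfl⟩ := hgs u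
    rw [LinearMap.mem_ker, hgt, hg0] at hu
    exact (hg0 n z).2 (h.mem_asympIdeal_of_mul_right hu)
  have hlen : ∀ n, Module.length A (A ⧸ F (n + 1)) =
      Module.length A (U n) + Module.length A (A ⧸ F n) := by
    intro n
    rw [Submodule.length_quotient_eq_add_of_le (asympIdeal_antitone (Nat.le_succ n) : F (n + 1) ≤ F n)]
    congr 1
    have hker : LinearMap.ker (g n) = F (n + 1) := by
      ext z
      exact hg0 n z
    have hinj : Function.Injective ((F (n + 1)).liftQ (g n) hker.ge) := by
      rw [← LinearMap.ker_eq_bot, Submodule.ker_liftQ_eq_bot _ _ _ hker.le]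
    rw [(Submodule.equivMapOfInjective _ hinj _).length_eq, ← Submodule.map_comp,
      Submodule.liftQ_mkQ]
  have hle : ∀ n, Module.length A (A ⧸ F n) ≤ ((n + 1).choose 2 * ℓ : ℕ) := by
    intro n
    refine (Submodule.length_quotient_le_of_le (pow_le_asympIdeal n)).trans ?_
    rw [hQn]
    exact_mod_cast le_rfl
  have hUfin : ∀ n, Module.length A (U n) ≠ ⊤ := fun n =>
    ne_top_of_le_ne_top (ENat.natCast_ne_top _) ((le_self_add.trans (hlen n).ge).trans (hle (n + 1)))
  have hmul : ∀ n k : ℕ, (k : ℕ∞) * Module.length A (U n) ≤ Module.length A (A ⧸ F (n + k)) := by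
    intro n k
    induction k with
    | zero => simp
    | succ k ih =>
      rw [← add_assoc, hlen (n + k), Nat.cast_succ, add_mul, one_mul, add_comm]
      exact add_le_add (Submodule.length_mono (hU (Nat.le_add_right n k))) ih
  have hC : ∀ n, Module.length A (U n) ≤ (2 * ℓ * (n + 1) : ℕ) := by
    intro n
    have h1 := (hmul n (n + 1)).trans (hle (n + (n + 1)))
    have h2 := hUfin n
    lift Module.length A (U n) to ℕ using h2 with v
    norm_cast at h1 ⊢
    have h3 : (n + (n + 1) + 1).choose 2 = (n + 1) * (2 * n + 1) := by
      rw [Nat.choose_two_right]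
      apply Nat.div_eq_of_eq_mul_left two_pos
      simp only [Nat.add_sub_cancel]
      ring
    rw [h3] at h1
    have h4 : (n + 1) * v ≤ (n + 1) * (2 * ℓ * (n + 1)) := h1.trans (by nlinarith [Nat.zero_le (ℓ * n), Nat.zero_le ℓ, Nat.zero_le (ℓ * n * n)])
    exact Nat.le_of_mul_le_mul_left h4 (Nat.succ_pos n)
  have hsat : ∀ m j u, u ∈ U m → (t ^ (j + 1)) u ∈ U j → u = 0 := by
    rintro m j _ ⟨z, hz, rfl⟩ ⟨w, hw, hwz⟩
    rw [hgtp, ← hgxp (m + 1) j w, show m + (j + 1) = j + (m + 1) by ring, eq_comm, ← sub_eq_zero,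
      ← map_sub, hg0] at hwz
    refine (hg0 m z).2 (h.mem_asympIdeal_succ (j := j + 1) (w := w) hz ?_)
    rwa [show m + (j + 1) + 1 = j + (m + 1) + 1 by ring]
  obtain ⟨a, c, hac⟩ := exists_le_hornerSum ht hU htU hUfin (2 * ℓ) hC hsat
  have hQx : ∀ e, x ^ e ∈ Ideal.span {x, y} ^ e := fun e =>
    Ideal.pow_mem_pow (Ideal.subset_span (by simp)) e
  have hQle : ∀ {i j : ℕ}, i ≤ j → Ideal.span {x, y} ^ j ≤ Ideal.span {x, y} ^ i :=
    fun h => Ideal.pow_le_pow_right h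
  have hUD : ∀ a i, U a ≤ Submodule.map (g (a + i)) (Ideal.span {x, y} ^ i) := by
    rintro a i _ ⟨z, hz, rfl⟩
    exact ⟨x ^ i * z, Ideal.mul_mem_right _ _ (hQx i), hgxp i a z⟩
  have hhorner : ∀ i, hornerSum t (U a) i ≤ Submodule.map (g (a + i)) (Ideal.span {x, y} ^ i) := by
    intro i
    induction i with
    | zero => exact hUD a 0
    | succ i ih =>
      refine sup_le (hUD a (i + 1)) ((Submodule.map_mono ih).trans ?_)
      rintro _ ⟨_, ⟨q, hq, rfl⟩, rfl⟩
      refine ⟨y * q, ?_, (hgt _ _).symm⟩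
      rw [pow_succ']
      exact Ideal.mul_mem_mul (Ideal.subset_span (by simp)) hq
  refine ⟨a + c, fun n z hz => ?_⟩
  rcases le_total n (a + c) with hn | hn
  · refine Ideal.mem_sup_left ?_
    rw [Nat.sub_eq_zero_of_le hn, pow_zero, Ideal.one_eq_top]
    exact Submodule.mem_top
  · obtain ⟨i, rfl⟩ := Nat.exists_eq_add_of_le hn
    have hle : U (a + (c + i)) ≤ Submodule.map (g (a + (c + i)))
        (Ideal.span {x, y} ^ i) := by
      refine (hac (c + i)).trans (sup_le ?_ ((hhorner (c + i)).trans ?_))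
      · refine (hUD c (a + i)).trans ?_
        rw [show a + (c + i) = c + (a + i) by ring]
        exact Submodule.map_mono (hQle (by omega))
      · exact Submodule.map_mono (hQle (by omega))
    rw [add_assoc] at hz
    obtain ⟨q, hq, hqz⟩ := hle (Submodule.mem_map_of_mem hz)
    rw [eq_comm, ← sub_eq_zero, ← map_sub, hg0] at hqz
    rw [Nat.add_sub_cancel_left, ← add_sub_cancel q z, add_assoc a c i]
    exact add_mem (Ideal.mem_sup_left hq) (Ideal.mem_sup_right hqz)

end AsympGraded

section IntegralClosure

variable {A : Type*} [CommRing A]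

theorem pow_mem_pow_of_mem_idealIC {J : Ideal A} {z : A} (hz : z ∈ idealIC J) :
    ∃ m : ℕ, ∀ k, z ^ k ∈ J ^ (k + 1 - m) := by
  obtain ⟨m, hm, c, hc, h⟩ := hz
  refine ⟨m, fun k => ?_⟩
  induction k using Nat.strong_induction_on with
  | _ k ih =>
    rcases lt_or_ge k m with hk | hk
    · rw [Nat.sub_eq_zero_of_le hk, pow_zero, Ideal.one_eq_top]
      exact Submodule.mem_top
    · have hzk : z ^ k = -∑ i ∈ Finset.Icc 1 m, c i * z ^ (k - i) := by
        have h1 : z ^ k = z ^ (k - m) * z ^ m := by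
          rw [← pow_add, Nat.sub_add_cancel hk]
        rw [h1, eq_neg_of_add_eq_zero_left h, mul_neg, Finset.mul_sum]
        congr 1
        refine Finset.sum_congr rfl fun i hi => ?_
        have him := (Finset.mem_Icc.1 hi).2
        rw [mul_left_comm, ← pow_add]
        congr 2
        omega
      rw [hzk]
      refine neg_mem (Ideal.sum_mem _ fun i hi => ?_)
      have him := Finset.mem_Icc.1 hi
      have := Ideal.mul_mem_mul (hc i hi) (ih (k - i) (by omega))
      rw [← pow_add] at this
      exact Ideal.pow_le_pow_right (by omega) this

theorem mem_idealIC_of_forall_mul_pow_mem [IsNoetherianRing A] {J : Ideal A} {z d : A}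
    (hd : ∀ u, d * u = 0 → u = 0) (h : ∀ k, d * z ^ k ∈ J ^ k) : z ∈ idealIC J := by
  classical
  let e : ℕ → reesAlgebra J := fun k =>
    ⟨Polynomial.monomial k (d * z ^ k), reesAlgebra.monomial_mem.2 (h k)⟩
  let f : ℕ →o Ideal (reesAlgebra J) :=
    { toFun := fun n => Ideal.span (e '' (Finset.range (n + 1) : Set ℕ))
      monotone' := fun n n' hn => Ideal.span_mono (Set.image_mono
        (Finset.coe_subset.2 (Finset.range_subset_range.2 (Nat.succ_le_succ hn)))) }
  obtain ⟨n, hn⟩ := monotone_stabilizes_iff_noetherian.2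
    (inferInstance : IsNoetherianRing (reesAlgebra J)) f
  have hmem : e (n + 1) ∈ f n := by
    rw [hn (n + 1) (Nat.le_succ n)]
    exact Ideal.subset_span ⟨n + 1, by simp, rfl⟩
  obtain ⟨c, hc⟩ := (Submodule.mem_span_image_finset_iff_exists_fun _).1 hmem
  let c' : ℕ → reesAlgebra J := fun k => if h : k ∈ Finset.range (n + 1) then c ⟨k, h⟩ else 0
  have hc' : ∑ k ∈ Finset.range (n + 1), c' k * e k = e (n + 1) := by
    rw [← hc, ← Finset.sum_coe_sort]
    refine Finset.sum_congr rfl fun k _ => ?_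
    have : c' k = c k := dif_pos k.2
    rw [this, smul_eq_mul]
  have hcoeff := congrArg (fun g : reesAlgebra J => (g : Polynomial A).coeff (n + 1)) hc'
  simp only [AddSubmonoidClass.coe_finsetSum, Polynomial.finsetSum_coeff, MulMemClass.coe_mul] at hcoeff
  have hterm : ∀ k ∈ Finset.range (n + 1), ((c' k : Polynomial A) * (e k : Polynomial A)).coeff (n + 1)
      = (c' k : Polynomial A).coeff (n + 1 - k) * (d * z ^ k) := by
    intro k hk
    have hk := Finset.mem_range.1 hk
    conv_lhs => rw [← Nat.sub_add_cancel hk.le]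
    exact Polynomial.coeff_mul_monomial _ _ _ _
  rw [Finset.sum_congr rfl hterm] at hcoeff
  have hlast : (e (n + 1) : Polynomial A).coeff (n + 1) = d * z ^ (n + 1) :=
    Polynomial.coeff_monomial_same _ _
  rw [hlast] at hcoeff
  refine ⟨n + 1, Nat.succ_pos n, fun i => -(c' (n + 1 - i) : Polynomial A).coeff i, ?_, ?_⟩
  · intro i _
    exact neg_mem (mem_reesAlgebra_iff J _ |>.1 (c' (n + 1 - i)).2 i)
  · have hre : ∑ i ∈ Finset.Icc 1 (n + 1), -(c' (n + 1 - i) : Polynomial A).coeff i *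
        z ^ (n + 1 - i) = ∑ k ∈ Finset.range (n + 1), -(c' k : Polynomial A).coeff (n + 1 - k) * z ^ k := by
      refine Finset.sum_nbij' (fun i => n + 1 - i) (fun k => n + 1 - k) ?_ ?_ ?_ ?_ ?_
      · intro i hi
        simp only [Finset.mem_Icc, Finset.mem_range] at hi ⊢
        omega
      · intro i hi
        simp only [Finset.mem_Icc, Finset.mem_range] at hi ⊢
        omega
      · intro i hi
        simp only [Finset.mem_Icc] at hi
        omega
      · intro i hi
        simp only [Finset.mem_range] at hi
        omega
      · intro i hi
        simp only [Finset.mem_Icc] at hi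
        rw [Nat.sub_sub_self hi.2]
    apply hd
    rw [hre, mul_add, ← hcoeff, Finset.mul_sum, ← Finset.sum_add_distrib]
    exact Finset.sum_eq_zero fun k _ => by ring

variable {x y : A}

theorem IsRegPair.asympIdeal_le_pow [IsNoetherianRing A] [IsLocalRing A] (h : IsRegPair x y)
    (hred : IsReduced (AdicCompletion (maximalIdeal A) A))
    (hx : x ∈ maximalIdeal A) (hy : y ∈ maximalIdeal A)
    {p : ℕ} (hQ : maximalIdeal A ^ p ≤ Ideal.span {x, y})
    (hfin : Module.length A (A ⧸ Ideal.span {x, y}) ≠ ⊤) :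
    ∃ c, ∀ n, asympIdeal (Ideal.span {x, y}) n ≤ Ideal.span {x, y} ^ (n - c) := by
  obtain ⟨c, hc⟩ := h.asympIdeal_le_sup hfin
  refine ⟨c, fun n => ?_⟩
  have hk : ∀ k, asympIdeal (Ideal.span {x, y}) n ≤
      Ideal.span {x, y} ^ (n - c) ⊔ asympIdeal (Ideal.span {x, y}) (n + k) := by
    intro k
    induction k with
    | zero => exact le_sup_right
    | succ k ih =>
      refine ih.trans (sup_le le_sup_left ((hc (n + k)).trans (sup_le_sup ?_ le_rfl)))
      exact Ideal.pow_le_pow_right (by omega)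
  obtain ⟨N, hN⟩ := exists_le_pow_of_infinite_order hred hx hy hQ
    (fun n => asympIdeal (Ideal.span {x, y}) (n + 1))
    (fun _ _ h => asympIdeal_antitone (Nat.succ_le_succ h))
    (fun n z hz => exists_pow_mem_of_mem_asympIdeal_succ hz) (p * n)
  refine (hk (N + 1)).trans (sup_le le_rfl ?_)
  have h1 : asympIdeal (Ideal.span {x, y}) (n + (N + 1)) ≤ maximalIdeal A ^ (p * n) :=
    (asympIdeal_antitone (by omega)).trans hN
  refine h1.trans ?_
  rw [pow_mul]
  exact (Ideal.pow_right_mono hQ n).trans (Ideal.pow_le_pow_right (Nat.sub_le _ _))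

theorem IsRegPair.mem_idealIC_iff [IsNoetherianRing A] (h : IsRegPair x y) {I : Ideal A}
    (hQI : Ideal.span {x, y} ≤ I) {r c : ℕ} (hr : ∀ j, I ^ j ≤ Ideal.span {x, y} ^ (j - r))
    (hc : ∀ n, asympIdeal (Ideal.span {x, y}) n ≤ Ideal.span {x, y} ^ (n - c)) {n : ℕ} {z : A} :
    z ∈ idealIC (I ^ n) ↔ z ∈ asympIdeal (Ideal.span {x, y}) n := by
  constructor
  · intro hz
    obtain ⟨m, hm⟩ := pow_mem_pow_of_mem_idealIC hz
    intro β' hβ'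
    refine ⟨n * m + r, fun k => ⟨n * (k + 1 - m) - r, ?_, ?_⟩⟩
    · have h1 : n * k ≤ n * (k + 1 - m) - r + (n * m + r) := by
        have : n * k ≤ n * ((k + 1 - m) + m) := Nat.mul_le_mul_left _ (by omega)
        rw [mul_add] at this
        omega
      have h2 : (n * k : ℝ) ≤ ((n * (k + 1 - m) - r : ℕ) : ℝ) + (n * m + r) := by
        exact_mod_cast h1
      have h3 : β' * k ≤ n * k := mul_le_mul_of_nonneg_right hβ'.le k.cast_nonneg
      linarith
    · refine hr _ ?_
      rw [pow_mul]
      exact hm k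
  · intro hz
    have hx : x ∈ Ideal.span {x, y} := Ideal.subset_span (by simp)
    refine mem_idealIC_of_forall_mul_pow_mem (d := x ^ c) (h.left_pow c) fun k => ?_
    rw [← pow_mul]
    have hzk : z ^ k ∈ asympIdeal (Ideal.span {x, y}) (n * k) := AsympOrderGE.pow hz k
    have h1 := Ideal.mul_mem_mul (Ideal.pow_mem_pow hx c) (hc _ hzk)
    rw [← pow_add] at h1
    exact Ideal.pow_right_mono hQI _ (Ideal.pow_le_pow_right (by omega) h1)

theorem IsRegPair.idealICIdeal_eq [IsNoetherianRing A] (h : IsRegPair x y) {I : Ideal A}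
    (hQI : Ideal.span {x, y} ≤ I) {r c : ℕ} (hr : ∀ j, I ^ j ≤ Ideal.span {x, y} ^ (j - r))
    (hc : ∀ n, asympIdeal (Ideal.span {x, y}) n ≤ Ideal.span {x, y} ^ (n - c)) (n : ℕ) :
    idealICIdeal (I ^ n) = asympIdeal (Ideal.span {x, y}) n := by
  have : idealIC (I ^ n) = (asympIdeal (Ideal.span {x, y}) n : Set A) :=
    Set.ext fun _ => h.mem_idealIC_iff hQI hr hc
  rw [idealICIdeal, this, Ideal.span_eq]

end IntegralClosure

section SecondDifference

variable {A : Type*} [CommRing A] {x y : A}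

theorem length_quotient_mul_add_le {J K : Ideal A} (hK : ∀ z, x * z ∈ J → y * z ∈ J → z ∈ K) :
    Module.length A (A ⧸ Ideal.span {x, y} * J) + Module.length A (A ⧸ K) ≤
      Module.length A (A ⧸ Ideal.span {x, y}) +
        (Module.length A (A ⧸ J) + Module.length A (A ⧸ J)) := by
  set Q : Ideal A := Ideal.span {x, y} with hQ
  have hx : x ∈ Q := Ideal.subset_span (by simp)
  have hy : y ∈ Q := Ideal.subset_span (by simp)
  let g (a : A) (ha : a ∈ Q) : (A ⧸ J) →ₗ[A] A ⧸ Q * J :=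
    Submodule.mapQ J (Q * J) (LinearMap.lsmul A A a) fun j hj => Ideal.mul_mem_mul ha hj
  let φ : ((A ⧸ J) × (A ⧸ J)) →ₗ[A] A ⧸ Q * J := LinearMap.coprod (g x hx) (g y hy)
  let ψ : A →ₗ[A] (A ⧸ J) × (A ⧸ J) :=
    LinearMap.prod (J.mkQ ∘ₗ LinearMap.lsmul A A y) (-(J.mkQ ∘ₗ LinearMap.lsmul A A x))
  have hφ : ∀ u v, φ (J.mkQ u, J.mkQ v) = (Q * J).mkQ (x * u + y * v) := fun u v => rfl
  have hψ : ∀ z, ψ z = (J.mkQ (y * z), J.mkQ (-(x * z))) := fun z => rfl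
  have hψφ : LinearMap.range ψ ≤ LinearMap.ker φ := by
    rintro _ ⟨z, rfl⟩
    rw [LinearMap.mem_ker, hψ, hφ]
    have : x * (y * z) + y * -(x * z) = 0 := by ring
    rw [this, map_zero]
  have hkerψ : LinearMap.ker ψ ≤ K := by
    intro z hz
    rw [LinearMap.mem_ker, hψ, Prod.mk_eq_zero, Submodule.mkQ_apply, Submodule.mkQ_apply,
      Submodule.Quotient.mk_eq_zero, Submodule.Quotient.mk_eq_zero] at hz
    exact hK z (neg_mem_iff.1 hz.2) hz.1
  have hrangeφ : Submodule.map (Q * J).mkQ Q ≤ LinearMap.range φ := by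
    rintro _ ⟨z, hz, rfl⟩
    obtain ⟨u, v, rfl⟩ := Ideal.mem_span_pair.1 hz
    refine ⟨(J.mkQ u, J.mkQ v), ?_⟩
    rw [hφ, mul_comm x, mul_comm y]
  have h1 := Submodule.length_quotient_eq_add_of_le (A := A) (J := Q * J) (K := Q)
    Ideal.mul_le_left
  have h2 : Module.length A (A ⧸ K) ≤ Module.length A (LinearMap.ker φ) :=
    (Submodule.length_quotient_le_of_le hkerψ).trans
      ((ψ.quotKerEquivRange.length_eq).le.trans (Submodule.length_mono hψφ))
  have h3 : Module.length A (A ⧸ J) + Module.length A (A ⧸ J) =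
      Module.length A (LinearMap.ker φ) + Module.length A (LinearMap.range φ) := by
    rw [← Module.length_prod]
    exact Module.length_eq_add_of_exact (LinearMap.ker φ).subtype φ.rangeRestrict
      (Submodule.injective_subtype _) φ.surjective_rangeRestrict
      (fun z => by simp [Subtype.ext_iff])
  rw [h1, h3]
  calc _ ≤ Module.length A (LinearMap.range φ) + Module.length A (A ⧸ Q) +
        Module.length A (LinearMap.ker φ) :=
        add_le_add (add_le_add (Submodule.length_mono hrangeφ) le_rfl) h2
    _ = _ := by ring

end SecondDifference

section HilbertPolynomial

theorem two_mul_choose_two_add (m : ℕ) : 2 * (((m + 2).choose 2 : ℕ) : ℤ) = (m + 2) * (m + 1) := by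
  induction m with
  | zero => simp
  | succ m ih =>
    rw [Nat.choose_succ_succ' (m + 2) 1, Nat.choose_one_right]
    push_cast
    linear_combination ih

theorem le_leading_coeff_of_choose_mul_le {L : ℕ → ℕ} {e₀ e₁ e₂ : ℤ} {N₀ q c : ℕ}
    (hcoef : ∀ n : ℕ, N₀ ≤ n →
      (L (n + 1) : ℤ) = e₀ * ((n + 2).choose 2 : ℕ) - e₁ * ((n + 1).choose 1 : ℕ)
        + e₂ * (n.choose 0 : ℕ))
    (hle : ∀ n, (n - c + 1).choose 2 * q ≤ L n) : (q : ℤ) ≤ e₀ := by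
  by_contra! hlt
  have key : ∀ m : ℕ, N₀ ≤ m → ((m : ℤ) + 2) ≤ |e₀| * (3 * c + c ^ 2) + 2 * |e₁| * (c + 1) + 2 * |e₂| := by
    intro m hm
    have h1 := hcoef (m + c) (by omega)
    have h2 := hle (m + c + 1)
    have h3 : m + c + 1 - c + 1 = m + 2 := by omega
    rw [h3] at h2
    have h2' : (((m + 2).choose 2 : ℕ) : ℤ) * q ≤ L (m + c + 1) := by exact_mod_cast h2
    rw [h1, Nat.choose_one_right, Nat.choose_zero_right] at h2'
    have h4 := two_mul_choose_two_add m
    have h5 := two_mul_choose_two_add (m + c)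
    push_cast at h2' h5
    have h6 : ((m : ℤ) + 2) * (m + 1) * (q - e₀) ≤
        e₀ * (c * (2 * m + 3) + c ^ 2) - 2 * e₁ * (m + c + 1) + 2 * e₂ := by
      have : ((m : ℤ) + 2) * (m + 1) * q ≤ e₀ * ((m + c + 2) * (m + c + 1)) -
          2 * e₁ * (m + c + 1) + 2 * e₂ := by
        rw [← h4, ← h5]
        linarith
      linarith
    have hm0 : (0 : ℤ) ≤ m := m.cast_nonneg
    have hc0 : (0 : ℤ) ≤ c := c.cast_nonneg
    have h7 : ((m : ℤ) + 2) * (m + 1) ≤ ((m : ℤ) + 2) * (m + 1) * (q - e₀) :=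
      le_mul_of_one_le_right (by positivity) (by linarith)
    have h8 : e₀ * (c * (2 * m + 3) + c ^ 2) ≤ |e₀| * (3 * c + c ^ 2) * (m + 1) := by
      have h81 : e₀ * (c * (2 * m + 3) + c ^ 2) ≤ |e₀| * (c * (2 * m + 3) + c ^ 2) :=
        mul_le_mul_of_nonneg_right (le_abs_self _) (by positivity)
      have h82 : (c : ℤ) * (2 * m + 3) + c ^ 2 ≤ (3 * c + c ^ 2) * (m + 1) := by nlinarith [mul_nonneg hc0 hm0, mul_nonneg (sq_nonneg (c : ℤ)) hm0]
      have h83 := mul_le_mul_of_nonneg_left h82 (abs_nonneg e₀)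
      linarith
    have h9 : -(2 * e₁ * (m + c + 1)) ≤ 2 * |e₁| * (c + 1) * (m + 1) := by
      have h91 : -e₁ * (m + c + 1) ≤ |e₁| * (m + c + 1) :=
        mul_le_mul_of_nonneg_right (neg_le_abs _) (by positivity)
      have h92 : (m : ℤ) + c + 1 ≤ (c + 1) * (m + 1) := by nlinarith [mul_nonneg hc0 hm0]
      have h93 := mul_le_mul_of_nonneg_left h92 (abs_nonneg e₁)
      linarith
    have h10 : 2 * e₂ ≤ 2 * |e₂| * (m + 1) := by
      have := le_abs_self e₂
      nlinarith [mul_nonneg (abs_nonneg e₂) hm0]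
    have h11 : ((m : ℤ) + 2) * (m + 1) ≤
        (|e₀| * (3 * c + c ^ 2) + 2 * |e₁| * (c + 1) + 2 * |e₂|) * (m + 1) := by linarith
    exact le_of_mul_le_mul_right h11 (by linarith)
  set D := |e₀| * (3 * c + c ^ 2) + 2 * |e₁| * (c + 1) + 2 * |e₂| with hD
  have := key (max N₀ D.toNat) (le_max_left _ _)
  have h1 : (D.toNat : ℤ) ≤ ((max N₀ D.toNat : ℕ) : ℤ) := by exact_mod_cast le_max_right _ _
  have h2 := Int.self_le_toNat D
  linarith

theorem exists_sum_range_add_le {L : ℕ → ℕ} {e₀ e₁ e₂ : ℤ} {N₀ q : ℕ} {v : ℕ → ℕ}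
    (hcoef : ∀ n : ℕ, N₀ ≤ n →
      (L (n + 1) : ℤ) = e₀ * ((n + 2).choose 2 : ℕ) - e₁ * ((n + 1).choose 1 : ℕ)
        + e₂ * (n.choose 0 : ℕ))
    (hq : (q : ℤ) ≤ e₀) (hL0 : L 0 = 0)
    (hv : ∀ m, v m + L (m + 2) + L m ≤ q + (L (m + 1) + L (m + 1))) :
    ∃ M, (∀ m, M ≤ m → v m = 0) ∧ ∑ m ∈ Finset.range M, (v m : ℤ) ≤ e₁ - e₀ + L 1 := by
  have hsum : ∀ N, ∑ m ∈ Finset.range N, (v m : ℤ) ≤ N * q - L (N + 1) + L N + L 1 := by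
    intro N
    induction N with
    | zero => simp [hL0]
    | succ N ih =>
      rw [Finset.sum_range_succ]
      have : ((v N + L (N + 2) + L N : ℕ) : ℤ) ≤ ((q + (L (N + 1) + L (N + 1)) : ℕ) : ℤ) :=
        by exact_mod_cast hv N
      push_cast at this ⊢
      linarith
  have hbig : ∀ n, N₀ ≤ n → ∑ m ∈ Finset.range (n + 1), (v m : ℤ) ≤ e₁ - e₀ + L 1 := by
    intro n hn
    refine (hsum (n + 1)).trans ?_
    have h1 := hcoef n hn
    have h2 := hcoef (n + 1) (by omega)
    rw [Nat.choose_one_right, Nat.choose_zero_right] at h1 h2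
    rw [Nat.choose_succ_succ' (n + 2) 1, Nat.choose_one_right] at h2
    push_cast at h1 h2 ⊢
    rw [h1, h2]
    have : (0 : ℤ) ≤ (n + 1) * (e₀ - q) := mul_nonneg (by positivity) (by linarith)
    linarith
  have hbdd : ∀ N, ∑ m ∈ Finset.range N, v m ≤ (e₁ - e₀ + L 1).toNat := by
    intro N
    have h1 : ∑ m ∈ Finset.range N, v m ≤ ∑ m ∈ Finset.range (max N₀ N + 1), v m :=
      Finset.sum_le_sum_of_subset (Finset.range_subset_range.2 (by omega))
    refine h1.trans ?_
    have := hbig (max N₀ N) (le_max_left _ _)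
    rw [← Nat.cast_sum] at this
    omega
  obtain ⟨M, hM⟩ : ∃ M, ∀ m, M ≤ m → ∑ i ∈ Finset.range m, v i = ∑ i ∈ Finset.range M, v i := by
    have hmono : Monotone fun N => ∑ i ∈ Finset.range N, v i := fun a b hab =>
      Finset.sum_le_sum_of_subset (Finset.range_subset_range.2 hab)
    have hfin : (Set.range fun N => ∑ i ∈ Finset.range N, v i).Finite :=
      (Set.finite_Iic _).subset (by rintro _ ⟨N, rfl⟩; exact hbdd N)
    obtain ⟨_, ⟨M, rfl⟩, hmax⟩ := hfin.exists_maximal (Set.range_nonempty _)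
    exact ⟨M, fun m hm => le_antisymm (hmax ⟨m, rfl⟩ (hmono hm)) (hmono hm)⟩
  refine ⟨max M (N₀ + 1), fun m hm => ?_, ?_⟩
  · have h1 := hM m (by omega)
    have h2 := hM (m + 1) (by omega)
    rw [Finset.sum_range_succ] at h2
    omega
  · have : max M (N₀ + 1) = (max M (N₀ + 1) - 1) + 1 := by omega
    rw [this]
    exact hbig _ (by omega)

end HilbertPolynomial

section DeterminantTrick

variable {A : Type*} [CommRing A]

open Polynomial in
/-- The submodule of `A[X]` over the Rees algebra of `I` generated by `Q X`. -/
def reesShift (Q I : Ideal A) : Submodule (reesAlgebra I) A[X] where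
  carrier := {f | f.coeff 0 = 0 ∧ ∀ n, f.coeff (n + 1) ∈ Q * I ^ n}
  zero_mem' := by simp
  add_mem' {f g} hf hg := ⟨by simp [hf.1, hg.1], fun n => by
    rw [coeff_add]
    exact add_mem (hf.2 n) (hg.2 n)⟩
  smul_mem' := by
    rintro ⟨r, hr⟩ f ⟨hf0, hf⟩
    have hsmul : (⟨r, hr⟩ : reesAlgebra I) • f = r * f := rfl
    rw [hsmul]
    refine ⟨by rw [mul_coeff_zero, hf0, mul_zero], fun n => ?_⟩
    rw [coeff_mul]
    refine Ideal.sum_mem _ fun ij hij => ?_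
    have hij := Finset.HasAntidiagonal.mem_antidiagonal.1 hij
    rcases hj : ij.2 with _ | j
    · rw [hf0, mul_zero]
      exact zero_mem _
    · have h1 := Ideal.mul_mem_mul (hr ij.1) (hf j)
      have h2 : I ^ ij.1 * (Q * I ^ j) = Q * I ^ n := by
        rw [mul_left_comm, ← pow_add]
        congr 2
        omega
      rwa [h2] at h1

open Polynomial

theorem monomial_mem_reesShift {Q I : Ideal A} {n : ℕ} {c : A}
    (hc : c ∈ Q * I ^ n) : monomial (n + 1) c ∈ reesShift Q I := by
  refine ⟨by simp [coeff_monomial], fun m => ?_⟩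
  rw [coeff_monomial]
  split_ifs with h
  · rwa [← Nat.succ_injective h]
  · exact zero_mem _

theorem mul_mem_reesShift {Q I : Ideal A} {r f : A[X]} (hr : r ∈ reesAlgebra I)
    (hf : f ∈ reesShift Q I) : r * f ∈ reesShift Q I :=
  (reesShift Q I).smul_mem ⟨r, hr⟩ hf

theorem Ideal.pow_le_of_prod_mem {ι : Type*} [Fintype ι] {I J : Ideal A}
    (h : ∀ a : ι → A, (∀ i, a i ∈ I) → ∏ i, a i ∈ J) : I ^ Fintype.card ι ≤ J := by
  rw [Submodule.pow_eq_span_pow_set, Submodule.span_le]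
  intro z hz
  obtain ⟨f, rfl⟩ := Set.mem_pow.1 hz
  rw [List.prod_ofFn, ← (Fintype.equivFin ι).prod_comp]
  exact h _ fun i => (f _).2

variable {ι : Type*} [Fintype ι] {Q I : Ideal A}

/-- The coefficient ideal of a generator of degree `d` in the degree `n` part. -/
def shiftedPow (Q : Ideal A) (n d : ℕ) : Ideal A := if d ≤ n then Q ^ (n - d) else ⊥

theorem monomial_mem_reesAlgebra_of_mem_shiftedPow (hQI : Q ≤ I) {n d : ℕ} {c : A}
    (hc : c ∈ shiftedPow Q n d) : monomial (n - d) c ∈ reesAlgebra I := by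
  unfold shiftedPow at hc
  split_ifs at hc with h
  · exact reesAlgebra.monomial_mem.2 (Ideal.pow_right_mono hQI _ hc)
  · rw [(Submodule.mem_bot A).1 hc, map_zero]
    exact zero_mem _

theorem monomial_mul_monomial_of_mem_shiftedPow {n d : ℕ} {c z : A}
    (hc : c ∈ shiftedPow Q n d) : monomial (n - d) c * monomial d z = monomial n (c * z) := by
  unfold shiftedPow at hc
  split_ifs at hc with h
  · rw [monomial_mul_monomial, Nat.sub_add_cancel h]
  · rw [(Submodule.mem_bot A).1 hc]
    simp

theorem monomial_mem_reesShift_of_mem_shiftedPow (hQI : Q ≤ I) {n d : ℕ} (hd : d < n) {c : A}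
    (hc : c ∈ shiftedPow Q n d) : monomial (n - d) c ∈ reesShift Q I := by
  rw [shiftedPow, if_pos hd.le] at hc
  obtain ⟨m, hm⟩ := Nat.exists_eq_add_of_lt hd
  have h1 : n - d = m + 1 := by omega
  rw [h1] at hc ⊢
  rw [pow_succ'] at hc
  exact monomial_mem_reesShift (Ideal.mul_mono_right (Ideal.pow_right_mono hQI m) hc)

theorem prod_sub_det_diagonal_sub_mem {R : Type*} [CommRing R] [DecidableEq ι] (J : Ideal R)
    (d : ι → ℕ) (D : ι → R) (M : Matrix ι ι R) (hM : ∀ i j, d j ≤ d i → M i j ∈ J) :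
    ∏ i, D i - (Matrix.diagonal D - M).det ∈ J := by
  have hM' : ∀ i j, d j ≤ d i → Ideal.Quotient.mk J (M i j) = 0 := fun i j hij =>
    Ideal.Quotient.eq_zero_iff_mem.2 (hM i j hij)
  rw [← Ideal.Quotient.mk_eq_mk_iff_sub_mem, map_prod, RingHom.map_det, Matrix.det_apply,
    Finset.sum_eq_single 1]
  · rw [Equiv.Perm.sign_one, one_smul]
    refine Finset.prod_congr rfl fun i _ => ?_
    rw [Equiv.Perm.one_apply, RingHom.mapMatrix_apply, Matrix.map_apply, Matrix.sub_apply,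
      map_sub, hM' i i le_rfl, sub_zero, Matrix.diagonal_apply_eq]
  · intro σ _ hσ
    have hne : (Finset.univ.filter fun i => σ i ≠ i).Nonempty := by
      by_contra! hempty
      refine hσ (Equiv.ext fun i => ?_)
      by_contra hi
      have : i ∈ (Finset.univ.filter fun i => σ i ≠ i) := by simpa using hi
      rw [hempty] at this
      exact absurd this (Finset.notMem_empty _)
    obtain ⟨i, hi, hmin⟩ := Finset.exists_min_image _ d hne
    have hi := (Finset.mem_filter.1 hi).2
    have h1 : d i ≤ d (σ i) := hmin _ (by simpa using hi)
    rw [Finset.prod_eq_zero (Finset.mem_univ i), smul_zero]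
    rw [RingHom.mapMatrix_apply, Matrix.map_apply, Matrix.sub_apply, map_sub, hM' _ _ h1,
      sub_zero, Matrix.diagonal_apply_ne _ hi, map_zero]
  · exact fun h => absurd (Finset.mem_univ _) h

theorem pow_card_add_two_le (hQI : Q ≤ I) (d : ι → ℕ) (z : ι → A)
    (hz : ∀ i, ∀ a ∈ I, ∃ p : ι → A, (∀ j, p j ∈ shiftedPow Q (d i + 1) (d j)) ∧
      ∃ w ∈ Q * I ^ d i, a * z i = ∑ j, p j * z j + w)
    (hI : ∀ s ∈ I ^ 2, ∃ p : ι → A, (∀ j, p j ∈ shiftedPow Q 2 (d j)) ∧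
      ∃ w ∈ Q * I, s = ∑ j, p j * z j + w) :
    I ^ (Fintype.card ι + 2) ≤ Q * I ^ (Fintype.card ι + 1) := by
  classical
  rw [pow_add, Ideal.mul_le]
  intro t ht s hs
  suffices h : ∀ a : ι → A, (∀ i, a i ∈ I) →
      (∏ i, a i) * s ∈ Q * I ^ (Fintype.card ι + 1) by
    have := Ideal.pow_le_of_prod_mem (ι := ι) (I := I)
      (J := Submodule.comap (LinearMap.mulRight A s) (Q * I ^ (Fintype.card ι + 1))) h
    exact this ht
  intro a ha
  choose p hp w hw hzp using fun i => hz i (a i) (ha i)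
  obtain ⟨ps, hps, ws, hws, hsp⟩ := hI s hs
  let R := reesAlgebra I
  let M₀ : Matrix ι ι R := fun i j =>
    ⟨monomial (d i + 1 - d j) (p i j), monomial_mem_reesAlgebra_of_mem_shiftedPow hQI (hp i j)⟩
  let D : ι → R := fun i => ⟨monomial 1 (a i), reesAlgebra.monomial_mem.2 (by simpa using ha i)⟩
  let M : Matrix ι ι R := Matrix.diagonal D - M₀
  let Z : ι → A[X] := fun i => monomial (d i) (z i)
  let N := reesShift Q I
  let NR : Ideal R := N.comap (Algebra.linearMap R A[X])
  have hM : ∀ i, ∑ j, (M i j : A[X]) * Z j = monomial (d i + 1) (w i) := by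
    intro i
    have h1 : ∀ j, (M i j : A[X]) * Z j =
        (if i = j then (monomial (d i + 1) (a i * z i) : A[X]) else 0) -
          monomial (d i + 1) (p i j * z j) := by
      intro j
      have h2 : (M i j : A[X]) = (Matrix.diagonal D i j : R) - (M₀ i j : A[X]) := rfl
      rw [h2, sub_mul]
      congr 1
      · split_ifs with hij
        · subst hij
          rw [Matrix.diagonal_apply_eq]
          exact (monomial_mul_monomial _ _ _ _).trans (by rw [add_comm])
        · rw [Matrix.diagonal_apply_ne _ hij]
          exact zero_mul _
      · exact monomial_mul_monomial_of_mem_shiftedPow (hp i j)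
    rw [Finset.sum_congr rfl fun j _ => h1 j, Finset.sum_sub_distrib, Finset.sum_ite_eq,
      if_pos (Finset.mem_univ _), ← map_sum, ← map_sub, hzp i, add_sub_cancel_left]
  have hdetZ : ∀ j, (M.det : A[X]) * Z j ∈ N := by
    intro j
    have h1 : (M.det : A[X]) * Z j = ∑ i, (M.adjugate j i : A[X]) * monomial (d i + 1) (w i) := by
      have h2 : ∀ l, ∑ i, (M.adjugate j i : A[X]) * (M i l : A[X]) =
          if j = l then (M.det : A[X]) else 0 := by
        intro l
        have h3 := congrFun (congrFun M.adjugate_mul j) l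
        rw [Matrix.mul_apply, Matrix.smul_apply, Matrix.one_apply] at h3
        have h4 := congrArg (fun r : R => (r : A[X])) h3
        simp only [AddSubmonoidClass.coe_finsetSum, MulMemClass.coe_mul] at h4
        rw [h4]
        split_ifs <;> simp
      calc (M.det : A[X]) * Z j = ∑ l, (if j = l then (M.det : A[X]) else 0) * Z l := by simp
        _ = ∑ l, ∑ i, (M.adjugate j i : A[X]) * (M i l : A[X]) * Z l := by
          refine Finset.sum_congr rfl fun l _ => ?_
          rw [← h2, Finset.sum_mul]
        _ = _ := by
          rw [Finset.sum_comm]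
          refine Finset.sum_congr rfl fun i _ => ?_
          rw [← hM i, Finset.mul_sum]
          simp only [mul_assoc]
    rw [h1]
    exact N.sum_mem fun i _ => mul_mem_reesShift (M.adjugate j i).2
      (monomial_mem_reesShift (hw i))
  have hs2 : (monomial 2 s : A[X]) = ∑ j, monomial (2 - d j) (ps j) * Z j + monomial 2 ws := by
    rw [hsp, map_add, map_sum]
    congr 1
    exact Finset.sum_congr rfl fun j _ => (monomial_mul_monomial_of_mem_shiftedPow (hps j)).symm
  have hdets : (M.det : A[X]) * monomial 2 s ∈ N := by
    rw [hs2, mul_add, Finset.mul_sum]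
    refine N.add_mem (N.sum_mem fun j _ => ?_) (mul_mem_reesShift M.det.2
      (monomial_mem_reesShift (by simpa using hws)))
    rw [mul_left_comm]
    exact mul_mem_reesShift (monomial_mem_reesAlgebra_of_mem_shiftedPow hQI (hps j)) (hdetZ j)
  have hdet : ∏ i, D i - M.det ∈ NR :=
    prod_sub_det_diagonal_sub_mem NR d D M₀ fun i j hij =>
      monomial_mem_reesShift_of_mem_shiftedPow hQI (Nat.lt_succ_of_le hij) (hp i j)
  have hfinal : (∏ i, D i : R).1 * monomial 2 s ∈ N := by
    have h1 : (∏ i, D i : R).1 * monomial 2 s =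
        monomial 2 s * (∏ i, D i - M.det : R).1 + (M.det : A[X]) * monomial 2 s := by
      have : (∏ i, D i - M.det : R).1 = (∏ i, D i : R).1 - (M.det : A[X]) := rfl
      rw [this]
      ring
    rw [h1]
    exact N.add_mem (mul_mem_reesShift (reesAlgebra.monomial_mem.2 hs) hdet) hdets
  have hprod : (∏ i, D i : R).1 = monomial (Fintype.card ι) (∏ i, a i) := by
    have h1 : (∏ i, D i : R).1 = ∏ i, (monomial 1 (a i) : A[X]) :=
      map_prod (reesAlgebra I).val D Finset.univ
    rw [h1]
    simp only [← C_mul_X_pow_eq_monomial, Finset.prod_mul_distrib, pow_one, Finset.prod_const,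
      Finset.card_univ, map_prod]
  rw [hprod, monomial_mul_monomial] at hfinal
  simpa using hfinal.2 (Fintype.card ι + 1)

end DeterminantTrick

section FiltrationGenerators

variable {A : Type*} [CommRing A]

theorem Submodule.le_of_length_map_mkQ_eq_zero {M : Type*} [AddCommGroup M] [Module A M]
    {J K : Submodule A M} (h : Module.length A (K.map J.mkQ) = 0) : K ≤ J := by
  intro z hz
  have h1 : Subsingleton (K.map J.mkQ) := Module.length_eq_zero_iff.1 h
  have h2 : J.mkQ z ∈ K.map J.mkQ := Submodule.mem_map_of_mem hz
  rw [(Submodule.subsingleton_iff_eq_bot).1 h1, Submodule.mem_bot, Submodule.mkQ_apply,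
    Submodule.Quotient.mk_eq_zero] at h2
  exact h2

theorem Submodule.exists_eq_sup_span_range {M : Type*} [AddCommGroup M] [Module A M]
    {K : Submodule A M} (hfin : Module.length A (M ⧸ K) ≠ ⊤) (n : ℕ) : ∀ {J : Submodule A M},
    J ≤ K → Module.length A (M ⧸ J) ≤ n + Module.length A (M ⧸ K) →
      ∃ z : Fin n → M, K = J ⊔ Submodule.span A (Set.range z) := by
  induction n with
  | zero =>
    intro J hJK h
    refine ⟨Fin.elim0, ?_⟩
    rw [length_quotient_eq_add_of_le hJK, Nat.cast_zero] at h
    have h0 : Module.length A (K.map J.mkQ) = 0 :=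
      nonpos_iff_eq_zero.1 ((ENat.add_le_add_iff_right hfin).1 h)
    have h2 := le_of_length_map_mkQ_eq_zero h0
    have h3 : Set.range (Fin.elim0 : Fin 0 → M) = ∅ := Set.range_eq_empty _
    rw [h3, Submodule.span_empty, sup_bot_eq]
    exact le_antisymm h2 hJK
  | succ n ih =>
    intro J hJK h
    by_cases hKJ : K ≤ J
    · refine ⟨fun _ => 0, le_antisymm (hKJ.trans le_sup_left) (sup_le hJK ?_)⟩
      rw [Submodule.span_le]
      rintro _ ⟨_, rfl⟩
      exact K.zero_mem
    · obtain ⟨z, hzK, hzJ⟩ := Set.not_subset.1 hKJ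
      have hJ' : J ⊔ Submodule.span A {z} ≤ K :=
        sup_le hJK (Submodule.span_le.2 (Set.singleton_subset_iff.2 hzK))
      have h1 : 1 ≤ Module.length A ((J ⊔ Submodule.span A {z}).map J.mkQ) := by
        rw [Order.one_le_iff_ne_zero]
        intro h0
        exact hzJ (le_of_length_map_mkQ_eq_zero h0 ((le_sup_right : _ ≤ J ⊔ _) (Submodule.mem_span_singleton_self z)))
      have h2 : 1 + Module.length A (M ⧸ (J ⊔ Submodule.span A {z})) ≤
          1 + (n + Module.length A (M ⧸ K)) := by
        refine (add_le_add h1 le_rfl).trans ?_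
        rw [← length_quotient_eq_add_of_le le_sup_left]
        refine h.trans (le_of_eq ?_)
        push_cast
        ring
      obtain ⟨w, hw⟩ := ih hJ' ((ENat.add_le_add_iff_left ENat.one_ne_top).1 h2)
      refine ⟨Fin.cons z w, ?_⟩
      rw [Fin.range_cons, Submodule.span_insert, ← sup_assoc, ← hw]

theorem exists_pow_le_mul_pow {x y : A} {I : Ideal A} {F : ℕ → Ideal A}
    (hQI : Ideal.span {x, y} ≤ I) (hIF : I ≤ F 1) (hmul : ∀ n, I * F n ≤ F (n + 1))
    (hcolon : ∀ n z, x * z ∈ F (n + 1) → z ∈ F n) {L : ℕ → ℕ}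
    (hL : ∀ n, Module.length A (A ⧸ F n) = L n) (hL0 : L 0 = 0)
    {q ℓI N₀ : ℕ} {e₀ e₁ e₂ : ℤ} (hq : Module.length A (A ⧸ Ideal.span {x, y}) = q)
    (hℓI : Module.length A (A ⧸ I) = ℓI) (hqe : (q : ℤ) ≤ e₀)
    (hcoef : ∀ n : ℕ, N₀ ≤ n →
      (L (n + 1) : ℤ) = e₀ * ((n + 2).choose 2 : ℕ) - e₁ * ((n + 1).choose 1 : ℕ)
        + e₂ * (n.choose 0 : ℕ)) :
    ∃ k : ℕ, (k : ℤ) ≤ e₁ - e₀ + ℓI ∧ I ^ (k + 2) ≤ Ideal.span {x, y} * I ^ (k + 1) := by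
  set Q : Ideal A := Ideal.span {x, y} with hQ
  have hQF : ∀ n, Q * F n ≤ F (n + 1) := fun n => (Ideal.mul_mono_left hQI).trans (hmul n)
  have hbound : ∀ m, Module.length A (A ⧸ Q * F (m + 1)) + L m ≤
      q + (L (m + 1) + L (m + 1) : ℕ) := by
    intro m
    have := length_quotient_mul_add_le (J := F (m + 1)) (K := F m) (x := x) (y := y)
      fun z hz _ => hcolon m z hz
    rwa [hL, hL, ← hQ, hq, ← Nat.cast_add] at this
  have hv : ∀ m, ∃ v : ℕ, Module.length A (A ⧸ Q * F (m + 1)) = v + L (m + 2) := by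
    intro m
    have h1 : Module.length A (A ⧸ Q * F (m + 1)) ≠ ⊤ := by
      refine ne_top_of_le_ne_top ?_ (le_self_add.trans (hbound m))
      rw [← Nat.cast_add]
      exact ENat.natCast_ne_top _
    obtain ⟨t, ht⟩ := ENat.ne_top_iff_exists.1 h1
    have h2 := Submodule.length_quotient_le_of_le (A := A) (hQF (m + 1))
    rw [hL, ← ht, Nat.cast_le] at h2
    refine ⟨t - L (m + 2), ?_⟩
    rw [← ht, ← Nat.cast_add, Nat.sub_add_cancel h2]
  choose v hv using hv
  obtain ⟨M, hM, hsum⟩ := exists_sum_range_add_le (v := v) hcoef hqe hL0 fun m => by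
    have := hbound m
    rw [hv] at this
    exact_mod_cast this
  have hLI : L 1 ≤ ℓI := by
    have := Submodule.length_quotient_le_of_le (A := A) hIF
    rw [hL, hℓI] at this
    exact_mod_cast this
  have hFtop : ∀ n, Module.length A (A ⧸ F n) ≠ ⊤ := fun n => by
    rw [hL]
    exact ENat.natCast_ne_top _
  let u : ℕ → ℕ := fun
    | 0 => ℓI - L 1
    | m + 1 => v m
  let B : ℕ → Ideal A := fun
    | 0 => I
    | m + 1 => Q * F (m + 1)
  have hgen : ∀ m, ∃ z : Fin (u m) → A, F (m + 1) = B m ⊔ Ideal.span (Set.range z) := by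
    rintro (_ | m)
    · refine Submodule.exists_eq_sup_span_range (hFtop _) _ hIF ?_
      change Module.length A (A ⧸ I) ≤ ((ℓI - L 1 : ℕ) : ℕ∞) + Module.length A (A ⧸ F 1)
      rw [hℓI, hL, ← Nat.cast_add]
      exact Nat.cast_le.2 (Nat.sub_add_cancel hLI).ge
    · refine Submodule.exists_eq_sup_span_range (hFtop _) _ (hQF (m + 1)) ?_
      rw [hv, hL]
  choose z hz using hgen
  let ι := Σ m : Fin (M + 1), Fin (u m)
  let d : ι → ℕ := fun i => i.1 + 1
  let Z : ι → A := fun i => z i.1 i.2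
  let G : ℕ → Ideal A := fun n =>
    Q ^ n * I ⊔ ⨆ i : ι, shiftedPow Q (n + 1) (d i) * Ideal.span {Z i}
  have hshift : ∀ n (i : ι), Q * shiftedPow Q (n + 1) (d i) ≤ shiftedPow Q (n + 2) (d i) := by
    intro n i
    unfold shiftedPow
    split_ifs with h1 h2 h2
    · rw [← pow_succ']
      exact Ideal.pow_le_pow_right (by omega)
    · omega
    · rw [Ideal.mul_bot]
      exact bot_le
    · rw [Ideal.mul_bot]
  have hzG : ∀ n, Ideal.span (Set.range (z n)) ≤ G n := by
    intro n
    rw [Ideal.span_le]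
    rintro _ ⟨j, rfl⟩
    have hn : n < M + 1 := by
      by_contra! hn
      obtain ⟨m, rfl⟩ : ∃ m, n = m + 1 := ⟨n - 1, by omega⟩
      have h0 : v m = 0 := hM m (by omega)
      exact absurd j.2 (by change ¬ (j : ℕ) < v m; omega)
    refine (le_sup_right : _ ≤ G n) (Submodule.mem_iSup_of_mem (⟨⟨n, hn⟩, j⟩ : ι) ?_)
    have h1 : shiftedPow Q (n + 1) (d ⟨⟨n, hn⟩, j⟩) = ⊤ := by
      change (if n + 1 ≤ n + 1 then Q ^ (n + 1 - (n + 1)) else ⊥) = ⊤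
      rw [if_pos le_rfl, Nat.sub_self, pow_zero, Ideal.one_eq_top]
    rw [h1, Ideal.top_mul]
    exact Ideal.mem_span_singleton_self _
  have hFG : ∀ n, F (n + 1) ≤ G n := by
    intro n
    induction n with
    | zero =>
      rw [hz 0]
      refine sup_le (le_trans ?_ le_sup_left) (hzG 0)
      rw [pow_zero, one_mul]
    | succ n ih =>
      rw [hz (n + 1)]
      refine sup_le ((Ideal.mul_mono_right ih).trans ?_) (hzG (n + 1))
      rw [Ideal.mul_sup, Ideal.mul_iSup]
      refine sup_le_sup ?_ (iSup_mono fun i => ?_)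
      · rw [← mul_assoc, ← pow_succ']
      · rw [← mul_assoc]
        exact Ideal.mul_mono_left (hshift n i)
  have hrep : ∀ n, ∀ s ∈ F (n + 1), ∃ p : ι → A, (∀ j, p j ∈ shiftedPow Q (n + 1) (d j)) ∧
      ∃ w ∈ Q ^ n * I, s = ∑ j, p j * Z j + w := by
    intro n s hs
    obtain ⟨w, hw, t, ht, rfl⟩ := Submodule.mem_sup.1 (hFG n hs)
    obtain ⟨f, hf, rfl⟩ := (Submodule.mem_iSup_iff_exists_finsupp _ _).1 ht
    choose p hp hpf using fun i => Ideal.mem_mul_span_singleton.1 (hf i)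
    refine ⟨p, hp, w, hw, ?_⟩
    have h1 : (f.sum fun _ xi => xi) = ∑ j : ι, f j := Finsupp.sum_fintype _ _ fun _ => rfl
    rw [add_comm, h1]
    simp only [hpf]
  refine ⟨Fintype.card ι, ?_, pow_card_add_two_le hQI d Z ?_ ?_⟩
  · have hcard : Fintype.card ι = ∑ m ∈ Finset.range (M + 1), u m := by
      rw [Fintype.card_sigma, ← Fin.sum_univ_eq_sum_range]
      simp only [Fintype.card_fin]
    rw [hcard, Finset.sum_range_succ']
    have h1 : u 0 = ℓI - L 1 := rfl
    have h2 : ∀ m, u (m + 1) = v m := fun _ => rfl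
    simp only [h1, h2]
    push_cast [Nat.cast_sub hLI]
    linarith
  · intro i a ha
    have hZi : Z i ∈ F (d i) := by
      change z i.1 i.2 ∈ F (i.1 + 1)
      rw [hz]
      exact (le_sup_right : _ ≤ B i.1 ⊔ _) (Ideal.subset_span ⟨_, rfl⟩)
    obtain ⟨p, hp, w, hw, h⟩ := hrep (d i) _ (hmul _ (Ideal.mul_mem_mul ha hZi))
    refine ⟨p, hp, w, ?_, h⟩
    have h1 : Q ^ d i * I ≤ Q * I ^ d i := by
      change Q ^ ((i.1 : ℕ) + 1) * I ≤ Q * I ^ ((i.1 : ℕ) + 1)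
      rw [pow_succ', pow_succ, mul_assoc]
      exact Ideal.mul_mono_right (Ideal.mul_mono_left (Ideal.pow_right_mono hQI _))
    exact h1 hw
  · intro s hs
    have h1 : I ^ 2 ≤ F 2 := by
      rw [sq]
      exact (Ideal.mul_mono_right hIF).trans (hmul 1)
    obtain ⟨p, hp, w, hw, h⟩ := hrep 1 s (h1 hs)
    exact ⟨p, hp, w, by rwa [pow_one] at hw, h⟩

end FiltrationGenerators

section MinimalReduction

variable {A : Type*} [CommRing A]

theorem card_add_length_quotient_le {M ι : Type*} [AddCommGroup M] [Module A M] {W : Submodule A M}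
    {v : ι → M} (S : Finset ι)
    (h : ∀ c : ι → A, (∃ i ∈ S, IsUnit (c i)) → ∑ i ∈ S, c i • v i ∉ W) {U : Submodule A M}
    (hW : W ≤ U) (hv : ∀ i ∈ S, v i ∈ U) :
    S.card + Module.length A (M ⧸ U) ≤ Module.length A (M ⧸ W) := by
  classical
  suffices h : S.card + Module.length A (M ⧸ W ⊔ Submodule.span A (v '' S)) ≤
      Module.length A (M ⧸ W) by
    refine (add_le_add le_rfl (Submodule.length_quotient_le_of_le (sup_le hW ?_))).trans h
    rw [Submodule.span_le]
    rintro _ ⟨i, hi, rfl⟩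
    exact hv i hi
  clear hv hW
  induction S using Finset.induction_on with
  | empty =>
    rw [Finset.card_empty, Nat.cast_zero, zero_add]
    exact Submodule.length_quotient_le_of_le le_sup_left
  | insert i S hi ih =>
    have ih := ih fun c ⟨j, hj, hc⟩ hmem => by
      refine h (fun l => if l ∈ S then c l else 0) ⟨j, Finset.mem_insert_of_mem hj, ?_⟩ ?_
      · simpa [hj] using hc
      · rw [Finset.sum_insert hi, if_neg hi, zero_smul, zero_add]
        convert hmem using 1
        exact Finset.sum_congr rfl fun l hl => by rw [if_pos hl]
    have hle : W ⊔ Submodule.span A (v '' S) ≤ W ⊔ Submodule.span A (v '' (insert i S : Finset ι)) :=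
      sup_le_sup le_rfl (Submodule.span_mono (Set.image_mono (by simp)))
    have h1 : 1 ≤ Module.length A ((W ⊔ Submodule.span A (v '' (insert i S : Finset ι))).map
        (W ⊔ Submodule.span A (v '' S)).mkQ) := by
      rw [Order.one_le_iff_ne_zero]
      intro h0
      have h2 : v i ∈ W ⊔ Submodule.span A (v '' S) :=
        Submodule.le_of_length_map_mkQ_eq_zero h0 ((le_sup_right : _ ≤ W ⊔ _)
          (Submodule.subset_span ⟨i, by simp, rfl⟩))
      obtain ⟨w, hw, t, ht, hwt⟩ := Submodule.mem_sup.1 h2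
      obtain ⟨c, rfl⟩ := (Submodule.mem_span_image_finset_iff_exists_fun A).1 ht
      refine h (fun l => if hl : l ∈ S then -c ⟨l, hl⟩ else 1)
        ⟨i, Finset.mem_insert_self i S, by simp [hi]⟩ ?_
      rw [Finset.sum_insert hi, dif_neg hi, one_smul, ← hwt, ← Finset.sum_coe_sort S]
      convert hw using 1
      rw [add_assoc, ← Finset.sum_add_distrib, Finset.sum_eq_zero, add_zero]
      intro l _
      rw [dif_pos l.2, neg_smul, add_neg_cancel]
    rw [Submodule.length_quotient_eq_add_of_le hle] at ih
    rw [Finset.card_insert_of_notMem hi]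
    refine le_trans ?_ ih
    push_cast
    rw [add_assoc]
    exact add_le_add le_rfl (add_le_add h1 le_rfl)

theorem exists_isUnit_sum_mul_pow [IsLocalRing A] [Infinite (ResidueField A)] (c : ℕ → A) {N i₀ : ℕ}
    (hi₀ : i₀ < N) (hc : IsUnit (c i₀)) : ∃ t, IsUnit (∑ i ∈ Finset.range N, c i * t ^ i) := by
  let p : Polynomial (ResidueField A) :=
    ∑ i ∈ Finset.range N, Polynomial.monomial i (residue A (c i))
  have hp : p ≠ 0 := by
    intro h0
    have h1 : p.coeff i₀ = residue A (c i₀) := by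
      rw [Polynomial.finsetSum_coeff]
      simp [Polynomial.coeff_monomial, hi₀]
    rw [h0, Polynomial.coeff_zero] at h1
    exact (residue_ne_zero_iff_isUnit _).2 hc h1.symm
  obtain ⟨t', ht'⟩ : ∃ t, p.eval t ≠ 0 := by
    by_contra! h
    exact hp (Polynomial.funext fun t => by simpa using h t)
  obtain ⟨t, rfl⟩ := residue_surjective t'
  refine ⟨t, (residue_ne_zero_iff_isUnit _).1 ?_⟩
  rw [map_sum]
  simp only [map_mul, map_pow]
  rw [Polynomial.eval_finsetSum] at ht'
  simpa only [Polynomial.eval_monomial] using ht'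

theorem pow_mul_sub_pow_mul_mem {Q Q' : Ideal A} {x v w : A} (hxv : x - v ∈ Q') (hx : x ∈ Q)
    (hv : v ∈ Q) {i m n : ℕ} (hw : w ∈ Q ^ m) (himn : i + m = n + 1) :
    x ^ i * w - v ^ i * w ∈ Q' * Q ^ n := by
  rw [← sub_mul, ← (Commute.all x v).mul_geom_sum₂ i, mul_assoc]
  refine Ideal.mul_mem_mul hxv ?_
  rw [Finset.sum_mul]
  refine Ideal.sum_mem _ fun l hl => ?_
  have hl := Finset.mem_range.1 hl
  have h1 := Ideal.mul_mem_mul (Ideal.mul_mem_mul (Ideal.pow_mem_pow hx l)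
    (Ideal.pow_mem_pow hv (i - 1 - l))) hw
  rw [← pow_add, ← pow_add] at h1
  exact Ideal.pow_le_pow_right (by omega) h1

theorem pow_succ_le_mul_sup_span {Q Q' : Ideal A} {z : A} (hQ : Q = Q' ⊔ Ideal.span {z}) (n : ℕ) :
    Q ^ (n + 1) ≤ Q' * Q ^ n ⊔ Ideal.span {z ^ (n + 1)} := by
  induction n with
  | zero => simp [← hQ]
  | succ n ih =>
    have hz : z ∈ Q := hQ ▸ (le_sup_right : _ ≤ Q' ⊔ _) (Ideal.mem_span_singleton_self z)
    rw [pow_succ' Q (n + 1)]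
    refine (Ideal.mul_mono_right ih).trans ?_
    rw [Ideal.mul_sup]
    refine sup_le ?_ ?_
    · rw [mul_left_comm, ← pow_succ']
      exact le_sup_left
    · conv_lhs => rw [hQ]
      rw [Ideal.sup_mul, Ideal.span_singleton_mul_span_singleton, ← pow_succ']
      refine sup_le_sup (Ideal.mul_mono_right ?_) le_rfl
      rw [Ideal.span_le, Set.singleton_subset_iff]
      exact Ideal.pow_mem_pow hz _

theorem exists_pow_succ_le_mul_pow [IsNoetherianRing A] [IsLocalRing A]
    [Infinite (ResidueField A)] {Q K : Ideal A} {x y z : A}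
    (hQ : Q = K ⊔ Ideal.span {x, y, z}) (hQm : Q ≤ maximalIdeal A) {C : ℕ}
    (hC : ∀ n, Module.length A (A ⧸ Q ^ n) ≤ (C * n ^ 2 : ℕ)) :
    ∃ s t : A, ∃ n, Q ^ (n + 1) ≤ (K ⊔ Ideal.span {x - s * z, y - t * z}) * Q ^ n := by
  have hxyz : Ideal.span {x, y, z} ≤ Q := hQ ▸ le_sup_right
  have hx : x ∈ Q := hxyz (Ideal.subset_span (by simp))
  have hy : y ∈ Q := hxyz (Ideal.subset_span (by simp))
  have hz : z ∈ Q := hxyz (Ideal.subset_span (by simp))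
  let S : ℕ → Finset (ℕ × ℕ) := fun m => Finset.range (m + 1) ×ˢ Finset.range (m + 1)
  let v : ℕ → ℕ × ℕ → A := fun n ij => x ^ ij.1 * (y ^ ij.2 * z ^ (n + 1 - (ij.1 + ij.2)))
  have hmem : ∀ n, ∀ ij ∈ S ((n + 1) / 2), v n ij ∈ Q ^ (n + 1) := by
    intro n ij hij
    have hij := Finset.mem_product.1 hij
    have hi := Finset.mem_range.1 hij.1
    have hj := Finset.mem_range.1 hij.2
    have h1 := Ideal.mul_mem_mul (Ideal.pow_mem_pow hx ij.1)
      (Ideal.mul_mem_mul (Ideal.pow_mem_pow hy ij.2) (Ideal.pow_mem_pow hz (n + 1 - (ij.1 + ij.2))))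
    rw [← pow_add, ← pow_add] at h1
    exact Ideal.pow_le_pow_right (by omega) h1
  obtain ⟨n, c, ⟨ij₀, hij₀, hc⟩, hrel⟩ : ∃ n, ∃ c : ℕ × ℕ → A,
      (∃ ij ∈ S ((n + 1) / 2), IsUnit (c ij)) ∧
      ∑ ij ∈ S ((n + 1) / 2), c ij • v n ij ∈ maximalIdeal A * Q ^ (n + 1) := by
    by_contra! h
    have hstep : ∀ n, (((n + 1) / 2 + 1) * ((n + 1) / 2 + 1) : ℕ) +
        Module.length A (A ⧸ Q ^ (n + 1)) ≤ Module.length A (A ⧸ Q ^ (n + 2)) := by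
      intro n
      have h1 := card_add_length_quotient_le (S ((n + 1) / 2)) (h n) Ideal.mul_le_right (hmem n)
      rw [Finset.card_product, Finset.card_range] at h1
      refine h1.trans (Submodule.length_quotient_le_of_le ?_)
      rw [pow_succ' Q (n + 1)]
      exact Ideal.mul_mono_left hQm
    have hcube : ∀ N : ℕ, ((N ^ 3 : ℕ) : ℕ∞) ≤ 12 * Module.length A (A ⧸ Q ^ (N + 1)) := by
      intro N
      induction N with
      | zero => simp
      | succ N ih =>
        refine le_trans ?_ (mul_le_mul_right (hstep N) 12)
        rw [mul_add]
        refine le_trans ?_ (add_le_add le_rfl ih)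
        norm_cast
        have h2 : N + 2 ≤ 2 * ((N + 1) / 2 + 1) := by omega
        nlinarith
    have h1 := (hcube (48 * C + 1)).trans (mul_le_mul_right (hC _) 12)
    norm_cast at h1
    have h2 : (48 * C + 1 + 1) ^ 2 ≤ 4 * (48 * C + 1) ^ 2 := by nlinarith
    have h3 : 48 * C * (48 * C + 1) ^ 2 < (48 * C + 1) * (48 * C + 1) ^ 2 :=
      Nat.mul_lt_mul_of_pos_right (Nat.lt_succ_self _) (by positivity)
    have h4 := Nat.mul_le_mul_left (12 * C) h2
    linarith
  have hrect := Finset.mem_product.1 hij₀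
  obtain ⟨s, hs⟩ := exists_isUnit_sum_mul_pow (fun i => c (i, ij₀.2)) (Finset.mem_range.1 hrect.1) hc
  obtain ⟨t, ht⟩ := exists_isUnit_sum_mul_pow
    (fun j => ∑ i ∈ Finset.range ((n + 1) / 2 + 1), c (i, j) * s ^ i) (Finset.mem_range.1 hrect.2) hs
  refine ⟨s, t, n, ?_⟩
  set Q' := K ⊔ Ideal.span {x - s * z, y - t * z} with hQ'
  have hx' : x - s * z ∈ Q' := (le_sup_right : _ ≤ K ⊔ _) (Ideal.subset_span (by simp))
  have hy' : y - t * z ∈ Q' := (le_sup_right : _ ≤ K ⊔ _) (Ideal.subset_span (by simp))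
  have hQQ' : Q = Q' ⊔ Ideal.span {z} := by
    have hzz : z ∈ Q' ⊔ Ideal.span {z} :=
      (le_sup_right : _ ≤ Q' ⊔ _) (Ideal.mem_span_singleton_self z)
    refine le_antisymm ?_ (sup_le (sup_le ?_ ?_) ?_)
    · rw [hQ]
      refine sup_le (le_sup_left.trans le_sup_left) (Ideal.span_le.2 ?_)
      refine Set.insert_subset ?_ (Set.insert_subset ?_ (Set.singleton_subset_iff.2 hzz))
      · rw [SetLike.mem_coe, ← sub_add_cancel x (s * z)]
        exact add_mem ((le_sup_left : Q' ≤ _) hx') (Ideal.mul_mem_left _ _ hzz)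
      · rw [SetLike.mem_coe, ← sub_add_cancel y (t * z)]
        exact add_mem ((le_sup_left : Q' ≤ _) hy') (Ideal.mul_mem_left _ _ hzz)
    · exact hQ ▸ le_sup_left
    · rw [Ideal.span_le]
      refine Set.insert_subset ?_ (Set.singleton_subset_iff.2 ?_)
      · exact sub_mem hx (Ideal.mul_mem_left _ _ hz)
      · exact sub_mem hy (Ideal.mul_mem_left _ _ hz)
    · exact (Ideal.span_singleton_le_iff_mem _).2 hz
  refine Submodule.le_of_le_smul_of_le_jacobson_bot (IsNoetherian.noetherian _)
    (maximalIdeal_le_jacobson ⊥) ((pow_succ_le_mul_sup_span hQQ' n).trans (sup_le le_sup_left ?_))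
  rw [Ideal.span_singleton_le_iff_mem]
  set u := ∑ j ∈ Finset.range ((n + 1) / 2 + 1),
    (∑ i ∈ Finset.range ((n + 1) / 2 + 1), c (i, j) * s ^ i) * t ^ j with hu
  have hdiff : ∑ ij ∈ S ((n + 1) / 2), c ij • v n ij - u * z ^ (n + 1) ∈ Q' * Q ^ n := by
    have hu' : u * z ^ (n + 1) = ∑ ij ∈ S ((n + 1) / 2),
        c ij * (s ^ ij.1 * t ^ ij.2 * z ^ (n + 1)) := by
      rw [Finset.sum_product_right, hu, Finset.sum_mul]
      refine Finset.sum_congr rfl fun j _ => ?_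
      rw [Finset.sum_mul, Finset.sum_mul]
      exact Finset.sum_congr rfl fun i _ => by ring
    rw [hu', ← Finset.sum_sub_distrib]
    refine Ideal.sum_mem _ fun ij hij => ?_
    rw [smul_eq_mul, ← mul_sub]
    refine Ideal.mul_mem_left _ _ ?_
    obtain ⟨i, j⟩ := ij
    have hij := Finset.mem_product.1 hij
    have hi := Finset.mem_range.1 hij.1
    have hj := Finset.mem_range.1 hij.2
    simp only at hi hj
    have hsz : s * z ∈ Q := Ideal.mul_mem_left _ _ hz
    have htz : t * z ∈ Q := Ideal.mul_mem_left _ _ hz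
    have h1 := Ideal.mul_mem_mul (Ideal.pow_mem_pow hy j)
      (Ideal.pow_mem_pow hz (n + 1 - (i + j)))
    have h2 := Ideal.mul_mem_mul (Ideal.pow_mem_pow hsz i)
      (Ideal.pow_mem_pow hz (n + 1 - (i + j)))
    rw [← pow_add] at h1 h2
    have h3 := add_mem (pow_mul_sub_pow_mul_mem hx' hx hsz h1 (i := i) (n := n) (by omega))
      (pow_mul_sub_pow_mul_mem hy' hy htz h2 (i := j) (n := n) (by omega))
    have h4 : z ^ (n + 1) = z ^ i * z ^ j * z ^ (n + 1 - (i + j)) := by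
      rw [← pow_add, ← pow_add]
      congr 1
      omega
    convert h3 using 1
    change x ^ i * (y ^ j * z ^ (n + 1 - (i + j))) - s ^ i * t ^ j * z ^ (n + 1) = _
    rw [h4]
    ring
  have huz : u * z ^ (n + 1) ∈ Q' * Q ^ n ⊔ maximalIdeal A * Q ^ (n + 1) := by
    rw [← sub_sub_cancel (∑ ij ∈ S ((n + 1) / 2), c ij • v n ij) (u * z ^ (n + 1))]
    exact sub_mem ((le_sup_right : _ ≤ Q' * Q ^ n ⊔ _) hrel)
      ((le_sup_left : Q' * Q ^ n ≤ _) hdiff)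
  exact (Ideal.unit_mul_mem_iff_mem _ ht).1 huz

end MinimalReduction

section RegularPairs

theorem IsRegPair.pow_pow {A : Type*} [CommRing A] {a b : A} (h : IsRegPair a b) (n : ℕ) : IsRegPair (a ^ n) (b ^ n) where
  left := h.left_pow n
  right := h.symm.left_pow n
  syz u v huv := by
    have h1 : IsRegPair (b ^ n) a :=
      { left := h.symm.left_pow n
        right := h.left
        syz := fun u v huv => by
          obtain ⟨w, hw, hw'⟩ := h.syz_pow n v u huv.symm
          exact ⟨w, hw', hw⟩ }
    obtain ⟨w, hw, hw'⟩ := h1.syz_pow n v u huv.symm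
    exact ⟨w, hw', hw⟩

variable {A : Type*} [CommRing A] [IsNoetherianRing A] [IsLocalRing A]

theorem length_quotient_ne_top_of_pow_le {J : Ideal A} {n : ℕ} (h : maximalIdeal A ^ n ≤ J) :
    Module.length A (A ⧸ J) ≠ ⊤ := by
  have := isArtinianRing_quotient_of_pow_le h
  rw [Module.length_ne_top_iff, isFiniteLength_iff_isNoetherian_isArtinian]
  exact ⟨inferInstance,
    isArtinian_of_surjective_algebraMap (R := A ⧸ J) Ideal.Quotient.mk_surjective⟩

theorem eq_zero_of_mul_eq_zero_of_exists {x y : A} (hy : y ∈ maximalIdeal A)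
    (h : ∀ u, x * u = 0 → ∃ w, u = y * w ∧ x * w = 0) (u : A) (hu : x * u = 0) : u = 0 := by
  have h0 : LinearMap.ker (LinearMap.mulLeft A x) = ⊥ := by
    refine Submodule.eq_bot_of_le_smul_of_le_jacobson_bot (maximalIdeal A) _
      (IsNoetherian.noetherian _) ?_ (maximalIdeal_le_jacobson ⊥)
    intro v hv
    obtain ⟨w, rfl, hw⟩ := h v hv
    exact Submodule.smul_mem_smul hy hw
  have h1 : u ∈ LinearMap.ker (LinearMap.mulLeft A x) := hu
  rwa [h0, Submodule.mem_bot] at h1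

theorem IsRegPair.of_mem_span {a b : A} (ha : ∀ u, a * u = 0 → u = 0)
    (hb : ∀ w, b * w ∈ Ideal.span {a} → w ∈ Ideal.span {a}) (ham : a ∈ maximalIdeal A) :
    IsRegPair a b where
  left := ha
  right := by
    refine eq_zero_of_mul_eq_zero_of_exists ham fun u hu => ?_
    obtain ⟨w, rfl⟩ := Ideal.mem_span_singleton'.1 (hb u (hu ▸ zero_mem _))
    refine ⟨w, mul_comm _ _, ha _ ?_⟩
    rw [← hu]
    ring
  syz u v huv := by
    obtain ⟨w, rfl⟩ := Ideal.mem_span_singleton'.1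
      (hb v (huv ▸ Ideal.mul_mem_right _ _ (Ideal.mem_span_singleton_self a)))
    refine ⟨w, sub_eq_zero.1 (ha _ ?_), mul_comm _ _⟩
    rw [mul_sub, huv]
    ring

theorem IsRegPair.of_mem_span_pair {a b x y : A} (h : IsRegPair a b)
    (ha : a ∈ Ideal.span {x, y}) (hb : b ∈ Ideal.span {x, y}) (hx : x ∈ maximalIdeal A)
    (hy : y ∈ maximalIdeal A) : IsRegPair x y := by
  obtain ⟨α, β, rfl⟩ := Ideal.mem_span_pair.1 ha
  obtain ⟨γ, δ, rfl⟩ := Ideal.mem_span_pair.1 hb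
  have hsyz : ∀ u v, x * u = y * v → ∃ w, u = y * w ∧ v = x * w := by
    intro u v huv
    obtain ⟨w, -, hw⟩ := h.syz (γ * v + δ * u) (α * v + β * u) (by
      linear_combination (α * δ - β * γ) * huv)
    refine ⟨w, sub_eq_zero.1 (h.left _ ?_), sub_eq_zero.1 (h.left _ ?_)⟩
    · linear_combination α * huv + y * hw
    · linear_combination -β * huv + x * hw
  refine ⟨eq_zero_of_mul_eq_zero_of_exists hy fun u hu => ?_,
    eq_zero_of_mul_eq_zero_of_exists hx fun u hu => ?_, hsyz⟩
  · obtain ⟨w, hw, hw'⟩ := hsyz u 0 (by rw [hu, mul_zero])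
    exact ⟨w, hw, hw'.symm⟩
  · obtain ⟨w, hw, hw'⟩ := hsyz 0 u (by rw [hu, mul_zero])
    exact ⟨w, hw', hw.symm⟩

theorem exists_isRegPair (hdim : ringKrullDim A = 2)
    (hCM : ∃ a : Fin 2 → A, (∀ i, a i ∈ maximalIdeal A) ∧ IsRegularSeq a) :
    ∃ a b : A, IsRegPair a b ∧ Ideal.span {a, b} ≤ maximalIdeal A ∧
      ∃ r, maximalIdeal A ^ r ≤ Ideal.span {a, b} := by
  obtain ⟨a, ham, hreg, htop⟩ := hCM
  have h0 : ∀ u, a 0 * u = 0 → u = 0 := fun u hu => by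
    simpa using hreg 0 u (by simp [hu])
  have hset : {j : Fin 2 | j < 1} = {0} := by
    ext j
    simp only [Set.mem_ofPred_eq, Set.mem_singleton_iff]
    omega
  have h1 : ∀ w, a 1 * w ∈ Ideal.span {a 0} → w ∈ Ideal.span {a 0} := fun w hw => by
    have := hreg 1 w
    rw [hset, Set.image_singleton] at this
    exact this hw
  have hpair : Ideal.span {a 0, a 1} = Ideal.ofList [a 0, a 1] := by
    rw [Ideal.ofList]
    congr 1
    ext w
    simp
  have hle : Ideal.span {a 0, a 1} ≤ maximalIdeal A :=
    Ideal.span_le.2 (Set.insert_subset (ham 0) (Set.singleton_subset_iff.2 (ham 1)))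
  refine ⟨a 0, a 1, IsRegPair.of_mem_span h0 h1 (ham 0), hle, ?_⟩
  have hR : RingTheory.Sequence.IsRegular A [a 0, a 1] := by
    rw [RingTheory.Sequence.isRegular_iff, RingTheory.Sequence.isWeaklyRegular_cons_iff,
      RingTheory.Sequence.isWeaklyRegular_cons_iff]
    refine ⟨⟨isSMulRegular_iff_right_eq_zero_of_smul.2 h0, ?_,
      RingTheory.Sequence.IsWeaklyRegular.nil _ _⟩, ?_⟩
    · refine (isSMulRegular_quotient_iff_mem_of_smul_mem _ _).2 fun w hw => ?_
      rw [← Submodule.ideal_span_singleton_smul, smul_eq_mul, Ideal.mul_top] at hw ⊢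
      exact h1 w hw
    · rw [smul_eq_mul, Ideal.mul_top, ← hpair]
      intro h
      exact (maximalIdeal.isMaximal A).ne_top (top_le_iff.1 (h ▸ hle))
  have h2 := ringKrullDim_add_length_eq_ringKrullDim_of_isRegular _ hR
  rw [hdim, ← hpair] at h2
  simp only [List.length_cons, List.length_nil] at h2
  have h3 : ringKrullDim (A ⧸ Ideal.span {a 0, a 1}) ≤ (0 : ℕ) := by
    generalize ringKrullDim (A ⧸ Ideal.span {a 0, a 1}) = d at h2
    induction d with
    | bot => exact bot_le
    | coe d =>
      have h4 : ((d + 2 : ℕ∞) : WithBot ℕ∞) = ((0 + 2 : ℕ∞) : WithBot ℕ∞) := h2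
      have h5 := (ENat.add_left_injective_of_ne_top (n := 2) (by simp)) (WithBot.coe_injective h4)
      subst h5
      rfl
  have : IsArtinianRing (A ⧸ Ideal.span {a 0, a 1}) :=
    isArtinianRing_iff_isNoetherianRing_krullDimLE_zero.2
      ⟨inferInstance, Ring.krullDimLE_iff.2 h3⟩
  exact exists_maximalIdeal_pow_le_of_isArtinianRing_quotient _

theorem exists_isRegPair_of_pow_le (hdim : ringKrullDim A = 2)
    (hCM : ∃ a : Fin 2 → A, (∀ i, a i ∈ maximalIdeal A) ∧ IsRegularSeq a) {Q : Ideal A} {p : ℕ}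
    (hp : maximalIdeal A ^ p ≤ Q) :
    ∃ a b : A, IsRegPair a b ∧ Ideal.span {a, b} ≤ Q ∧
      Module.length A (A ⧸ Ideal.span {a, b}) ≠ ⊤ := by
  obtain ⟨a, b, h, hle, r, hr⟩ := exists_isRegPair hdim hCM
  refine ⟨a ^ p, b ^ p, h.pow_pow p, ?_, length_quotient_ne_top_of_pow_le (n := r * (p + p)) ?_⟩
  · exact Ideal.span_le.2 (Set.insert_subset (hp (Ideal.pow_mem_pow (hle (Ideal.subset_span
      (by simp))) p)) (Set.singleton_subset_iff.2 (hp (Ideal.pow_mem_pow (hle (Ideal.subset_span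
      (by simp))) p))))
  · rw [pow_mul]
    refine (Ideal.pow_right_mono hr _).trans ?_
    rw [Ideal.span_insert, Ideal.span_insert, ← Ideal.span_singleton_pow,
      ← Ideal.span_singleton_pow]
    exact Ideal.sup_pow_add_le_pow_sup_pow

theorem exists_length_quotient_pow_le (hdim : ringKrullDim A = 2)
    (hCM : ∃ a : Fin 2 → A, (∀ i, a i ∈ maximalIdeal A) ∧ IsRegularSeq a) {Q : Ideal A} {p : ℕ}
    (hp : maximalIdeal A ^ p ≤ Q) :
    ∃ C : ℕ, ∀ n, Module.length A (A ⧸ Q ^ n) ≤ (C * n ^ 2 : ℕ) := by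
  obtain ⟨a, b, h, hle, hfin⟩ := exists_isRegPair_of_pow_le hdim hCM hp
  obtain ⟨t, ht⟩ := ENat.ne_top_iff_exists.1 hfin
  refine ⟨t, fun n => (Submodule.length_quotient_le_of_le (Ideal.pow_right_mono hle n)).trans ?_⟩
  rw [h.length_quotient_pow, ← ht, mul_comm t]
  norm_cast
  refine Nat.mul_le_mul_right t ?_
  rw [Nat.choose_two_right, Nat.add_sub_cancel]
  refine Nat.div_le_of_le_mul ?_
  nlinarith [Nat.le_self_pow two_ne_zero n]

theorem IsMinimalReduction.exists_eq_span_pair [Infinite (ResidueField A)]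
    (hdim : ringKrullDim A = 2)
    (hCM : ∃ a : Fin 2 → A, (∀ i, a i ∈ maximalIdeal A) ∧ IsRegularSeq a) {Q I : Ideal A}
    (hQ : IsMinimalReduction Q I) (hQm : Q ≤ maximalIdeal A) {p : ℕ}
    (hp : maximalIdeal A ^ p ≤ Q) : ∃ x y, Q = Ideal.span {x, y} := by
  classical
  have hfg : ∃ n : ℕ, ∃ f : Fin n → A, Submodule.span A (Set.range f) = Q :=
    Submodule.fg_iff_exists_fin_generating_family.1 (IsNoetherian.noetherian Q)
  obtain ⟨f, hf⟩ := Nat.find_spec hfg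
  have hmin : ∀ m, m < Nat.find hfg → ¬ ∃ f : Fin m → A, Submodule.span A (Set.range f) = Q :=
    fun m hm => Nat.find_min hfg hm
  generalize Nat.find hfg = d at f hmin
  match d, f, hf, hmin with
  | 0, f, hf, _ => exact ⟨0, 0, by rw [← hf]; simp [Set.range_eq_empty]⟩
  | 1, f, hf, _ => exact ⟨f 0, f 0, by rw [← hf]; simp [Set.range_unique]⟩
  | 2, f, hf, _ =>
    refine ⟨f 0, f 1, ?_⟩
    rw [← hf]
    congr 1
    ext w
    simp [Fin.exists_fin_two, eq_comm]
  | d + 3, f, hf, hmin =>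
    obtain ⟨C, hC⟩ := exists_length_quotient_pow_le hdim hCM hp
    obtain ⟨x, f, rfl⟩ : ∃ x g, f = Fin.cons x g := ⟨_, _, (Fin.cons_self_tail f).symm⟩
    obtain ⟨y, f, rfl⟩ : ∃ x g, f = Fin.cons x g := ⟨_, _, (Fin.cons_self_tail f).symm⟩
    obtain ⟨z, f, rfl⟩ : ∃ x g, f = Fin.cons x g := ⟨_, _, (Fin.cons_self_tail f).symm⟩
    simp only [Fin.range_cons] at hf
    have hQe : Q = Ideal.span (Set.range f) ⊔ Ideal.span {x, y, z} := by
      rw [← Ideal.span_union, ← hf, Ideal.span]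
      congr 1
      ext w
      simp only [Set.mem_insert_iff, Set.mem_union, Set.mem_singleton_iff]
      tauto
    obtain ⟨s, t, n, hn⟩ := exists_pow_succ_le_mul_pow hQe hQm hC
    have hle : Ideal.span (Set.range f) ⊔ Ideal.span {x - s * z, y - t * z} ≤ Q := by
      rw [hQe]
      refine sup_le_sup le_rfl (Ideal.span_le.2 (Set.insert_subset ?_
        (Set.singleton_subset_iff.2 ?_)))
      · exact sub_mem (Ideal.subset_span (by simp))
          (Ideal.mul_mem_left _ _ (Ideal.subset_span (by simp)))
      · exact sub_mem (Ideal.subset_span (by simp))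
          (Ideal.mul_mem_left _ _ (Ideal.subset_span (by simp)))
    obtain ⟨⟨hQI, m, hm⟩, hQmin⟩ := hQ
    refine (hmin (d + 2) (by omega) ⟨Fin.cons (x - s * z) (Fin.cons (y - t * z) f), ?_⟩).elim
    rw [← hQmin _ hle ⟨hle.trans hQI, n + m, ?_⟩]
    · rw [← Ideal.span_union, Fin.range_cons, Fin.range_cons, Ideal.span]
      congr 1
      ext w
      simp only [Set.mem_insert_iff, Set.mem_union, Set.mem_singleton_iff]
      tauto
    · have hk : ∀ k, I ^ (k + m) = Q ^ k * I ^ m := by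
        intro k
        induction k with
        | zero => simp
        | succ k ih =>
          rw [show k + 1 + m = 1 + (k + m) by ring, pow_add, ih, mul_left_comm, pow_one,
            ← pow_succ', hm, ← mul_assoc, ← pow_succ]
      refine le_antisymm ?_ ?_
      · rw [show n + m + 1 = (n + 1) + m by ring, hk, hk, ← mul_assoc]
        exact Ideal.mul_mono_left hn
      · rw [pow_succ' I]
        exact Ideal.mul_mono_left (hle.trans hQI)

end RegularPairs

/-- **Corollary 3.6 (2).**  Let `(A, 𝔪)` be a two-dimensional analytically
unramified Cohen–Macaulay Noetherian local ring with infinite residue field, and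
`I` an `𝔪`-primary ideal with a minimal reduction `Q`.  If
`ℓ_A(A/(I^(n+1))‾) = ē₀·C(n+2,2) − ē₁·C(n+1,1) + ē₂·C(n,0)` for all large `n`
(the normal Hilbert coefficients of `I`, defined via the integral closure
filtration) and `ℓ_A(A/I) = ℓI`, then `r_Q(I) ≤ ē₁ − ē₀ + ℓI + 1`. -/
theorem reduction_number_le_normal_hilbert_coeffs {A : Type*} [CommRing A]
    [IsNoetherianRing A] [IsLocalRing A]
    (hdim : ringKrullDim A = 2)
    (hCM : ∃ a : Fin 2 → A, (∀ i, a i ∈ maximalIdeal A) ∧ IsRegularSeq a)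
    (hres : Infinite (ResidueField A))
    (hunram : IsReduced (AdicCompletion (maximalIdeal A) A))
    (I Q : Ideal A) (hprim : I.IsPrimary) (hrad : I.radical = maximalIdeal A)
    (hQ : IsMinimalReduction Q I)
    (L : ℕ → ℕ)
    (hL : ∀ n : ℕ, modLength A (A ⧸ idealICIdeal (I ^ n)) = ((L n : ℕ∞) : WithBot ℕ∞))
    (e₀ e₁ e₂ : ℤ)
    (hcoef : ∃ N₀ : ℕ, ∀ n : ℕ, N₀ ≤ n →
      (L (n + 1) : ℤ) = e₀ * ((n + 2).choose 2 : ℕ) - e₁ * ((n + 1).choose 1 : ℕ)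
        + e₂ * (n.choose 0 : ℕ))
    (ℓI : ℕ) (hℓI : modLength A (A ⧸ I) = ((ℓI : ℕ∞) : WithBot ℕ∞)) :
    WithTop.map (fun m : ℕ => (m : ℤ)) (redNum Q I)
      ≤ ((e₁ - e₀ + (ℓI : ℤ) + 1 : ℤ) : WithTop ℤ) := by
  have hIm : I ≤ maximalIdeal A := hrad ▸ Ideal.le_radical
  obtain ⟨p, hp⟩ := Ideal.exists_pow_le_of_le_radical_of_fg hrad.ge
    (IsNoetherian.noetherian (maximalIdeal A))
  obtain ⟨hQI, r, hr⟩ := hQ.1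
  have hpQ : maximalIdeal A ^ (p * (r + 1)) ≤ Q := by
    rw [pow_mul]
    exact (Ideal.pow_right_mono hp _).trans (hr ▸ Ideal.mul_le_left)
  obtain ⟨x, y, rfl⟩ := hQ.exists_eq_span_pair hdim hCM (hQI.trans hIm) hpQ
  have hx : x ∈ maximalIdeal A := hIm (hQI (Ideal.subset_span (by simp)))
  have hy : y ∈ maximalIdeal A := hIm (hQI (Ideal.subset_span (by simp)))
  obtain ⟨a, b, hab, hle, -⟩ := exists_isRegPair_of_pow_le hdim hCM hpQ
  have h : IsRegPair x y := hab.of_mem_span_pair (hle (Ideal.subset_span (by simp)))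
    (hle (Ideal.subset_span (by simp))) hx hy
  have hfin := length_quotient_ne_top_of_pow_le hpQ
  obtain ⟨c, hc⟩ := h.asympIdeal_le_pow hunram hx hy hpQ hfin
  have hrj : ∀ j, I ^ j ≤ Ideal.span {x, y} ^ (j - r) := by
    intro j
    rcases le_total j r with hj | hj
    · simp [Nat.sub_eq_zero_of_le hj]
    · obtain ⟨k, rfl⟩ := Nat.exists_eq_add_of_le hj
      rw [Nat.add_sub_cancel_left]
      have hk : I ^ (r + k) = Ideal.span {x, y} ^ k * I ^ r := by
        clear hj
        induction k with
        | zero => simp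
        | succ k ih =>
          rw [← add_assoc, pow_succ', ih, mul_left_comm, ← pow_succ', hr, ← mul_assoc, ← pow_succ]
      exact hk ▸ Ideal.mul_le_left
  have hF := h.idealICIdeal_eq hQI hrj hc
  have hLF : ∀ n, Module.length A (A ⧸ asympIdeal (Ideal.span {x, y}) n) = L n := fun n =>
    WithBot.coe_injective ((Module.coe_length _ _).trans (hF n ▸ hL n))
  have hL0 : L 0 = 0 := by
    have h0 := hLF 0
    rw [asympIdeal_zero, Module.length_eq_zero_iff.2 (Ideal.Quotient.subsingleton_iff.2 rfl)] at h0
    exact_mod_cast h0.symm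
  have hI1 : I ≤ asympIdeal (Ideal.span {x, y}) 1 := by
    rw [← hF 1, pow_one]
    refine fun z hz => Ideal.subset_span ⟨1, one_pos, fun _ => -z, ?_, by simp⟩
    simpa using hz
  obtain ⟨q, hq⟩ := ENat.ne_top_iff_exists.1 hfin
  obtain ⟨N₀, hN₀⟩ := hcoef
  have hqe : (q : ℤ) ≤ e₀ := by
    refine le_leading_coeff_of_choose_mul_le (c := c) hN₀ fun n => ?_
    have h1 := Submodule.length_quotient_le_of_le (hc n)
    rw [h.length_quotient_pow, hLF, ← hq] at h1
    exact_mod_cast h1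
  have hmul : ∀ n, I * asympIdeal (Ideal.span {x, y}) n ≤
      asympIdeal (Ideal.span {x, y}) (n + 1) := fun n => Ideal.mul_le.2 fun z hz w hw => by
    rw [add_comm]
    exact mul_mem_asympIdeal (hI1 hz) hw
  obtain ⟨k, hk, hle⟩ := exists_pow_le_mul_pow hQI hI1 hmul
    (fun n z => h.mem_asympIdeal_of_mul_left) hLF hL0 hq.symm
    (WithBot.coe_injective ((Module.coe_length _ _).trans hℓI)) hqe hN₀
  have hred : redNum (Ideal.span {x, y}) I ≤ ((k + 1 : ℕ) : ℕ∞) :=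
    sInf_le ⟨k + 1, rfl, le_antisymm hle (pow_succ' I (k + 1) ▸ Ideal.mul_mono_left hQI)⟩
  obtain ⟨m, hm, hmk⟩ := ENat.le_natCast_iff.1 hred
  rw [hm]
  refine WithTop.coe_le_coe.2 ?_
  have : (m : ℤ) ≤ k + 1 := by exact_mod_cast hmk
  linarith
end

section
/- Let A be a commutative ring, Q ⊆ I ideals of A, and let {F_n}_{n≥0} be a family of ideals of A such that F_0 = A, I·F_n ⊆ F_{n+1} for all n ≥ 0, and I^{k+1} ⊆ Q·F_k for some k ≥ 0. Suppose that for every n ≥ 0 the A-module F_n/(Q·F_{n-1} + I^n) is finitely generated, and is zero for all sufficiently large n. Then F_n = Q·F_{n−1} for all sufficiently large n. -/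
/-- Let `A` be a commutative ring, `Q ⊆ I` ideals, and `{F n}` a family of ideals
with `F 0 = A`, `I·F n ⊆ F (n+1)`, and `I^(k+1) ⊆ Q·F k` for some `k ≥ 0`.  If each
quotient `F n / (Q·F (n-1) + I^n)` is finitely generated (i.e. there is a finite set
`s` with `F n = Q·F (n-1) + I^n + span s`) and vanishes for all large `n`
(i.e. `F n = Q·F (n-1) + I^n`), then `F n = Q·F (n-1)` for all large `n`. -/
theorem eventually_F_eq_Q_mul {A : Type*} [CommRing A] (Q I : Ideal A) (hQI : Q ≤ I)
    (F : ℕ → Ideal A) (hF0 : F 0 = ⊤)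
    (hFI : ∀ n : ℕ, I * F n ≤ F (n + 1))
    (k : ℕ) (hk : I ^ (k + 1) ≤ Q * F k)
    (hfg : ∀ n : ℕ, 1 ≤ n →
      ∃ s : Finset A, F n = Q * F (n - 1) + I ^ n + Ideal.span (↑s : Set A))
    (N : ℕ) (hvan : ∀ n : ℕ, N ≤ n → F n = Q * F (n - 1) + I ^ n) :
    ∃ M : ℕ, ∀ n : ℕ, M ≤ n → F n = Q * F (n - 1) := by
  have hpow : ∀ m : ℕ, I ^ (k + m + 1) ≤ Q * F (k + m) := by
    intro m
    induction m with
    | zero => exact hk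
    | succ m ih =>
      calc I ^ (k + m + 1 + 1) = I * I ^ (k + m + 1) := pow_succ' _ _
        _ ≤ I * (Q * F (k + m)) := mul_le_mul_right ih I
        _ = Q * (I * F (k + m)) := mul_left_comm _ _ _
        _ ≤ Q * F (k + m + 1) := mul_le_mul_right (hFI _) Q
  refine ⟨max N (k + 1), fun n hn => ?_⟩
  obtain ⟨hN, hkn⟩ := max_le_iff.mp hn
  obtain ⟨m, rfl⟩ : ∃ m, n = k + m + 1 := ⟨n - (k + 1), by omega⟩
  exact (hvan _ hN).trans (sup_eq_left.mpr (hpow m))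
end

section
/- Let n ≥ 3, let k be a field, let S = k[X_0, X_1, …, X_n] be the polynomial ring, and let 𝔞 ⊆ S be the ideal generated by the 2×2 minors of the matrix with rows (X_0, X_1, …, X_{n−1}) and (X_1, X_2, …, X_n). Let A = S/𝔞 and let x_i denote the image of X_i in A. Let 𝔪 = (x_0, x_1, …, x_n) and Q = (x_0, x_n). Then 𝔪² = Q·𝔪. -/
set_option synthInstance.maxHeartbeats 1000000

open MvPolynomial

/-- If `x 0, …, x n` satisfy the relations `x i * x (j + 1) = x (i + 1) * x j` for `i < j`, then
every product `x i * x j` lies in `(x 0, x n) * (x 0, …, x n)`. -/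
theorem mul_mem_span_pair_mul_span_range {R : Type*} [CommRing R] {n : ℕ} {x : Fin (n + 1) → R}
    (hrel : ∀ i j : Fin n, i < j → x i.castSucc * x j.succ = x i.succ * x j.castSucc)
    (i j : Fin (n + 1)) (hij : i ≤ j) :
    x i * x j ∈ Ideal.span {x 0, x (Fin.last n)} * Ideal.span (Set.range x) := by
  have hrange (l : Fin (n + 1)) : x l ∈ Ideal.span (Set.range x) :=
    Ideal.subset_span (Set.mem_range_self l)
  induction i using Fin.induction generalizing j with
  | zero => exact Ideal.mul_mem_mul (Ideal.subset_span (by simp)) (hrange j)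
  | succ i ih =>
    cases j using Fin.lastCases with
    | last =>
      rw [mul_comm (x i.succ)]
      exact Ideal.mul_mem_mul (Ideal.subset_span (by simp)) (hrange i.succ)
    | cast j =>
      have hlt : i < j := Fin.succ_le_castSucc_iff.mp hij
      rw [← hrel i j hlt]
      exact ih j.succ ((Fin.castSucc_lt_succ_iff.mpr hlt.le).le)

/-- **Example 4.1, setup for (1).**  Let `n ≥ 3`, `S = k[X 0, …, X n]`, and `𝔞` the
ideal generated by the 2×2 minors `X i · X (j+1) − X (i+1) · X j` (`0 ≤ i < j ≤ n−1`)
of the matrix with rows `(X 0, …, X (n-1))` and `(X 1, …, X n)`.  In `A = S/𝔞`, with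
`x i` the image of `X i`, `𝔪 = (x 0, …, x n)` and `Q = (x 0, x n)`, one has
`𝔪² = Q·𝔪`. -/
theorem maximal_ideal_sq_eq (n : ℕ) (hn : 3 ≤ n) (k : Type*) [Field k]
    (𝔞 : Ideal (MvPolynomial (Fin (n + 1)) k))
    (h𝔞 : 𝔞 = Ideal.span {f | ∃ (i j : ℕ) (hij : i < j) (hj : j + 1 ≤ n),
      f = X (⟨i, by omega⟩ : Fin (n + 1)) * X (⟨j + 1, by omega⟩ : Fin (n + 1))
        - X (⟨i + 1, by omega⟩ : Fin (n + 1)) * X (⟨j, by omega⟩ : Fin (n + 1))})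
    (x : Fin (n + 1) → MvPolynomial (Fin (n + 1)) k ⧸ 𝔞)
    (hx : ∀ i, x i = Ideal.Quotient.mk 𝔞 (X i))
    (𝔪 Q : Ideal (MvPolynomial (Fin (n + 1)) k ⧸ 𝔞))
    (h𝔪 : 𝔪 = Ideal.span (Set.range x))
    (hQ : Q = Ideal.span {x ⟨0, by omega⟩, x ⟨n, by omega⟩}) :
    𝔪 ^ 2 = Q * 𝔪 := by
  have hrel (i j : Fin n) (hij : i < j) :
      x i.castSucc * x j.succ = x i.succ * x j.castSucc := by
    simp only [hx, ← map_mul]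
    rw [Ideal.Quotient.eq, h𝔞]
    exact Ideal.subset_span ⟨i, j, hij, j.isLt, rfl⟩
  have hmem := mul_mem_span_pair_mul_span_range hrel
  rw [h𝔪, hQ, pow_two]
  apply le_antisymm
  · rw [Ideal.span_mul_span', Ideal.span_le]
    rintro _ ⟨_, ⟨i, rfl⟩, _, ⟨j, rfl⟩, rfl⟩
    rcases le_total i j with hij | hij
    · exact hmem i j hij
    · show x i * x j ∈ _
      rw [mul_comm (x i)]
      exact hmem j i hij
  · refine Ideal.mul_mono_left (Ideal.span_mono ?_)
    rintro _ (rfl | rfl) <;> exact ⟨_, rfl⟩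
end

section
/- Let n ≥ 3, let k be a field, let S = k[X_0, X_1, …, X_n], let 𝔞 ⊆ S be the ideal generated by the 2×2 minors of the matrix with rows (X_0, …, X_{n−1}) and (X_1, …, X_n), and let A = S/𝔞 with x_i the image of X_i. Let J = (x_0, x_1, …, x_{n−1}) and Q = (x_0, x_{n−1}). Then J² = Q·J. -/
set_option synthInstance.maxHeartbeats 1000000

open MvPolynomial

/-- If the `2 × 2` minors of the matrix with rows `(y 0, …, y (m - 1))` and `(y 1, …, y m)` vanish,
then every product `y i * y j` with `i ≤ j ≤ m` lies in `(y 0, y m) * (y 0, …, y m)`. -/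
theorem mul_mem_span_pair_mul_span {A : Type*} [CommRing A] (m : ℕ) (y : ℕ → A)
    (hy : ∀ i j, i < j → j + 1 ≤ m → y i * y (j + 1) = y (i + 1) * y j)
    (i j : ℕ) (hij : i ≤ j) (hj : j ≤ m) :
    y i * y j ∈ Ideal.span {y 0, y m} * Ideal.span {a | ∃ i ≤ m, a = y i} := by
  induction i generalizing j with
  | zero =>
    exact Ideal.mul_mem_mul (Ideal.subset_span (by simp)) (Ideal.subset_span ⟨j, hj, rfl⟩)
  | succ i ih =>
    obtain rfl | hjm := hj.eq_or_lt
    · rw [mul_comm (y _)]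
      exact Ideal.mul_mem_mul (Ideal.subset_span (by simp)) (Ideal.subset_span ⟨_, hij, rfl⟩)
    · rw [← hy i j (by omega) hjm]
      exact ih (j + 1) (by omega) hjm

/-- The ideal `(y 0, y m)` is a reduction of `(y 0, …, y m)` with reduction number at most one when
the `2 × 2` minors of the matrix with rows `(y 0, …, y (m - 1))` and `(y 1, …, y m)` vanish. -/
theorem span_sq_eq_span_pair_mul_span {A : Type*} [CommRing A] (m : ℕ) (y : ℕ → A)
    (hy : ∀ i j, i < j → j + 1 ≤ m → y i * y (j + 1) = y (i + 1) * y j) :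
    Ideal.span {a | ∃ i ≤ m, a = y i} ^ 2 =
      Ideal.span {y 0, y m} * Ideal.span {a | ∃ i ≤ m, a = y i} := by
  apply le_antisymm
  · rw [sq, Ideal.span_mul_span', Ideal.span_le]
    rintro _ ⟨_, ⟨i, hi, rfl⟩, _, ⟨j, hj, rfl⟩, rfl⟩
    obtain hij | hij := le_total i j
    · exact mul_mem_span_pair_mul_span m y hy i j hij hj
    · beta_reduce
      rw [mul_comm (y i)]
      exact mul_mem_span_pair_mul_span m y hy j i hij hi
  · rw [sq]
    refine Ideal.mul_mono_left (Ideal.span_mono ?_)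
    rintro a (rfl | rfl)
    exacts [⟨0, m.zero_le, rfl⟩, ⟨m, le_rfl, rfl⟩]

/-- **Example 4.1, setup for (2).**  Let `n ≥ 3`, `S = k[X 0, …, X n]`, `𝔞` the
ideal of 2×2 minors of the matrix with rows `(X 0, …, X (n-1))` and
`(X 1, …, X n)`, and `A = S/𝔞` with `x i` the image of `X i`.  For
`J = (x 0, x 1, …, x (n-1))` and `Q = (x 0, x (n-1))` one has `J² = Q·J`. -/
theorem J_sq_eq (n : ℕ) (hn : 3 ≤ n) (k : Type*) [Field k]
    (𝔞 : Ideal (MvPolynomial (Fin (n + 1)) k))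
    (h𝔞 : 𝔞 = Ideal.span {f | ∃ (i j : ℕ) (hij : i < j) (hj : j + 1 ≤ n),
      f = X (⟨i, by omega⟩ : Fin (n + 1)) * X (⟨j + 1, by omega⟩ : Fin (n + 1))
        - X (⟨i + 1, by omega⟩ : Fin (n + 1)) * X (⟨j, by omega⟩ : Fin (n + 1))})
    (x : Fin (n + 1) → MvPolynomial (Fin (n + 1)) k ⧸ 𝔞)
    (hx : ∀ i, x i = Ideal.Quotient.mk 𝔞 (X i))
    (J Q : Ideal (MvPolynomial (Fin (n + 1)) k ⧸ 𝔞))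
    (hJ : J = Ideal.span {y | ∃ (i : ℕ) (hi : i ≤ n - 1), y = x ⟨i, by omega⟩})
    (hQ : Q = Ideal.span {x ⟨0, by omega⟩, x ⟨n - 1, by omega⟩}) :
    J ^ 2 = Q * J := by
  let y : ℕ → MvPolynomial (Fin (n + 1)) k ⧸ 𝔞 := fun i ↦ if h : i < n + 1 then x ⟨i, h⟩ else 0
  have hyx (i : ℕ) (h : i < n + 1) : y i = x ⟨i, h⟩ := dif_pos h
  have hy : ∀ i j, i < j → j + 1 ≤ n - 1 → y i * y (j + 1) = y (i + 1) * y j := by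
    intro i j hij hj
    rw [hyx i (by omega), hyx (j + 1) (by omega), hyx (i + 1) (by omega), hyx j (by omega),
      hx, hx, hx, hx, ← map_mul, ← map_mul, Ideal.Quotient.eq]
    exact h𝔞.ge (Ideal.subset_span ⟨i, j, hij, by omega, rfl⟩)
  have hJy : J = Ideal.span {a | ∃ i ≤ n - 1, a = y i} := by
    rw [hJ]
    congr 1
    ext a
    constructor
    · rintro ⟨i, hi, rfl⟩
      exact ⟨i, hi, (hyx i _).symm⟩
    · rintro ⟨i, hi, rfl⟩
      exact ⟨i, hi, hyx i _⟩
  have hQy : Q = Ideal.span {y 0, y (n - 1)} := by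
    rw [hQ, hyx 0 (by omega), hyx (n - 1) (by omega)]
  rw [hJy, hQy]
  exact span_sq_eq_span_pair_mul_span (n - 1) y hy
end

section
/- Let n ≥ 3, let k be a field, and let B = k[s, t] be the polynomial ring in two variables. Then the monomial (s^{n−2} t)^{n−2} does not belong to the ideal (s^{n−1}, t^{n−1}) · (s^{n−1}, s^{n−2} t, t^{n−1})^{n−3} of B. -/
open MvPolynomial

/-- Modulo `d`, a product of `(a * b, d)` with the `j`-th power of `(b * c, b * e, d)` is
divisible by `a * b ^ (j + 1)`. -/
theorem span_pair_mul_span_triple_pow_le {R : Type*} [CommRing R] (a b c d e : R) (j : ℕ) :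
    Ideal.span {a * b, d} * Ideal.span {b * c, b * e, d} ^ j ≤
      Ideal.span {a * b ^ (j + 1), d} := by
  induction j with
  | zero => simp
  | succ j ih =>
    rw [pow_succ, ← mul_assoc]
    refine (Ideal.mul_mono_left ih).trans ?_
    rw [Ideal.span_mul_span', Ideal.span_le]
    rintro _ ⟨x, hx, y, hy, rfl⟩
    simp only [Set.mem_insert_iff, Set.mem_singleton_iff] at hx hy
    refine Ideal.mem_span_pair.mpr ?_
    rcases hx with rfl | rfl
    · rcases hy with rfl | rfl | rfl
      · exact ⟨c, 0, by ring⟩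
      · exact ⟨e, 0, by ring⟩
      · exact ⟨0, a * b ^ (j + 1), by ring⟩
    · exact ⟨0, y, by ring⟩

/-- A monomial `s ^ p * t ^ q` with `p < u` and `q < v` does not lie in `(s ^ u, t ^ v)`. -/
theorem X_pow_mul_X_pow_notMem_span_pair {k : Type*} [Field k] {p q u v : ℕ}
    (hp : p < u) (hq : q < v) :
    (X 0 ^ p * X 1 ^ q : MvPolynomial (Fin 2) k) ∉ Ideal.span {X 0 ^ u, X 1 ^ v} := by
  intro h
  obtain ⟨f, g, hfg⟩ := Ideal.mem_span_pair.mp h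
  have hc := congrArg (coeff (Finsupp.single 0 p + Finsupp.single 1 q)) hfg
  simp only [X_pow_eq_monomial, coeff_add, coeff_mul_monomial', monomial_mul, coeff_monomial] at hc
  rw [if_neg fun hle => ?_, if_neg fun hle => ?_] at hc
  · simp at hc
  · have := hle 1
    simp at this
    omega
  · have := hle 0
    simp at this
    omega

/-- In `B = k[s, t]` (with `s = X 0`, `t = X 1`), for `n ≥ 3` the monomial
`(s^(n-2)·t)^(n-2)` does not lie in the ideal
`(s^(n-1), t^(n-1)) · (s^(n-1), s^(n-2)·t, t^(n-1))^(n-3)`. -/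
theorem monomial_not_mem (n : ℕ) (hn : 3 ≤ n) (k : Type*) [Field k] :
    (X 0 ^ (n - 2) * X 1) ^ (n - 2) ∉
      Ideal.span {(X 0 ^ (n - 1) : MvPolynomial (Fin 2) k), X 1 ^ (n - 1)} *
        (Ideal.span {(X 0 ^ (n - 1) : MvPolynomial (Fin 2) k),
          X 0 ^ (n - 2) * X 1, X 1 ^ (n - 1)}) ^ (n - 3) := by
  obtain ⟨j, rfl⟩ := Nat.exists_eq_add_of_le' hn
  simp only [Nat.add_sub_cancel, show j + 3 - 2 = j + 1 by omega, show j + 3 - 1 = j + 2 by omega]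
  intro h
  have hle := span_pair_mul_span_triple_pow_le (X 0 : MvPolynomial (Fin 2) k) (X 0 ^ (j + 1))
    (X 0) (X 1 ^ (j + 2)) (X 1) j
  rw [← pow_succ', ← pow_succ, ← pow_mul, ← pow_succ'] at hle
  have hmem := hle h
  rw [mul_pow, ← pow_mul] at hmem
  exact X_pow_mul_X_pow_notMem_span_pair (Nat.lt_succ_self _) (Nat.lt_succ_self _) hmem
end
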